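/- Substitution property of the self-translation, value into stoup-typed term: if Γ, x:A | z:D̲ ⊢ t : B̲ and Γ ⊢ u : A are derivable in EEC, then Γᶜ | k_z:B̲ᶜ ⊢ (t[u/x])ᶜ = tᶜ[uᶜ/x] : D̲ᶜ in the equational theory of EEC. -/

import Mathlib

set_option autoImplicit false

namespace EEC

/-! # The enriched effect calculus (EEC)

A deep embedding of the enriched effect calculus of Egger, Møgelberg and
Simpson: value types and computation types, raw terms (de Bruijn indices for
value variables, together with a designated stoup variable `svar`), typing
derivations with an (at most singleton) stoup, the βη-equational theory, the
simply-typed λ-calculus together with βη-equality and Moggi's computational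
λ-calculus equality, the standard cbv/cbn translations of typed λ-calculus
into EEC, Hasegawa's linear-use CPS translations, and the generic linear-use
CPS self-translation of EEC. -/

mutual
  /-- Value types of EEC. -/
  inductive VType : Type
    | base : ℕ → VType                 -- value type constants α
    | unit : VType                     -- 1
    | prod : VType → VType → VType     -- A × B
    | arr : VType → VType → VType      -- A → B
    | comp : CType → VType             -- every computation type is a value type
    | lin : CType → CType → VType      -- A̲ ⊸ B̲
  /-- Computation types of EEC. -/
  inductive CType : Type
    | base : ℕ → CType                 -- computation type constants α̲
    | cunit : CType                    -- 1̲
    | cand : CType → CType → CType     -- A̲ & B̲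
    | carr : VType → CType → CType     -- A ⇒ B̲
    | iunit : CType                    -- I̲
    | bang : VType → CType             -- !A
    | copow : VType → CType → CType    -- !A ⊗ B̲
    | czero : CType                    -- 0̲
    | csum : CType → CType → CType     -- A̲ ⊕ B̲
end

/-- Raw terms of EEC.  Value variables are de Bruijn indices (`var n`, with
`var 0` the innermost bound variable); the unique stoup variable is `svar`
(the constructs `llam`, `copowlet` (in its body) and `ccase` (in its
branches) bind the stoup variable). -/
inductive Tm : Type
  | var : ℕ → Tm                -- value variable
  | svar : Tm                   -- the stoup variable
  | unit : Tm                   -- * : 1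
  | vpair : Tm → Tm → Tm        -- ⟨t,u⟩
  | vfst : Tm → Tm
  | vsnd : Tm → Tm
  | vlam : VType → Tm → Tm      -- λx:A. t
  | vapp : Tm → Tm → Tm
  | cunit : Tm                  -- ⋆ : 1̲
  | cpair : Tm → Tm → Tm        -- ⟨t,u⟩ : A̲ & B̲
  | cfst : Tm → Tm
  | csnd : Tm → Tm
  | clam : VType → Tm → Tm      -- λx:A ⇒ t
  | capp : Tm → Tm → Tm         -- s ⋅ t
  | top : Tm                    -- ⊤ : I̲
  | ilet : Tm → Tm → Tm         -- t to ⊤. u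
  | bang : Tm → Tm              -- !t
  | banglet : Tm → Tm → Tm      -- let !x = t in u   (binds a value variable in u)
  | copow : Tm → Tm → Tm        -- !t ⊗ u
  | copowlet : Tm → Tm → Tm     -- let !x⊗y = s in t (binds a value variable and the stoup variable in t)
  | cimage : CType → Tm → Tm    -- image_{A̲}(t)
  | cinl : Tm → Tm
  | cinr : Tm → Tm
  | ccase : Tm → Tm → Tm → Tm   -- case s of (x. t | y. u)  (branches bind the stoup variable)
  | llam : CType → Tm → Tm      -- λ°z:A̲. t (binds the stoup variable)
  | lapp : Tm → Tm → Tm         -- s[t]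

namespace Tm

/-- Lift a renaming of value variables under a binder. -/
def liftN (f : ℕ → ℕ) : ℕ → ℕ
  | 0 => 0
  | n + 1 => f n + 1

/-- Renaming of value variables. -/
def rename (f : ℕ → ℕ) : Tm → Tm
  | .var n => .var (f n)
  | .svar => .svar
  | .unit => .unit
  | .vpair t u => .vpair (rename f t) (rename f u)
  | .vfst t => .vfst (rename f t)
  | .vsnd t => .vsnd (rename f t)
  | .vlam A t => .vlam A (rename (liftN f) t)
  | .vapp s t => .vapp (rename f s) (rename f t)
  | .cunit => .cunit
  | .cpair t u => .cpair (rename f t) (rename f u)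
  | .cfst t => .cfst (rename f t)
  | .csnd t => .csnd (rename f t)
  | .clam A t => .clam A (rename (liftN f) t)
  | .capp s t => .capp (rename f s) (rename f t)
  | .top => .top
  | .ilet t u => .ilet (rename f t) (rename f u)
  | .bang t => .bang (rename f t)
  | .banglet t u => .banglet (rename f t) (rename (liftN f) u)
  | .copow t u => .copow (rename f t) (rename f u)
  | .copowlet s t => .copowlet (rename f s) (rename (liftN f) t)
  | .cimage A t => .cimage A (rename f t)
  | .cinl t => .cinl (rename f t)
  | .cinr t => .cinr (rename f t)
  | .ccase s t u => .ccase (rename f s) (rename f t) (rename f u)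
  | .llam A t => .llam A (rename f t)
  | .lapp s t => .lapp (rename f s) (rename f t)

/-- Weakening of value variables. -/
def shift (t : Tm) : Tm := rename Nat.succ t

/-- Lift a parallel substitution of value variables under a binder. -/
def liftS (σ : ℕ → Tm) : ℕ → Tm
  | 0 => .var 0
  | n + 1 => shift (σ n)

/-- Parallel (capture-avoiding) substitution for value variables. -/
def psubst (σ : ℕ → Tm) : Tm → Tm
  | .var n => σ n
  | .svar => .svar
  | .unit => .unit
  | .vpair t u => .vpair (psubst σ t) (psubst σ u)
  | .vfst t => .vfst (psubst σ t)
  | .vsnd t => .vsnd (psubst σ t)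
  | .vlam A t => .vlam A (psubst (liftS σ) t)
  | .vapp s t => .vapp (psubst σ s) (psubst σ t)
  | .cunit => .cunit
  | .cpair t u => .cpair (psubst σ t) (psubst σ u)
  | .cfst t => .cfst (psubst σ t)
  | .csnd t => .csnd (psubst σ t)
  | .clam A t => .clam A (psubst (liftS σ) t)
  | .capp s t => .capp (psubst σ s) (psubst σ t)
  | .top => .top
  | .ilet t u => .ilet (psubst σ t) (psubst σ u)
  | .bang t => .bang (psubst σ t)
  | .banglet t u => .banglet (psubst σ t) (psubst (liftS σ) u)
  | .copow t u => .copow (psubst σ t) (psubst σ u)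
  | .copowlet s t => .copowlet (psubst σ s) (psubst (liftS σ) t)
  | .cimage A t => .cimage A (psubst σ t)
  | .cinl t => .cinl (psubst σ t)
  | .cinr t => .cinr (psubst σ t)
  | .ccase s t u => .ccase (psubst σ s) (psubst σ t) (psubst σ u)
  | .llam A t => .llam A (psubst σ t)
  | .lapp s t => .lapp (psubst σ s) (psubst σ t)

/-- Capture-avoiding substitution `t[u/x]` of a term `u` for the innermost
value variable of `t`. -/
def subst0 (u : Tm) (t : Tm) : Tm :=
  psubst (fun n => match n with | 0 => u | m + 1 => .var m) t

/-- Capture-avoiding substitution `t[u/z]` of a term `u` for the stoup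
variable of `t`.  The substitution stops at the stoup-variable binders
(`llam`-bodies, `copowlet`-bodies and `ccase`-branches). -/
def ssubst (u : Tm) : Tm → Tm
  | .var n => .var n
  | .svar => u
  | .unit => .unit
  | .vpair t t' => .vpair (ssubst u t) (ssubst u t')
  | .vfst t => .vfst (ssubst u t)
  | .vsnd t => .vsnd (ssubst u t)
  | .vlam A t => .vlam A (ssubst (shift u) t)
  | .vapp s t => .vapp (ssubst u s) (ssubst u t)
  | .cunit => .cunit
  | .cpair t t' => .cpair (ssubst u t) (ssubst u t')
  | .cfst t => .cfst (ssubst u t)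
  | .csnd t => .csnd (ssubst u t)
  | .clam A t => .clam A (ssubst (shift u) t)
  | .capp s t => .capp (ssubst u s) (ssubst u t)
  | .top => .top
  | .ilet t t' => .ilet (ssubst u t) (ssubst u t')
  | .bang t => .bang (ssubst u t)
  | .banglet t t' => .banglet (ssubst u t) (ssubst (shift u) t')
  | .copow t t' => .copow (ssubst u t) (ssubst u t')
  | .copowlet s t => .copowlet (ssubst u s) t
  | .cimage A t => .cimage A (ssubst u t)
  | .cinl t => .cinl (ssubst u t)
  | .cinr t => .cinr (ssubst u t)
  | .ccase s t t' => .ccase (ssubst u s) t t'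
  | .llam A t => .llam A t
  | .lapp s t => .lapp (ssubst u s) (ssubst u t)

end Tm

/-- Typing derivations of EEC (Figure 1 of the paper).  `Deriv Γ none t A`
is the judgement `Γ ⊢ t : A` (empty stoup); `Deriv Γ (some A̲) t (.comp B̲)`
is the judgement `Γ | z:A̲ ⊢ t : B̲`.  In the rules below `Δ` ranges over an
arbitrary (possibly empty) stoup. -/
inductive Deriv : List VType → Option CType → Tm → VType → Type
  | var (Γ : List VType) (n : ℕ) (A : VType) :
      Γ[n]? = some A → Deriv Γ none (.var n) A
  | svar (Γ : List VType) (A : CType) : Deriv Γ (some A) .svar (.comp A)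
  | unit (Γ : List VType) : Deriv Γ none .unit .unit
  | vpair (Γ : List VType) (t u : Tm) (A B : VType) :
      Deriv Γ none t A → Deriv Γ none u B → Deriv Γ none (.vpair t u) (.prod A B)
  | vfst (Γ : List VType) (t : Tm) (A B : VType) :
      Deriv Γ none t (.prod A B) → Deriv Γ none (.vfst t) A
  | vsnd (Γ : List VType) (t : Tm) (A B : VType) :
      Deriv Γ none t (.prod A B) → Deriv Γ none (.vsnd t) B
  | vlam (Γ : List VType) (t : Tm) (A B : VType) :
      Deriv (A :: Γ) none t B → Deriv Γ none (.vlam A t) (.arr A B)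
  | vapp (Γ : List VType) (s t : Tm) (A B : VType) :
      Deriv Γ none s (.arr A B) → Deriv Γ none t A → Deriv Γ none (.vapp s t) B
  | cunit (Γ : List VType) (Δ : Option CType) : Deriv Γ Δ .cunit (.comp .cunit)
  | cpair (Γ : List VType) (Δ : Option CType) (t u : Tm) (A B : CType) :
      Deriv Γ Δ t (.comp A) → Deriv Γ Δ u (.comp B) →
      Deriv Γ Δ (.cpair t u) (.comp (.cand A B))
  | cfst (Γ : List VType) (Δ : Option CType) (t : Tm) (A B : CType) :
      Deriv Γ Δ t (.comp (.cand A B)) → Deriv Γ Δ (.cfst t) (.comp A)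
  | csnd (Γ : List VType) (Δ : Option CType) (t : Tm) (A B : CType) :
      Deriv Γ Δ t (.comp (.cand A B)) → Deriv Γ Δ (.csnd t) (.comp B)
  | clam (Γ : List VType) (Δ : Option CType) (t : Tm) (A : VType) (B : CType) :
      Deriv (A :: Γ) Δ t (.comp B) → Deriv Γ Δ (.clam A t) (.comp (.carr A B))
  | capp (Γ : List VType) (Δ : Option CType) (s t : Tm) (A : VType) (B : CType) :
      Deriv Γ Δ s (.comp (.carr A B)) → Deriv Γ none t A →
      Deriv Γ Δ (.capp s t) (.comp B)
  | top (Γ : List VType) : Deriv Γ none .top (.comp .iunit)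
  | ilet (Γ : List VType) (Δ : Option CType) (t u : Tm) (A : CType) :
      Deriv Γ Δ t (.comp .iunit) → Deriv Γ none u (.comp A) →
      Deriv Γ Δ (.ilet t u) (.comp A)
  | bang (Γ : List VType) (t : Tm) (A : VType) :
      Deriv Γ none t A → Deriv Γ none (.bang t) (.comp (.bang A))
  | banglet (Γ : List VType) (Δ : Option CType) (t u : Tm) (A : VType) (B : CType) :
      Deriv Γ Δ t (.comp (.bang A)) → Deriv (A :: Γ) none u (.comp B) →
      Deriv Γ Δ (.banglet t u) (.comp B)
  | copow (Γ : List VType) (Δ : Option CType) (t u : Tm) (A : VType) (B : CType) :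
      Deriv Γ none t A → Deriv Γ Δ u (.comp B) →
      Deriv Γ Δ (.copow t u) (.comp (.copow A B))
  | copowlet (Γ : List VType) (Δ : Option CType) (s t : Tm) (A : VType) (B C : CType) :
      Deriv Γ Δ s (.comp (.copow A B)) → Deriv (A :: Γ) (some B) t (.comp C) →
      Deriv Γ Δ (.copowlet s t) (.comp C)
  | cimage (Γ : List VType) (Δ : Option CType) (t : Tm) (A : CType) :
      Deriv Γ Δ t (.comp .czero) → Deriv Γ Δ (.cimage A t) (.comp A)
  | cinl (Γ : List VType) (Δ : Option CType) (t : Tm) (A B : CType) :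
      Deriv Γ Δ t (.comp A) → Deriv Γ Δ (.cinl t) (.comp (.csum A B))
  | cinr (Γ : List VType) (Δ : Option CType) (t : Tm) (A B : CType) :
      Deriv Γ Δ t (.comp B) → Deriv Γ Δ (.cinr t) (.comp (.csum A B))
  | ccase (Γ : List VType) (Δ : Option CType) (s t u : Tm) (A B C : CType) :
      Deriv Γ Δ s (.comp (.csum A B)) → Deriv Γ (some A) t (.comp C) →
      Deriv Γ (some B) u (.comp C) → Deriv Γ Δ (.ccase s t u) (.comp C)
  | llam (Γ : List VType) (t : Tm) (A B : CType) :
      Deriv Γ (some A) t (.comp B) → Deriv Γ none (.llam A t) (.lin A B)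
  | lapp (Γ : List VType) (Δ : Option CType) (s t : Tm) (A B : CType) :
      Deriv Γ none s (.lin A B) → Deriv Γ Δ t (.comp A) →
      Deriv Γ Δ (.lapp s t) (.comp B)

/-- The equational theory of EEC: the smallest type-respecting congruence
containing the βη-equalities of Figure 2 of the paper. -/
inductive EEq : List VType → Option CType → Tm → Tm → VType → Prop
  -- equivalence
  | refl {Γ Δ t A} : Deriv Γ Δ t A → EEq Γ Δ t t A
  | symm {Γ Δ t u A} : EEq Γ Δ t u A → EEq Γ Δ u t A
  | trans {Γ Δ t u v A} : EEq Γ Δ t u A → EEq Γ Δ u v A → EEq Γ Δ t v A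
  -- congruence rules
  | vpair_cong {Γ t t' u u' A B} : EEq Γ none t t' A → EEq Γ none u u' B →
      EEq Γ none (.vpair t u) (.vpair t' u') (.prod A B)
  | vfst_cong {Γ t t' A B} : EEq Γ none t t' (.prod A B) →
      EEq Γ none (.vfst t) (.vfst t') A
  | vsnd_cong {Γ t t' A B} : EEq Γ none t t' (.prod A B) →
      EEq Γ none (.vsnd t) (.vsnd t') B
  | vlam_cong {Γ t t' A B} : EEq (A :: Γ) none t t' B →
      EEq Γ none (.vlam A t) (.vlam A t') (.arr A B)
  | vapp_cong {Γ s s' t t' A B} : EEq Γ none s s' (.arr A B) → EEq Γ none t t' A →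
      EEq Γ none (.vapp s t) (.vapp s' t') B
  | cpair_cong {Γ Δ t t' u u' A B} : EEq Γ Δ t t' (.comp A) → EEq Γ Δ u u' (.comp B) →
      EEq Γ Δ (.cpair t u) (.cpair t' u') (.comp (.cand A B))
  | cfst_cong {Γ Δ t t' A B} : EEq Γ Δ t t' (.comp (.cand A B)) →
      EEq Γ Δ (.cfst t) (.cfst t') (.comp A)
  | csnd_cong {Γ Δ t t' A B} : EEq Γ Δ t t' (.comp (.cand A B)) →
      EEq Γ Δ (.csnd t) (.csnd t') (.comp B)
  | clam_cong {Γ Δ t t' A B} : EEq (A :: Γ) Δ t t' (.comp B) →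
      EEq Γ Δ (.clam A t) (.clam A t') (.comp (.carr A B))
  | capp_cong {Γ Δ s s' t t' A B} : EEq Γ Δ s s' (.comp (.carr A B)) → EEq Γ none t t' A →
      EEq Γ Δ (.capp s t) (.capp s' t') (.comp B)
  | ilet_cong {Γ Δ t t' u u' A} : EEq Γ Δ t t' (.comp .iunit) → EEq Γ none u u' (.comp A) →
      EEq Γ Δ (.ilet t u) (.ilet t' u') (.comp A)
  | bang_cong {Γ t t' A} : EEq Γ none t t' A →
      EEq Γ none (.bang t) (.bang t') (.comp (.bang A))
  | banglet_cong {Γ Δ t t' u u' A B} : EEq Γ Δ t t' (.comp (.bang A)) →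
      EEq (A :: Γ) none u u' (.comp B) →
      EEq Γ Δ (.banglet t u) (.banglet t' u') (.comp B)
  | copow_cong {Γ Δ t t' u u' A B} : EEq Γ none t t' A → EEq Γ Δ u u' (.comp B) →
      EEq Γ Δ (.copow t u) (.copow t' u') (.comp (.copow A B))
  | copowlet_cong {Γ Δ s s' t t' A B C} : EEq Γ Δ s s' (.comp (.copow A B)) →
      EEq (A :: Γ) (some B) t t' (.comp C) →
      EEq Γ Δ (.copowlet s t) (.copowlet s' t') (.comp C)
  | cimage_cong {Γ Δ t t' A} : EEq Γ Δ t t' (.comp .czero) →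
      EEq Γ Δ (.cimage A t) (.cimage A t') (.comp A)
  | cinl_cong {Γ Δ t t' A B} : EEq Γ Δ t t' (.comp A) →
      EEq Γ Δ (.cinl t) (.cinl t') (.comp (.csum A B))
  | cinr_cong {Γ Δ t t' A B} : EEq Γ Δ t t' (.comp B) →
      EEq Γ Δ (.cinr t) (.cinr t') (.comp (.csum A B))
  | ccase_cong {Γ Δ s s' t t' u u' A B C} : EEq Γ Δ s s' (.comp (.csum A B)) →
      EEq Γ (some A) t t' (.comp C) → EEq Γ (some B) u u' (.comp C) →
      EEq Γ Δ (.ccase s t u) (.ccase s' t' u') (.comp C)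
  | llam_cong {Γ t t' A B} : EEq Γ (some A) t t' (.comp B) →
      EEq Γ none (.llam A t) (.llam A t') (.lin A B)
  | lapp_cong {Γ Δ s s' t t' A B} : EEq Γ none s s' (.lin A B) → EEq Γ Δ t t' (.comp A) →
      EEq Γ Δ (.lapp s t) (.lapp s' t') (.comp B)
  -- the equalities of Figure 2
  | unit_eta {Γ t} : Deriv Γ none t .unit → EEq Γ none t .unit .unit
  | vfst_beta {Γ t u A B} : Deriv Γ none t A → Deriv Γ none u B →
      EEq Γ none (.vfst (.vpair t u)) t A
  | vsnd_beta {Γ t u A B} : Deriv Γ none t A → Deriv Γ none u B →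
      EEq Γ none (.vsnd (.vpair t u)) u B
  | vpair_eta {Γ t A B} : Deriv Γ none t (.prod A B) →
      EEq Γ none (.vpair (.vfst t) (.vsnd t)) t (.prod A B)
  | vlam_beta {Γ t u A B} : Deriv (A :: Γ) none t B → Deriv Γ none u A →
      EEq Γ none (.vapp (.vlam A t) u) (Tm.subst0 u t) B
  | vlam_eta {Γ t A B} : Deriv Γ none t (.arr A B) →
      EEq Γ none (.vlam A (.vapp (Tm.shift t) (.var 0))) t (.arr A B)
  | cunit_eta {Γ Δ t} : Deriv Γ Δ t (.comp .cunit) → EEq Γ Δ t .cunit (.comp .cunit)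
  | cfst_beta {Γ Δ t u A B} : Deriv Γ Δ t (.comp A) → Deriv Γ Δ u (.comp B) →
      EEq Γ Δ (.cfst (.cpair t u)) t (.comp A)
  | csnd_beta {Γ Δ t u A B} : Deriv Γ Δ t (.comp A) → Deriv Γ Δ u (.comp B) →
      EEq Γ Δ (.csnd (.cpair t u)) u (.comp B)
  | cpair_eta {Γ Δ t A B} : Deriv Γ Δ t (.comp (.cand A B)) →
      EEq Γ Δ (.cpair (.cfst t) (.csnd t)) t (.comp (.cand A B))
  | clam_beta {Γ Δ t u A B} : Deriv (A :: Γ) Δ t (.comp B) → Deriv Γ none u A →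
      EEq Γ Δ (.capp (.clam A t) u) (Tm.subst0 u t) (.comp B)
  | clam_eta {Γ Δ t A B} : Deriv Γ Δ t (.comp (.carr A B)) →
      EEq Γ Δ (.clam A (.capp (Tm.shift t) (.var 0))) t (.comp (.carr A B))
  | ilet_beta {Γ t A} : Deriv Γ none t (.comp A) →
      EEq Γ none (.ilet .top t) t (.comp A)
  | ilet_eta {Γ Δ t u A} : Deriv Γ Δ t (.comp .iunit) → Deriv Γ (some .iunit) u (.comp A) →
      EEq Γ Δ (.ilet t (Tm.ssubst .top u)) (Tm.ssubst t u) (.comp A)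
  | bang_beta {Γ t u A B} : Deriv Γ none t A → Deriv (A :: Γ) none u (.comp B) →
      EEq Γ none (.banglet (.bang t) u) (Tm.subst0 t u) (.comp B)
  | bang_eta {Γ Δ t u A B} : Deriv Γ Δ t (.comp (.bang A)) →
      Deriv Γ (some (.bang A)) u (.comp B) →
      EEq Γ Δ (.banglet t (Tm.ssubst (.bang (.var 0)) (Tm.shift u))) (Tm.ssubst t u) (.comp B)
  | copow_beta {Γ Δ t s u A B C} : Deriv Γ none t A → Deriv Γ Δ s (.comp B) →
      Deriv (A :: Γ) (some B) u (.comp C) →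
      EEq Γ Δ (.copowlet (.copow t s) u) (Tm.ssubst s (Tm.subst0 t u)) (.comp C)
  | copow_eta {Γ Δ t u A B C} : Deriv Γ Δ t (.comp (.copow A B)) →
      Deriv Γ (some (.copow A B)) u (.comp C) →
      EEq Γ Δ (.copowlet t (Tm.ssubst (.copow (.var 0) .svar) (Tm.shift u))) (Tm.ssubst t u) (.comp C)
  | czero_eta {Γ Δ t u A} : Deriv Γ Δ t (.comp .czero) → Deriv Γ (some .czero) u (.comp A) →
      EEq Γ Δ (.cimage A t) (Tm.ssubst t u) (.comp A)
  | csum_beta_inl {Γ Δ t u u' A B C} : Deriv Γ (some A) u (.comp C) →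
      Deriv Γ (some B) u' (.comp C) → Deriv Γ Δ t (.comp A) →
      EEq Γ Δ (.ccase (.cinl t) u u') (Tm.ssubst t u) (.comp C)
  | csum_beta_inr {Γ Δ t u u' A B C} : Deriv Γ (some A) u (.comp C) →
      Deriv Γ (some B) u' (.comp C) → Deriv Γ Δ t (.comp B) →
      EEq Γ Δ (.ccase (.cinr t) u u') (Tm.ssubst t u') (.comp C)
  | csum_eta {Γ Δ t u A B C} : Deriv Γ Δ t (.comp (.csum A B)) →
      Deriv Γ (some (.csum A B)) u (.comp C) →
      EEq Γ Δ (.ccase t (Tm.ssubst (.cinl .svar) u) (Tm.ssubst (.cinr .svar) u)) (Tm.ssubst t u) (.comp C)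
  | llam_beta {Γ Δ t u A B} : Deriv Γ (some A) t (.comp B) → Deriv Γ Δ u (.comp A) →
      EEq Γ Δ (.lapp (.llam A t) u) (Tm.ssubst u t) (.comp B)
  | llam_eta {Γ t A B} : Deriv Γ none t (.lin A B) →
      EEq Γ none (.llam A (.lapp t .svar)) t (.lin A B)

end EEC

namespace EEC

/-! ## The generic linear-use CPS self-translation of EEC (Figures 4–6) -/

mutual
  /-- CPS translation `Aᶜ` of value types, relative to the result type `R̲`. -/
  def cpsV (R : CType) : VType → VType
    | .base a => .base a
    | .unit => .unit
    | .prod A B => .prod (cpsV R A) (cpsV R B)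
    | .arr A B => .arr (cpsV R A) (cpsV R B)
    | .comp A => .lin (cpsC R A) R
    | .lin A B => .lin (cpsC R B) (cpsC R A)
  /-- CPS translation `A̲ᶜ` of computation types, relative to the result type
  `R̲` (a computation-type constant equal to `R̲` is translated to `I̲`). -/
  def cpsC (R : CType) : CType → CType
    | .base a =>
        match R with
        | .base b => if b = a then .iunit else .base a
        | _ => .base a
    | .cunit => .czero
    | .cand A B => .csum (cpsC R A) (cpsC R B)
    | .carr A B => .copow (cpsV R A) (cpsC R B)
    | .iunit => R
    | .bang A => .carr (cpsV R A) R
    | .copow A B => .carr (cpsV R A) (cpsC R B)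
    | .czero => .cunit
    | .csum A B => .cand (cpsC R A) (cpsC R B)
end

/-- Pointwise CPS translation `Γᶜ` of a context. -/
def cpsCtx (R : CType) (Γ : List VType) : List VType := Γ.map (cpsV R)

/-- The generic linear-use CPS self-translation on terms (Figures 5 and 6 of
the paper), defined by recursion on typing derivations.  A value judgement
`Γ ⊢ t : A` is sent to a term `tᶜ` with `Γᶜ ⊢ tᶜ : Aᶜ`, and a stoup
judgement `Γ | z:A̲ ⊢ t : B̲` is sent (contravariantly) to a term `tᶜ` with
`Γᶜ | k_z:B̲ᶜ ⊢ tᶜ : A̲ᶜ`. -/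
def cps (R : CType) : {Γ : List VType} → {Δ : Option CType} → {t : Tm} → {A : VType} →
    Deriv Γ Δ t A → Tm
  | _, _, _, _, .var _ n _ _ => .var n
  | _, _, _, _, .svar _ _ => .svar
  | _, _, _, _, .unit _ => .unit
  | _, _, _, _, .vpair _ _ _ _ _ d1 d2 => .vpair (cps R d1) (cps R d2)
  | _, _, _, _, .vfst _ _ _ _ d => .vfst (cps R d)
  | _, _, _, _, .vsnd _ _ _ _ d => .vsnd (cps R d)
  | _, _, _, _, .vlam _ _ A _ d => .vlam (cpsV R A) (cps R d)
  | _, _, _, _, .vapp _ _ _ _ _ d1 d2 => .vapp (cps R d1) (cps R d2)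
  | _, _, _, _, .cunit _ none => .llam .czero (.cimage R .svar)
  | _, _, _, _, .cunit _ (some D) => .cimage (cpsC R D) .svar
  | _, _, _, _, .cpair _ none _ _ A B d1 d2 =>
      .llam (.csum (cpsC R A) (cpsC R B))
        (.ccase .svar (.lapp (cps R d1) .svar) (.lapp (cps R d2) .svar))
  | _, _, _, _, .cpair _ (some _) _ _ _ _ d1 d2 => .ccase .svar (cps R d1) (cps R d2)
  | _, _, _, _, .cfst _ none _ A _ d => .llam (cpsC R A) (.lapp (cps R d) (.cinl .svar))
  | _, _, _, _, .cfst _ (some _) _ _ _ d => Tm.ssubst (.cinl .svar) (cps R d)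
  | _, _, _, _, .csnd _ none _ _ B d => .llam (cpsC R B) (.lapp (cps R d) (.cinr .svar))
  | _, _, _, _, .csnd _ (some _) _ _ _ d => Tm.ssubst (.cinr .svar) (cps R d)
  | _, _, _, _, .clam _ none _ A B d =>
      .llam (.copow (cpsV R A) (cpsC R B)) (.copowlet .svar (.lapp (cps R d) .svar))
  | _, _, _, _, .clam _ (some _) _ _ _ d => .copowlet .svar (cps R d)
  | _, _, _, _, .capp _ none _ _ _ B d1 d2 =>
      .llam (cpsC R B) (.lapp (cps R d1) (.copow (cps R d2) .svar))
  | _, _, _, _, .capp _ (some _) _ _ _ _ d1 d2 =>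
      Tm.ssubst (.copow (cps R d2) .svar) (cps R d1)
  | _, _, _, _, .top _ => .llam R .svar
  | _, _, _, _, .ilet _ none _ _ A d1 d2 =>
      .llam (cpsC R A) (.lapp (cps R d1) (.lapp (cps R d2) .svar))
  | _, _, _, _, .ilet _ (some _) _ _ _ d1 d2 =>
      Tm.ssubst (.lapp (cps R d2) .svar) (cps R d1)
  | _, _, _, _, .bang _ _ A d => .llam (.carr (cpsV R A) R) (.capp .svar (cps R d))
  | _, _, _, _, .banglet _ none _ _ A B d1 d2 =>
      .llam (cpsC R B) (.lapp (cps R d1) (.clam (cpsV R A) (.lapp (cps R d2) .svar)))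
  | _, _, _, _, .banglet _ (some _) _ _ A _ d1 d2 =>
      Tm.ssubst (.clam (cpsV R A) (.lapp (cps R d2) .svar)) (cps R d1)
  | _, _, _, _, .copow _ none _ _ A B d1 d2 =>
      .llam (.carr (cpsV R A) (cpsC R B)) (.lapp (cps R d2) (.capp .svar (cps R d1)))
  | _, _, _, _, .copow _ (some _) _ _ _ _ d1 d2 =>
      Tm.ssubst (.capp .svar (cps R d1)) (cps R d2)
  | _, _, _, _, .copowlet _ none _ _ A _ C d1 d2 =>
      .llam (cpsC R C) (.lapp (cps R d1) (.clam (cpsV R A) (cps R d2)))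
  | _, _, _, _, .copowlet _ (some _) _ _ A _ _ d1 d2 =>
      Tm.ssubst (.clam (cpsV R A) (cps R d2)) (cps R d1)
  | _, _, _, _, .cimage _ none _ A d => .llam (cpsC R A) (.lapp (cps R d) .cunit)
  | _, _, _, _, .cimage _ (some _) _ _ d => Tm.ssubst .cunit (cps R d)
  | _, _, _, _, .cinl _ none _ A B d =>
      .llam (.cand (cpsC R A) (cpsC R B)) (.lapp (cps R d) (.cfst .svar))
  | _, _, _, _, .cinl _ (some _) _ _ _ d => Tm.ssubst (.cfst .svar) (cps R d)
  | _, _, _, _, .cinr _ none _ A B d =>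
      .llam (.cand (cpsC R A) (cpsC R B)) (.lapp (cps R d) (.csnd .svar))
  | _, _, _, _, .cinr _ (some _) _ _ _ d => Tm.ssubst (.csnd .svar) (cps R d)
  | _, _, _, _, .ccase _ none _ _ _ _ _ C d1 d2 d3 =>
      .llam (cpsC R C) (.lapp (cps R d1) (.cpair (cps R d2) (cps R d3)))
  | _, _, _, _, .ccase _ (some _) _ _ _ _ _ _ d1 d2 d3 =>
      Tm.ssubst (.cpair (cps R d2) (cps R d3)) (cps R d1)
  | _, _, _, _, .llam _ _ _ B d => .llam (cpsC R B) (cps R d)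
  | _, _, _, _, .lapp _ none _ _ _ B d1 d2 =>
      .llam (cpsC R B) (.lapp (cps R d2) (.lapp (cps R d1) .svar))
  | _, _, _, _, .lapp _ (some _) _ _ _ _ d1 d2 =>
      Tm.ssubst (.lapp (cps R d1) .svar) (cps R d2)

end EEC

namespace EEC

/-! ## The type isomorphisms `ι` of Figure 7, with explicit inverses -/

mutual
  /-- The closed term `ι_A : (Aᶜ)ᶜ → A` (Figure 7). -/
  def iotaV (R : CType) : VType → Tm
    | .base a => .vlam (.base a) (.var 0)
    | .unit => .vlam .unit .unit
    | .prod A B => .vlam (cpsV R (cpsV R (.prod A B)))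
        (.vpair (.vapp (iotaV R A) (.vfst (.var 0))) (.vapp (iotaV R B) (.vsnd (.var 0))))
    | .arr A B => .vlam (cpsV R (cpsV R (.arr A B)))
        (.vlam A (.vapp (iotaV R B) (.vapp (.var 1) (.vapp (iotaVinv R A) (.var 0)))))
    | .comp A => .vlam (cpsV R (cpsV R (.comp A)))
        (.lapp (iotaC R A) (.lapp (.var 0) .top))
    | .lin A B => .vlam (cpsV R (cpsV R (.lin A B)))
        (.llam A (.lapp (iotaC R B) (.lapp (.var 0) (.lapp (iotaCinv R A) .svar))))
  /-- The closed term `ι_A⁻¹ : A → (Aᶜ)ᶜ`. -/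
  def iotaVinv (R : CType) : VType → Tm
    | .base a => .vlam (.base a) (.var 0)
    | .unit => .vlam .unit .unit
    | .prod A B => .vlam (.prod A B)
        (.vpair (.vapp (iotaVinv R A) (.vfst (.var 0))) (.vapp (iotaVinv R B) (.vsnd (.var 0))))
    | .arr A B => .vlam (.arr A B)
        (.vlam (cpsV R (cpsV R A)) (.vapp (iotaVinv R B) (.vapp (.var 1) (.vapp (iotaV R A) (.var 0)))))
    | .comp A => .vlam (.comp A)
        (.llam .iunit (.ilet .svar (.lapp (iotaCinv R A) (.var 0))))
    | .lin A B => .vlam (.lin A B)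
        (.llam (cpsC R (cpsC R A)) (.lapp (iotaCinv R B) (.lapp (.var 0) (.lapp (iotaC R A) .svar))))
  /-- The closed term `ι_A̲ : (A̲ᶜ)ᶜ ⊸ A̲` (Figure 7). -/
  def iotaC (R : CType) : CType → Tm
    | .base a => .llam (cpsC R (cpsC R (.base a))) .svar
    | .cunit => .llam (cpsC R (cpsC R .cunit)) .cunit
    | .cand A B => .llam (cpsC R (cpsC R (.cand A B)))
        (.cpair (.lapp (iotaC R A) (.cfst .svar)) (.lapp (iotaC R B) (.csnd .svar)))
    | .carr A B => .llam (cpsC R (cpsC R (.carr A B)))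
        (.clam A (.lapp (iotaC R B) (.capp .svar (.vapp (iotaVinv R A) (.var 0)))))
    | .iunit => .llam (cpsC R (cpsC R .iunit)) .svar
    | .bang A => .llam (cpsC R (cpsC R (.bang A)))
        (.copowlet .svar (.ilet .svar (.bang (.vapp (iotaV R A) (.var 0)))))
    | .copow A B => .llam (cpsC R (cpsC R (.copow A B)))
        (.copowlet .svar (.copow (.vapp (iotaV R A) (.var 0)) (.lapp (iotaC R B) .svar)))
    | .czero => .llam (cpsC R (cpsC R .czero)) .svar
    | .csum A B => .llam (cpsC R (cpsC R (.csum A B)))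
        (.ccase .svar (.cinl (.lapp (iotaC R A) .svar)) (.cinr (.lapp (iotaC R B) .svar)))
  /-- The closed term `ι_A̲⁻¹ : A̲ ⊸ (A̲ᶜ)ᶜ`. -/
  def iotaCinv (R : CType) : CType → Tm
    | .base a => .llam (.base a) .svar
    | .cunit => .llam .cunit .cunit
    | .cand A B => .llam (.cand A B)
        (.cpair (.lapp (iotaCinv R A) (.cfst .svar)) (.lapp (iotaCinv R B) (.csnd .svar)))
    | .carr A B => .llam (.carr A B)
        (.clam (cpsV R (cpsV R A)) (.lapp (iotaCinv R B) (.capp .svar (.vapp (iotaV R A) (.var 0)))))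
    | .iunit => .llam .iunit .svar
    | .bang A => .llam (.bang A)
        (.banglet .svar (.copow (.vapp (iotaVinv R A) (.var 0)) .top))
    | .copow A B => .llam (.copow A B)
        (.copowlet .svar (.copow (.vapp (iotaVinv R A) (.var 0)) (.lapp (iotaCinv R B) .svar)))
    | .czero => .llam .czero .svar
    | .csum A B => .llam (.csum A B)
        (.ccase .svar (.cinl (.lapp (iotaCinv R A) .svar)) (.cinr (.lapp (iotaCinv R B) .svar)))
end

/-- The substitution `[ι⁻¹(Γ)]`, replacing each variable `xᵢ : Cᵢ` of `Γ` by
`ι_{Cᵢ}⁻¹(xᵢ)`. -/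
def iotaSubst (R : CType) (Γ : List VType) (t : Tm) : Tm :=
  Tm.psubst (fun n =>
    match Γ[n]? with
    | some C => .vapp (iotaVinv R C) (.var n)
    | none => .var n) t

/-! ## The simply-typed λ-calculus -/

/-- Simple types. -/
inductive STy : Type
  | base : ℕ → STy
  | unit : STy
  | prod : STy → STy → STy
  | arr : STy → STy → STy

/-- Raw simply-typed λ-terms (de Bruijn indices). -/
inductive LTm : Type
  | var : ℕ → LTm
  | unit : LTm
  | pair : LTm → LTm → LTm
  | fst : LTm → LTm
  | snd : LTm → LTm
  | lam : STy → LTm → LTm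
  | app : LTm → LTm → LTm

namespace LTm

/-- Renaming of variables. -/
def rename (f : ℕ → ℕ) : LTm → LTm
  | .var n => .var (f n)
  | .unit => .unit
  | .pair M N => .pair (rename f M) (rename f N)
  | .fst M => .fst (rename f M)
  | .snd M => .snd (rename f M)
  | .lam σ M => .lam σ (rename (Tm.liftN f) M)
  | .app M N => .app (rename f M) (rename f N)

/-- Weakening. -/
def shift (M : LTm) : LTm := rename Nat.succ M

/-- Parallel capture-avoiding substitution. -/
def psubst (σ : ℕ → LTm) : LTm → LTm
  | .var n => σ n
  | .unit => .unit
  | .pair M N => .pair (psubst σ M) (psubst σ N)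
  | .fst M => .fst (psubst σ M)
  | .snd M => .snd (psubst σ M)
  | .lam τ M => .lam τ (psubst (fun n => match n with | 0 => .var 0 | m + 1 => shift (σ m)) M)
  | .app M N => .app (psubst σ M) (psubst σ N)

/-- Capture-avoiding substitution `M[N/x]` for the innermost variable. -/
def subst0 (N : LTm) (M : LTm) : LTm :=
  psubst (fun n => match n with | 0 => N | m + 1 => .var m) M

end LTm

/-- Typing derivations of the simply-typed λ-calculus (Figure 3). -/
inductive LDeriv : List STy → LTm → STy → Type
  | var (Θ : List STy) (n : ℕ) (σ : STy) : Θ[n]? = some σ → LDeriv Θ (.var n) σ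
  | unit (Θ : List STy) : LDeriv Θ .unit .unit
  | pair (Θ : List STy) (M N : LTm) (σ τ : STy) :
      LDeriv Θ M σ → LDeriv Θ N τ → LDeriv Θ (.pair M N) (.prod σ τ)
  | fst (Θ : List STy) (M : LTm) (σ τ : STy) :
      LDeriv Θ M (.prod σ τ) → LDeriv Θ (.fst M) σ
  | snd (Θ : List STy) (M : LTm) (σ τ : STy) :
      LDeriv Θ M (.prod σ τ) → LDeriv Θ (.snd M) τ
  | lam (Θ : List STy) (M : LTm) (σ τ : STy) :
      LDeriv (σ :: Θ) M τ → LDeriv Θ (.lam σ M) (.arr σ τ)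
  | app (Θ : List STy) (M N : LTm) (σ τ : STy) :
      LDeriv Θ M (.arr σ τ) → LDeriv Θ N σ → LDeriv Θ (.app M N) τ

/-- Values of the (call-by-value) λ-calculus. -/
inductive LVal : LTm → Prop
  | var (n : ℕ) : LVal (.var n)
  | unit : LVal .unit
  | lam (σ : STy) (M : LTm) : LVal (.lam σ M)
  | pair {M N : LTm} : LVal M → LVal N → LVal (.pair M N)

/-- βη-equality of the simply-typed λ-calculus. -/
inductive LBetaEta : List STy → LTm → LTm → STy → Prop
  | refl {Θ M σ} : LDeriv Θ M σ → LBetaEta Θ M M σ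
  | symm {Θ M N σ} : LBetaEta Θ M N σ → LBetaEta Θ N M σ
  | trans {Θ M N P σ} : LBetaEta Θ M N σ → LBetaEta Θ N P σ → LBetaEta Θ M P σ
  | pair_cong {Θ M M' N N' σ τ} : LBetaEta Θ M M' σ → LBetaEta Θ N N' τ →
      LBetaEta Θ (.pair M N) (.pair M' N') (.prod σ τ)
  | fst_cong {Θ M M' σ τ} : LBetaEta Θ M M' (.prod σ τ) → LBetaEta Θ (.fst M) (.fst M') σ
  | snd_cong {Θ M M' σ τ} : LBetaEta Θ M M' (.prod σ τ) → LBetaEta Θ (.snd M) (.snd M') τ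
  | lam_cong {Θ M M' σ τ} : LBetaEta (σ :: Θ) M M' τ →
      LBetaEta Θ (.lam σ M) (.lam σ M') (.arr σ τ)
  | app_cong {Θ M M' N N' σ τ} : LBetaEta Θ M M' (.arr σ τ) → LBetaEta Θ N N' σ →
      LBetaEta Θ (.app M N) (.app M' N') τ
  | beta {Θ M N σ τ} : LDeriv (σ :: Θ) M τ → LDeriv Θ N σ →
      LBetaEta Θ (.app (.lam σ M) N) (LTm.subst0 N M) τ
  | eta {Θ M σ τ} : LDeriv Θ M (.arr σ τ) →
      LBetaEta Θ (.lam σ (.app (LTm.shift M) (.var 0))) M (.arr σ τ)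
  | fst_beta {Θ M N σ τ} : LDeriv Θ M σ → LDeriv Θ N τ →
      LBetaEta Θ (.fst (.pair M N)) M σ
  | snd_beta {Θ M N σ τ} : LDeriv Θ M σ → LDeriv Θ N τ →
      LBetaEta Θ (.snd (.pair M N)) N τ
  | pair_eta {Θ M σ τ} : LDeriv Θ M (.prod σ τ) →
      LBetaEta Θ (.pair (.fst M) (.snd M)) M (.prod σ τ)
  | unit_eta {Θ M} : LDeriv Θ M .unit → LBetaEta Θ M .unit .unit

/-- Equality in Moggi's computational λ-calculus `λc` (call-by-value
βη-equalities restricted to values, together with the `let`-laws, expressed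
via the standard encoding `let x = M in N := (λx.N) M`). -/
inductive LamC : List STy → LTm → LTm → STy → Prop
  | refl {Θ M σ} : LDeriv Θ M σ → LamC Θ M M σ
  | symm {Θ M N σ} : LamC Θ M N σ → LamC Θ N M σ
  | trans {Θ M N P σ} : LamC Θ M N σ → LamC Θ N P σ → LamC Θ M P σ
  | pair_cong {Θ M M' N N' σ τ} : LamC Θ M M' σ → LamC Θ N N' τ →
      LamC Θ (.pair M N) (.pair M' N') (.prod σ τ)
  | fst_cong {Θ M M' σ τ} : LamC Θ M M' (.prod σ τ) → LamC Θ (.fst M) (.fst M') σ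
  | snd_cong {Θ M M' σ τ} : LamC Θ M M' (.prod σ τ) → LamC Θ (.snd M) (.snd M') τ
  | lam_cong {Θ M M' σ τ} : LamC (σ :: Θ) M M' τ →
      LamC Θ (.lam σ M) (.lam σ M') (.arr σ τ)
  | app_cong {Θ M M' N N' σ τ} : LamC Θ M M' (.arr σ τ) → LamC Θ N N' σ →
      LamC Θ (.app M N) (.app M' N') τ
  | beta_v {Θ M V σ τ} : LDeriv (σ :: Θ) M τ → LDeriv Θ V σ → LVal V →
      LamC Θ (.app (.lam σ M) V) (LTm.subst0 V M) τ
  | eta_v {Θ V σ τ} : LVal V → LDeriv Θ V (.arr σ τ) →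
      LamC Θ (.lam σ (.app (LTm.shift V) (.var 0))) V (.arr σ τ)
  | fst_beta_v {Θ V W σ τ} : LVal V → LVal W → LDeriv Θ V σ → LDeriv Θ W τ →
      LamC Θ (.fst (.pair V W)) V σ
  | snd_beta_v {Θ V W σ τ} : LVal V → LVal W → LDeriv Θ V σ → LDeriv Θ W τ →
      LamC Θ (.snd (.pair V W)) W τ
  | pair_eta_v {Θ V σ τ} : LVal V → LDeriv Θ V (.prod σ τ) →
      LamC Θ (.pair (.fst V) (.snd V)) V (.prod σ τ)
  | unit_eta_v {Θ V} : LVal V → LDeriv Θ V .unit → LamC Θ V .unit .unit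
  | let_eta {Θ M σ} : LDeriv Θ M σ → LamC Θ (.app (.lam σ (.var 0)) M) M σ
  | let_assoc {Θ M N L σ ρ τ} : LDeriv (σ :: Θ) M τ → LDeriv (ρ :: Θ) N σ →
      LDeriv Θ L ρ →
      LamC Θ (.app (.lam σ M) (.app (.lam ρ N) L))
        (.app (.lam ρ (.app (.lam σ (LTm.rename (Tm.liftN Nat.succ) M)) N)) L) τ
  | app_left {Θ M N σ τ} : LDeriv Θ M (.arr σ τ) → LDeriv Θ N σ →
      LamC Θ (.app M N) (.app (.lam (.arr σ τ) (.app (.var 0) (LTm.shift N))) M) τ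
  | app_right {Θ V N σ τ} : LVal V → LDeriv Θ V (.arr σ τ) → LDeriv Θ N σ →
      LamC Θ (.app V N) (.app (.lam σ (.app (LTm.shift V) (.var 0))) N) τ
  | pair_left {Θ M N σ τ} : LDeriv Θ M σ → LDeriv Θ N τ →
      LamC Θ (.pair M N) (.app (.lam σ (.pair (.var 0) (LTm.shift N))) M) (.prod σ τ)
  | pair_right {Θ V N σ τ} : LVal V → LDeriv Θ V σ → LDeriv Θ N τ →
      LamC Θ (.pair V N) (.app (.lam τ (.pair (LTm.shift V) (.var 0))) N) (.prod σ τ)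
  | fst_cc {Θ M σ τ} : LDeriv Θ M (.prod σ τ) →
      LamC Θ (.fst M) (.app (.lam (.prod σ τ) (.fst (.var 0))) M) σ
  | snd_cc {Θ M σ τ} : LDeriv Θ M (.prod σ τ) →
      LamC Θ (.snd M) (.app (.lam (.prod σ τ) (.snd (.var 0))) M) τ

end EEC

namespace EEC

/-! ## The standard cbv and cbn translations of typed λ-calculus into EEC -/

/-- The computation-type constant `α̲` associated with a simply-typed
λ-calculus type constant `α` (the association is injective but not
surjective, so that some computation-type constants of EEC are different
from `α̲` for every λ-calculus type constant `α`). -/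
def assocC (a : ℕ) : CType := .base (a + 1)

/-- The call-by-value translation `σᵛ` on types. -/
def cbvT : STy → VType
  | .base a => .base a
  | .unit => .unit
  | .prod σ τ => .prod (cbvT σ) (cbvT τ)
  | .arr σ τ => .arr (cbvT σ) (.comp (.bang (cbvT τ)))

/-- The call-by-value translation `Θᵛ` on contexts. -/
def cbvCtx (Θ : List STy) : List VType := Θ.map cbvT

/-- The call-by-value translation on terms: `Θ ⊢ M : τ` is sent to
`Θᵛ ⊢ Mᵛ : !(τᵛ)`. -/
def cbvTm : LTm → Tm
  | .var n => .bang (.var n)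
  | .unit => .bang .unit
  | .pair M N => .banglet (cbvTm M) (.banglet (Tm.shift (cbvTm N)) (.bang (.vpair (.var 1) (.var 0))))
  | .fst M => .banglet (cbvTm M) (.bang (.vfst (.var 0)))
  | .snd M => .banglet (cbvTm M) (.bang (.vsnd (.var 0)))
  | .lam σ M => .bang (.vlam (cbvT σ) (cbvTm M))
  | .app M N => .banglet (cbvTm M) (.banglet (Tm.shift (cbvTm N)) (.vapp (.var 1) (.var 0)))

/-- The call-by-name translation `σⁿ` on types. -/
def cbnT : STy → CType
  | .base a => assocC a
  | .unit => .cunit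
  | .prod σ τ => .cand (cbnT σ) (cbnT τ)
  | .arr σ τ => .carr (.comp (cbnT σ)) (cbnT τ)

/-- The call-by-name translation `Θⁿ` on contexts. -/
def cbnCtx (Θ : List STy) : List VType := Θ.map (fun σ => .comp (cbnT σ))

/-- The call-by-name translation on terms: `Θ ⊢ M : τ` is sent to
`Θⁿ ⊢ Mⁿ : τⁿ`, mimicking each construct by the corresponding
computation-type construct of EEC. -/
def cbnTm : LTm → Tm
  | .var n => .var n
  | .unit => .cunit
  | .pair M N => .cpair (cbnTm M) (cbnTm N)
  | .fst M => .cfst (cbnTm M)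
  | .snd M => .csnd (cbnTm M)
  | .lam σ M => .clam (.comp (cbnT σ)) (cbnTm M)
  | .app M N => .capp (cbnTm M) (cbnTm N)

/-! ## Hasegawa's linear-use CPS translations (Section 4) -/

/-- The call-by-value linear-use CPS translation `σᵛᶜ` on types. -/
def cbvcpsT (R : CType) : STy → VType
  | .base a => .base a
  | .unit => .unit
  | .prod σ τ => .prod (cbvcpsT R σ) (cbvcpsT R τ)
  | .arr σ τ => .arr (cbvcpsT R σ) (.lin (.carr (cbvcpsT R τ) R) R)

/-- `Θᵛᶜ`. -/
def cbvcpsCtx (R : CType) (Θ : List STy) : List VType := Θ.map (cbvcpsT R)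

/-- The call-by-value linear-use CPS translation on terms: `Θ ⊢ M : τ` is
sent to `Θᵛᶜ ⊢ Mᵛᶜ : (τᵛᶜ ⇒ R̲) ⊸ R̲`. -/
def cbvcps (R : CType) : {Θ : List STy} → {M : LTm} → {σ : STy} → LDeriv Θ M σ → Tm
  | _, _, _, .var _ n σ _ => .llam (.carr (cbvcpsT R σ) R) (.capp .svar (.var n))
  | _, _, _, .unit _ => .llam (.carr .unit R) (.capp .svar .unit)
  | _, _, _, .pair _ _ _ σ τ dM dN =>
      .llam (.carr (.prod (cbvcpsT R σ) (cbvcpsT R τ)) R)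
        (.lapp (cbvcps R dM)
          (.clam (cbvcpsT R σ)
            (.lapp (Tm.shift (cbvcps R dN))
              (.clam (cbvcpsT R τ) (.capp .svar (.vpair (.var 1) (.var 0)))))))
  | _, _, _, .fst _ _ σ τ dM =>
      .llam (.carr (cbvcpsT R σ) R)
        (.lapp (cbvcps R dM)
          (.clam (.prod (cbvcpsT R σ) (cbvcpsT R τ)) (.capp .svar (.vfst (.var 0)))))
  | _, _, _, .snd _ _ σ τ dM =>
      .llam (.carr (cbvcpsT R τ) R)
        (.lapp (cbvcps R dM)
          (.clam (.prod (cbvcpsT R σ) (cbvcpsT R τ)) (.capp .svar (.vsnd (.var 0)))))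
  | _, _, _, .lam _ _ σ τ dM =>
      .llam (.carr (.arr (cbvcpsT R σ) (.lin (.carr (cbvcpsT R τ) R) R)) R)
        (.capp .svar (.vlam (cbvcpsT R σ) (cbvcps R dM)))
  | _, _, _, .app _ _ _ σ τ dM dN =>
      .llam (.carr (cbvcpsT R τ) R)
        (.lapp (cbvcps R dM)
          (.clam (.arr (cbvcpsT R σ) (.lin (.carr (cbvcpsT R τ) R) R))
            (.lapp (Tm.shift (cbvcps R dN))
              (.clam (cbvcpsT R σ) (.lapp (.vapp (.var 1) (.var 0)) .svar)))))

/-- The call-by-name linear-use CPS translation `σⁿᶜ` on types. -/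
def cbncpsT (R : CType) : STy → CType
  | .base a => assocC a
  | .unit => .czero
  | .prod σ τ => .csum (cbncpsT R σ) (cbncpsT R τ)
  | .arr σ τ => .copow (.lin (cbncpsT R σ) R) (cbncpsT R τ)

/-- `Θⁿᶜ ⊸ R̲`, assigning each variable `xᵢ : σᵢ` the type `σᵢⁿᶜ ⊸ R̲`. -/
def cbncpsCtx (R : CType) (Θ : List STy) : List VType :=
  Θ.map (fun σ => .lin (cbncpsT R σ) R)

/-- The call-by-name linear-use CPS translation on terms: `Θ ⊢ M : τ` is
sent to `Θⁿᶜ ⊸ R̲ ⊢ Mⁿᶜ : τⁿᶜ ⊸ R̲`. -/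
def cbncps (R : CType) : {Θ : List STy} → {M : LTm} → {σ : STy} → LDeriv Θ M σ → Tm
  | _, _, _, .var _ n _ _ => .var n
  | _, _, _, .unit _ => .llam .czero (.cimage R .svar)
  | _, _, _, .pair _ _ _ σ τ dM dN =>
      .llam (.csum (cbncpsT R σ) (cbncpsT R τ))
        (.ccase .svar (.lapp (cbncps R dM) .svar) (.lapp (cbncps R dN) .svar))
  | _, _, _, .fst _ _ σ _τ dM => .llam (cbncpsT R σ) (.lapp (cbncps R dM) (.cinl .svar))
  | _, _, _, .snd _ _ _ τ dM => .llam (cbncpsT R τ) (.lapp (cbncps R dM) (.cinr .svar))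
  | _, _, _, .lam _ _ σ τ dM =>
      .llam (.copow (.lin (cbncpsT R σ) R) (cbncpsT R τ))
        (.copowlet .svar (.lapp (cbncps R dM) .svar))
  | _, _, _, .app _ _ _ σ τ dM dN =>
      .llam (cbncpsT R τ) (.lapp (cbncps R dM) (.copow (cbncps R dN) .svar))

end EEC

namespace EEC

namespace Tm

/-! ### The algebra of renaming and substitution -/

theorem liftN_comp (f g : ℕ → ℕ) : liftN f ∘ liftN g = liftN (f ∘ g) := by
  funext n; cases n <;> rfl

theorem liftS_comp_liftN (σ : ℕ → Tm) (f : ℕ → ℕ) : liftS σ ∘ liftN f = liftS (σ ∘ f) := by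
  funext n; cases n <;> rfl

theorem liftS_var : liftS Tm.var = Tm.var := by
  funext n; cases n <;> rfl

theorem rename_rename (f g : ℕ → ℕ) (t : Tm) : rename f (rename g t) = rename (f ∘ g) t := by
  induction t generalizing f g <;> simp_all [rename, liftN_comp]

theorem rename_liftN_shift (f : ℕ → ℕ) (t : Tm) :
    rename (liftN f) (shift t) = shift (rename f t) := by
  simp only [shift, rename_rename]; rfl

theorem psubst_rename (σ : ℕ → Tm) (f : ℕ → ℕ) (t : Tm) :
    psubst σ (rename f t) = psubst (σ ∘ f) t := by
  induction t generalizing σ f <;> simp_all [rename, psubst, liftS_comp_liftN]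

theorem rename_comp_liftS (f : ℕ → ℕ) (σ : ℕ → Tm) :
    rename (liftN f) ∘ liftS σ = liftS (rename f ∘ σ) := by
  funext n
  cases n with
  | zero => rfl
  | succ n => simp [liftS, rename_liftN_shift]

theorem rename_psubst (f : ℕ → ℕ) (σ : ℕ → Tm) (t : Tm) :
    rename f (psubst σ t) = psubst (rename f ∘ σ) t := by
  induction t generalizing σ f <;> simp_all [rename, psubst, rename_comp_liftS]

theorem psubst_shift (σ : ℕ → Tm) (t : Tm) :
    psubst (liftS σ) (shift t) = shift (psubst σ t) := by
  simp only [shift, psubst_rename, rename_psubst]; rfl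

theorem psubst_comp_liftS (τ σ : ℕ → Tm) :
    psubst (liftS τ) ∘ liftS σ = liftS (psubst τ ∘ σ) := by
  funext n
  cases n with
  | zero => rfl
  | succ n => simp [liftS, psubst_shift]

theorem psubst_psubst (τ σ : ℕ → Tm) (t : Tm) :
    psubst τ (psubst σ t) = psubst (psubst τ ∘ σ) t := by
  induction t generalizing τ σ <;> simp_all [psubst, psubst_comp_liftS]

theorem psubst_var (t : Tm) : psubst Tm.var t = t := by
  induction t <;> simp_all [psubst, liftS_var]

/-- Extension of a substitution by a term for the innermost variable. -/
def scons (u : Tm) (σ : ℕ → Tm) : ℕ → Tm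
  | 0 => u
  | n + 1 => σ n

theorem subst0_eq (u t : Tm) : subst0 u t = psubst (scons u Tm.var) t := by
  unfold subst0
  congr 1

theorem subst0_shift (u t : Tm) : subst0 u (shift t) = t := by
  rw [subst0_eq, shift, psubst_rename]
  exact psubst_var t

theorem rename_ssubst (f : ℕ → ℕ) (u t : Tm) :
    rename f (ssubst u t) = ssubst (rename f u) (rename f t) := by
  induction t generalizing f u <;> simp_all [rename, ssubst, rename_liftN_shift]

theorem shift_ssubst (u t : Tm) : shift (ssubst u t) = ssubst (shift u) (shift t) :=
  rename_ssubst _ _ _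

theorem ssubst_svar (t : Tm) : ssubst .svar t = t := by
  induction t <;> simp_all [ssubst, shift, rename]

theorem ssubst_ssubst (u v t : Tm) : ssubst u (ssubst v t) = ssubst (ssubst u v) t := by
  induction t generalizing u v <;> simp_all [ssubst, shift_ssubst]

/-- A term without free occurrence of the stoup variable. -/
def StoupFree (t : Tm) : Prop := ssubst .unit t = t

theorem StoupFree.ssubst {t : Tm} (h : StoupFree t) (u : Tm) : Tm.ssubst u t = t := by
  unfold StoupFree at h
  induction t generalizing u <;> simp_all [Tm.ssubst, shift, rename]

theorem StoupFree.rename {t : Tm} (h : StoupFree t) (f : ℕ → ℕ) : StoupFree (rename f t) := by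
  have := rename_ssubst f .unit t
  rw [h] at this
  exact this.symm

theorem StoupFree.liftS {σ : ℕ → Tm} (h : ∀ n, StoupFree (σ n)) (n : ℕ) :
    StoupFree (liftS σ n) := by
  cases n with
  | zero => rfl
  | succ n => exact (h n).rename _

theorem psubst_ssubst {σ : ℕ → Tm} (h : ∀ n, StoupFree (σ n)) (u t : Tm) :
    psubst σ (ssubst u t) = ssubst (psubst σ u) (psubst σ t) := by
  induction t generalizing σ u <;> simp_all [psubst, ssubst]
  case var n => exact ((h n).ssubst _).symm
  all_goals
    rename_i ih
    rw [ih (StoupFree.liftS h), psubst_shift]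

end Tm

/-- Typability: existence of a typing derivation. -/
abbrev Ty (Γ : List VType) (Δ : Option CType) (t : Tm) (A : VType) : Prop :=
  Nonempty (Deriv Γ Δ t A)

/-- The computation type underlying a value type. -/
def VType.cod : VType → CType
  | .comp A => A
  | _ => .cunit

theorem Deriv.stoupFree {Γ : List VType} {Δ : Option CType} {t : Tm} {A : VType}
    (d : Deriv Γ Δ t A) (h : Δ = none) : t.StoupFree := by
  unfold Tm.StoupFree
  induction d <;> simp_all [Tm.ssubst, Tm.shift, Tm.rename]

theorem Ty.stoupFree {Γ : List VType} {t : Tm} {A : VType} (h : Ty Γ none t A) : t.StoupFree :=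
  h.some.stoupFree rfl

open Tm

/-! ### Typing is preserved by renaming and substitution, compatibly with the translation -/

theorem lift_renaming {Γ Γ' : List VType} {f : ℕ → ℕ} {C : VType}
    (hf : ∀ n A, Γ[n]? = some A → Γ'[f n]? = some A) :
    ∀ n A, (C :: Γ)[n]? = some A → (C :: Γ')[liftN f n]? = some A := by
  intro n A h
  cases n with
  | zero => simpa [liftN] using h
  | succ n => simpa [liftN] using hf n A (by simpa using h)

theorem Deriv.exists_rename (R : CType) {Γ : List VType} {Δ : Option CType} {t : Tm} {A : VType}
    (d : Deriv Γ Δ t A) {Γ' : List VType} {f : ℕ → ℕ}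
    (hf : ∀ n A, Γ[n]? = some A → Γ'[f n]? = some A) :
    ∃ d' : Deriv Γ' Δ (rename f t) A, cps R d' = rename f (cps R d) := by
  induction d generalizing Γ' f with
  | var _ n A h => exact ⟨.var _ _ _ (hf n A h), rfl⟩
  | svar _ A => exact ⟨.svar _ A, rfl⟩
  | unit _ =>
    refine ⟨.unit _, ?_⟩
    simp [cps, rename]
  | vpair _ _ _ _ _ _ _ ih1 ih2 =>
    obtain ⟨e1, h1⟩ := ih1 hf
    obtain ⟨e2, h2⟩ := ih2 hf
    refine ⟨.vpair _ _ _ _ _ e1 e2, ?_⟩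
    simp [cps, rename, h1, h2]
  | vfst _ _ _ _ _ ih1 =>
    obtain ⟨e1, h1⟩ := ih1 hf
    refine ⟨.vfst _ _ _ _ e1, ?_⟩
    simp [cps, rename, h1]
  | vsnd _ _ _ _ _ ih1 =>
    obtain ⟨e1, h1⟩ := ih1 hf
    refine ⟨.vsnd _ _ _ _ e1, ?_⟩
    simp [cps, rename, h1]
  | vlam _ _ _ _ _ ih1 =>
    obtain ⟨e1, h1⟩ := ih1 (lift_renaming hf)
    refine ⟨.vlam _ _ _ _ e1, ?_⟩
    simp [cps, rename, h1]
  | vapp _ _ _ _ _ _ _ ih1 ih2 =>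
    obtain ⟨e1, h1⟩ := ih1 hf
    obtain ⟨e2, h2⟩ := ih2 hf
    refine ⟨.vapp _ _ _ _ _ e1 e2, ?_⟩
    simp [cps, rename, h1, h2]
  | cunit _ _ =>
    refine ⟨.cunit _ _, ?_⟩
    cases ‹Option CType› <;> simp [cps, rename]
  | cpair _ _ _ _ _ _ _ _ ih1 ih2 =>
    obtain ⟨e1, h1⟩ := ih1 hf
    obtain ⟨e2, h2⟩ := ih2 hf
    refine ⟨.cpair _ _ _ _ _ _ e1 e2, ?_⟩
    cases ‹Option CType› <;> simp [cps, rename, h1, h2]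
  | cfst _ _ _ _ _ _ ih1 =>
    obtain ⟨e1, h1⟩ := ih1 hf
    refine ⟨.cfst _ _ _ _ _ e1, ?_⟩
    cases ‹Option CType› <;> simp [cps, rename, rename_ssubst, h1]
  | csnd _ _ _ _ _ _ ih1 =>
    obtain ⟨e1, h1⟩ := ih1 hf
    refine ⟨.csnd _ _ _ _ _ e1, ?_⟩
    cases ‹Option CType› <;> simp [cps, rename, rename_ssubst, h1]
  | clam _ _ _ _ _ _ ih1 =>
    obtain ⟨e1, h1⟩ := ih1 (lift_renaming hf)
    refine ⟨.clam _ _ _ _ _ e1, ?_⟩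
    cases ‹Option CType› <;> simp [cps, rename, h1]
  | capp _ _ _ _ _ _ _ _ ih1 ih2 =>
    obtain ⟨e1, h1⟩ := ih1 hf
    obtain ⟨e2, h2⟩ := ih2 hf
    refine ⟨.capp _ _ _ _ _ _ e1 e2, ?_⟩
    cases ‹Option CType› <;> simp [cps, rename, rename_ssubst, h1, h2]
  | top _ =>
    refine ⟨.top _, ?_⟩
    simp [cps, rename]
  | ilet _ _ _ _ _ _ _ ih1 ih2 =>
    obtain ⟨e1, h1⟩ := ih1 hf
    obtain ⟨e2, h2⟩ := ih2 hf
    refine ⟨.ilet _ _ _ _ _ e1 e2, ?_⟩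
    cases ‹Option CType› <;> simp [cps, rename, rename_ssubst, h1, h2]
  | bang _ _ _ _ ih1 =>
    obtain ⟨e1, h1⟩ := ih1 hf
    refine ⟨.bang _ _ _ e1, ?_⟩
    simp [cps, rename, h1]
  | banglet _ _ _ _ _ _ _ _ ih1 ih2 =>
    obtain ⟨e1, h1⟩ := ih1 hf
    obtain ⟨e2, h2⟩ := ih2 (lift_renaming hf)
    refine ⟨.banglet _ _ _ _ _ _ e1 e2, ?_⟩
    cases ‹Option CType› <;> simp [cps, rename, rename_ssubst, h1, h2]
  | copow _ _ _ _ _ _ _ _ ih1 ih2 =>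
    obtain ⟨e1, h1⟩ := ih1 hf
    obtain ⟨e2, h2⟩ := ih2 hf
    refine ⟨.copow _ _ _ _ _ _ e1 e2, ?_⟩
    cases ‹Option CType› <;> simp [cps, rename, rename_ssubst, h1, h2]
  | copowlet _ _ _ _ _ _ _ _ _ ih1 ih2 =>
    obtain ⟨e1, h1⟩ := ih1 hf
    obtain ⟨e2, h2⟩ := ih2 (lift_renaming hf)
    refine ⟨.copowlet _ _ _ _ _ _ _ e1 e2, ?_⟩
    cases ‹Option CType› <;> simp [cps, rename, rename_ssubst, h1, h2]
  | cimage _ _ _ _ _ ih1 =>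
    obtain ⟨e1, h1⟩ := ih1 hf
    refine ⟨.cimage _ _ _ _ e1, ?_⟩
    cases ‹Option CType› <;> simp [cps, rename, rename_ssubst, h1]
  | cinl _ _ _ _ _ _ ih1 =>
    obtain ⟨e1, h1⟩ := ih1 hf
    refine ⟨.cinl _ _ _ _ _ e1, ?_⟩
    cases ‹Option CType› <;> simp [cps, rename, rename_ssubst, h1]
  | cinr _ _ _ _ _ _ ih1 =>
    obtain ⟨e1, h1⟩ := ih1 hf
    refine ⟨.cinr _ _ _ _ _ e1, ?_⟩
    cases ‹Option CType› <;> simp [cps, rename, rename_ssubst, h1]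
  | ccase _ _ _ _ _ _ _ _ _ _ _ ih1 ih2 ih3 =>
    obtain ⟨e1, h1⟩ := ih1 hf
    obtain ⟨e2, h2⟩ := ih2 hf
    obtain ⟨e3, h3⟩ := ih3 hf
    refine ⟨.ccase _ _ _ _ _ _ _ _ e1 e2 e3, ?_⟩
    cases ‹Option CType› <;> simp [cps, rename, rename_ssubst, h1, h2, h3]
  | llam _ _ _ _ _ ih1 =>
    obtain ⟨e1, h1⟩ := ih1 hf
    refine ⟨.llam _ _ _ _ e1, ?_⟩
    simp [cps, rename, h1]
  | lapp _ _ _ _ _ _ _ _ ih1 ih2 =>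
    obtain ⟨e1, h1⟩ := ih1 hf
    obtain ⟨e2, h2⟩ := ih2 hf
    refine ⟨.lapp _ _ _ _ _ _ e1 e2, ?_⟩
    cases ‹Option CType› <;> simp [cps, rename, rename_ssubst, h1, h2]

theorem Deriv.exists_shift (R : CType) {Γ : List VType} {Δ : Option CType} {t : Tm} {A : VType}
    (d : Deriv Γ Δ t A) (C : VType) :
    ∃ d' : Deriv (C :: Γ) Δ (shift t) A, cps R d' = shift (cps R d) :=
  d.exists_rename R (fun n A h => by simpa using h)

theorem lift_subst {R : CType} {Γ Γ' : List VType} {σ τ : ℕ → Tm} {C : VType}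
    (hs : ∀ n A, Γ[n]? = some A → ∃ d : Deriv Γ' none (σ n) A, cps R d = τ n) :
    ∀ n A, (C :: Γ)[n]? = some A →
      ∃ d : Deriv (C :: Γ') none (liftS σ n) A, cps R d = liftS τ n := by
  intro n A h
  cases n with
  | zero => exact ⟨.var _ 0 _ (by simpa using h), rfl⟩
  | succ n =>
    obtain ⟨d, hd⟩ := hs n A (by simpa using h)
    obtain ⟨e, he⟩ := d.exists_shift R C
    exact ⟨e, he.trans (congrArg Tm.shift hd)⟩

theorem Deriv.exists_psubst (R : CType) {Γ : List VType} {Δ : Option CType} {t : Tm} {A : VType}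
    (d : Deriv Γ Δ t A) {Γ' : List VType} {σ τ : ℕ → Tm}
    (hs : ∀ n A, Γ[n]? = some A → ∃ d : Deriv Γ' none (σ n) A, cps R d = τ n)
    (hτ : ∀ n, StoupFree (τ n)) :
    ∃ d' : Deriv Γ' Δ (psubst σ t) A, cps R d' = psubst τ (cps R d) := by
  induction d generalizing Γ' σ τ with
  | var _ n A h => exact hs n A h
  | svar _ A => exact ⟨.svar _ A, rfl⟩
  | unit _ =>
    refine ⟨.unit _, ?_⟩
    simp [cps, psubst]
  | vpair _ _ _ _ _ _ _ ih1 ih2 =>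
    obtain ⟨e1, h1⟩ := ih1 hs hτ
    obtain ⟨e2, h2⟩ := ih2 hs hτ
    refine ⟨.vpair _ _ _ _ _ e1 e2, ?_⟩
    simp [cps, psubst, h1, h2]
  | vfst _ _ _ _ _ ih1 =>
    obtain ⟨e1, h1⟩ := ih1 hs hτ
    refine ⟨.vfst _ _ _ _ e1, ?_⟩
    simp [cps, psubst, h1]
  | vsnd _ _ _ _ _ ih1 =>
    obtain ⟨e1, h1⟩ := ih1 hs hτ
    refine ⟨.vsnd _ _ _ _ e1, ?_⟩
    simp [cps, psubst, h1]
  | vlam _ _ _ _ _ ih1 =>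
    obtain ⟨e1, h1⟩ := ih1 (lift_subst hs) (StoupFree.liftS hτ)
    refine ⟨.vlam _ _ _ _ e1, ?_⟩
    simp [cps, psubst, h1]
  | vapp _ _ _ _ _ _ _ ih1 ih2 =>
    obtain ⟨e1, h1⟩ := ih1 hs hτ
    obtain ⟨e2, h2⟩ := ih2 hs hτ
    refine ⟨.vapp _ _ _ _ _ e1 e2, ?_⟩
    simp [cps, psubst, h1, h2]
  | cunit _ _ =>
    refine ⟨.cunit _ _, ?_⟩
    cases ‹Option CType› <;> simp [cps, psubst]
  | cpair _ _ _ _ _ _ _ _ ih1 ih2 =>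
    obtain ⟨e1, h1⟩ := ih1 hs hτ
    obtain ⟨e2, h2⟩ := ih2 hs hτ
    refine ⟨.cpair _ _ _ _ _ _ e1 e2, ?_⟩
    cases ‹Option CType› <;> simp [cps, psubst, h1, h2]
  | cfst _ _ _ _ _ _ ih1 =>
    obtain ⟨e1, h1⟩ := ih1 hs hτ
    refine ⟨.cfst _ _ _ _ _ e1, ?_⟩
    cases ‹Option CType› <;> simp [cps, psubst, psubst_ssubst hτ, h1]
  | csnd _ _ _ _ _ _ ih1 =>
    obtain ⟨e1, h1⟩ := ih1 hs hτ
    refine ⟨.csnd _ _ _ _ _ e1, ?_⟩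
    cases ‹Option CType› <;> simp [cps, psubst, psubst_ssubst hτ, h1]
  | clam _ _ _ _ _ _ ih1 =>
    obtain ⟨e1, h1⟩ := ih1 (lift_subst hs) (StoupFree.liftS hτ)
    refine ⟨.clam _ _ _ _ _ e1, ?_⟩
    cases ‹Option CType› <;> simp [cps, psubst, h1]
  | capp _ _ _ _ _ _ _ _ ih1 ih2 =>
    obtain ⟨e1, h1⟩ := ih1 hs hτ
    obtain ⟨e2, h2⟩ := ih2 hs hτ
    refine ⟨.capp _ _ _ _ _ _ e1 e2, ?_⟩
    cases ‹Option CType› <;> simp [cps, psubst, psubst_ssubst hτ, h1, h2]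
  | top _ =>
    refine ⟨.top _, ?_⟩
    simp [cps, psubst]
  | ilet _ _ _ _ _ _ _ ih1 ih2 =>
    obtain ⟨e1, h1⟩ := ih1 hs hτ
    obtain ⟨e2, h2⟩ := ih2 hs hτ
    refine ⟨.ilet _ _ _ _ _ e1 e2, ?_⟩
    cases ‹Option CType› <;> simp [cps, psubst, psubst_ssubst hτ, h1, h2]
  | bang _ _ _ _ ih1 =>
    obtain ⟨e1, h1⟩ := ih1 hs hτ
    refine ⟨.bang _ _ _ e1, ?_⟩
    simp [cps, psubst, h1]
  | banglet _ _ _ _ _ _ _ _ ih1 ih2 =>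
    obtain ⟨e1, h1⟩ := ih1 hs hτ
    obtain ⟨e2, h2⟩ := ih2 (lift_subst hs) (StoupFree.liftS hτ)
    refine ⟨.banglet _ _ _ _ _ _ e1 e2, ?_⟩
    cases ‹Option CType› <;> simp [cps, psubst, psubst_ssubst hτ, h1, h2]
  | copow _ _ _ _ _ _ _ _ ih1 ih2 =>
    obtain ⟨e1, h1⟩ := ih1 hs hτ
    obtain ⟨e2, h2⟩ := ih2 hs hτ
    refine ⟨.copow _ _ _ _ _ _ e1 e2, ?_⟩
    cases ‹Option CType› <;> simp [cps, psubst, psubst_ssubst hτ, h1, h2]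
  | copowlet _ _ _ _ _ _ _ _ _ ih1 ih2 =>
    obtain ⟨e1, h1⟩ := ih1 hs hτ
    obtain ⟨e2, h2⟩ := ih2 (lift_subst hs) (StoupFree.liftS hτ)
    refine ⟨.copowlet _ _ _ _ _ _ _ e1 e2, ?_⟩
    cases ‹Option CType› <;> simp [cps, psubst, psubst_ssubst hτ, h1, h2]
  | cimage _ _ _ _ _ ih1 =>
    obtain ⟨e1, h1⟩ := ih1 hs hτ
    refine ⟨.cimage _ _ _ _ e1, ?_⟩
    cases ‹Option CType› <;> simp [cps, psubst, psubst_ssubst hτ, h1]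
  | cinl _ _ _ _ _ _ ih1 =>
    obtain ⟨e1, h1⟩ := ih1 hs hτ
    refine ⟨.cinl _ _ _ _ _ e1, ?_⟩
    cases ‹Option CType› <;> simp [cps, psubst, psubst_ssubst hτ, h1]
  | cinr _ _ _ _ _ _ ih1 =>
    obtain ⟨e1, h1⟩ := ih1 hs hτ
    refine ⟨.cinr _ _ _ _ _ e1, ?_⟩
    cases ‹Option CType› <;> simp [cps, psubst, psubst_ssubst hτ, h1]
  | ccase _ _ _ _ _ _ _ _ _ _ _ ih1 ih2 ih3 =>
    obtain ⟨e1, h1⟩ := ih1 hs hτ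
    obtain ⟨e2, h2⟩ := ih2 hs hτ
    obtain ⟨e3, h3⟩ := ih3 hs hτ
    refine ⟨.ccase _ _ _ _ _ _ _ _ e1 e2 e3, ?_⟩
    cases ‹Option CType› <;> simp [cps, psubst, psubst_ssubst hτ, h1, h2, h3]
  | llam _ _ _ _ _ ih1 =>
    obtain ⟨e1, h1⟩ := ih1 hs hτ
    refine ⟨.llam _ _ _ _ e1, ?_⟩
    simp [cps, psubst, h1]
  | lapp _ _ _ _ _ _ _ _ ih1 ih2 =>
    obtain ⟨e1, h1⟩ := ih1 hs hτ
    obtain ⟨e2, h2⟩ := ih2 hs hτ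
    refine ⟨.lapp _ _ _ _ _ _ e1 e2, ?_⟩
    cases ‹Option CType› <;> simp [cps, psubst, psubst_ssubst hτ, h1, h2]

theorem Ty.shift {Γ : List VType} {Δ : Option CType} {t : Tm} {A : VType}
    (h : Ty Γ Δ t A) (C : VType) : Ty (C :: Γ) Δ (Tm.shift t) A :=
  ⟨(h.some.exists_shift .iunit C).choose⟩

theorem lift_typing {Γ Γ' : List VType} {σ : ℕ → Tm} {C : VType}
    (hs : ∀ n A, Γ[n]? = some A → Ty Γ' none (σ n) A) :
    ∀ n A, (C :: Γ)[n]? = some A → Ty (C :: Γ') none (liftS σ n) A := by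
  intro n A h
  cases n with
  | zero => exact ⟨.var _ 0 _ (by simpa using h)⟩
  | succ n => exact (hs n A (by simpa using h)).shift C

theorem Ty.psubst {Γ Γ' : List VType} {Δ : Option CType} {t : Tm} {A : VType} {σ : ℕ → Tm}
    (h : Ty Γ Δ t A) (hs : ∀ n A, Γ[n]? = some A → Ty Γ' none (σ n) A) :
    Ty Γ' Δ (Tm.psubst σ t) A := by
  obtain ⟨d⟩ := h
  induction d generalizing Γ' σ with
  | var _ n A h => exact hs n A h
  | svar _ A => exact ⟨.svar _ A⟩
  | unit _ =>
    exact ⟨.unit _⟩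
  | vpair _ _ _ _ _ _ _ ih1 ih2 =>
    exact ⟨.vpair _ _ _ _ _ (ih1 hs).some (ih2 hs).some⟩
  | vfst _ _ _ _ _ ih1 =>
    exact ⟨.vfst _ _ _ _ (ih1 hs).some⟩
  | vsnd _ _ _ _ _ ih1 =>
    exact ⟨.vsnd _ _ _ _ (ih1 hs).some⟩
  | vlam _ _ _ _ _ ih1 =>
    exact ⟨.vlam _ _ _ _ (ih1 (lift_typing hs)).some⟩
  | vapp _ _ _ _ _ _ _ ih1 ih2 =>
    exact ⟨.vapp _ _ _ _ _ (ih1 hs).some (ih2 hs).some⟩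
  | cunit _ _ =>
    exact ⟨.cunit _ _⟩
  | cpair _ _ _ _ _ _ _ _ ih1 ih2 =>
    exact ⟨.cpair _ _ _ _ _ _ (ih1 hs).some (ih2 hs).some⟩
  | cfst _ _ _ _ _ _ ih1 =>
    exact ⟨.cfst _ _ _ _ _ (ih1 hs).some⟩
  | csnd _ _ _ _ _ _ ih1 =>
    exact ⟨.csnd _ _ _ _ _ (ih1 hs).some⟩
  | clam _ _ _ _ _ _ ih1 =>
    exact ⟨.clam _ _ _ _ _ (ih1 (lift_typing hs)).some⟩
  | capp _ _ _ _ _ _ _ _ ih1 ih2 =>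
    exact ⟨.capp _ _ _ _ _ _ (ih1 hs).some (ih2 hs).some⟩
  | top _ =>
    exact ⟨.top _⟩
  | ilet _ _ _ _ _ _ _ ih1 ih2 =>
    exact ⟨.ilet _ _ _ _ _ (ih1 hs).some (ih2 hs).some⟩
  | bang _ _ _ _ ih1 =>
    exact ⟨.bang _ _ _ (ih1 hs).some⟩
  | banglet _ _ _ _ _ _ _ _ ih1 ih2 =>
    exact ⟨.banglet _ _ _ _ _ _ (ih1 hs).some (ih2 (lift_typing hs)).some⟩
  | copow _ _ _ _ _ _ _ _ ih1 ih2 =>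
    exact ⟨.copow _ _ _ _ _ _ (ih1 hs).some (ih2 hs).some⟩
  | copowlet _ _ _ _ _ _ _ _ _ ih1 ih2 =>
    exact ⟨.copowlet _ _ _ _ _ _ _ (ih1 hs).some (ih2 (lift_typing hs)).some⟩
  | cimage _ _ _ _ _ ih1 =>
    exact ⟨.cimage _ _ _ _ (ih1 hs).some⟩
  | cinl _ _ _ _ _ _ ih1 =>
    exact ⟨.cinl _ _ _ _ _ (ih1 hs).some⟩
  | cinr _ _ _ _ _ _ ih1 =>
    exact ⟨.cinr _ _ _ _ _ (ih1 hs).some⟩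
  | ccase _ _ _ _ _ _ _ _ _ _ _ ih1 ih2 ih3 =>
    exact ⟨.ccase _ _ _ _ _ _ _ _ (ih1 hs).some (ih2 hs).some (ih3 hs).some⟩
  | llam _ _ _ _ _ ih1 =>
    exact ⟨.llam _ _ _ _ (ih1 hs).some⟩
  | lapp _ _ _ _ _ _ _ _ ih1 ih2 =>
    exact ⟨.lapp _ _ _ _ _ _ (ih1 hs).some (ih2 hs).some⟩

theorem Ty.subst0 {Γ : List VType} {Δ : Option CType} {t u : Tm} {A B : VType}
    (h : Ty (A :: Γ) Δ t B) (hu : Ty Γ none u A) : Ty Γ Δ (Tm.subst0 u t) B := by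
  rw [subst0_eq]
  refine h.psubst fun n C hn => ?_
  cases n with
  | zero =>
    obtain rfl : A = C := by simpa using hn
    exact hu
  | succ n => exact ⟨.var _ n _ (by simpa using hn)⟩

theorem Ty.ssubst {Γ : List VType} {Δ : Option CType} {t u : Tm} {A : CType} {B : VType}
    (h : Ty Γ (some A) t B) (hu : Ty Γ Δ u (.comp A)) : Ty Γ Δ (Tm.ssubst u t) B := by
  obtain ⟨d⟩ := h
  generalize hD : some A = D at d
  induction d generalizing u with
  | svar _ B =>
    cases hD
    exact hu
  | cpair _ _ _ _ _ _ d1 d2 ih1 ih2 =>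
    subst hD
    exact ⟨.cpair _ _ _ _ _ _ (ih1 hu rfl).some (ih2 hu rfl).some⟩
  | cfst _ _ _ _ _ d1 ih1 =>
    subst hD
    exact ⟨.cfst _ _ _ _ _ (ih1 hu rfl).some⟩
  | csnd _ _ _ _ _ d1 ih1 =>
    subst hD
    exact ⟨.csnd _ _ _ _ _ (ih1 hu rfl).some⟩
  | clam _ _ _ _ _ d1 ih1 =>
    subst hD
    exact ⟨.clam _ _ _ _ _ (ih1 (hu.shift _) rfl).some⟩
  | capp _ _ _ _ _ _ d1 d2 ih1 ih2 =>
    subst hD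
    rw [Tm.ssubst, (d2.stoupFree rfl).ssubst]
    exact ⟨.capp _ _ _ _ _ _ (ih1 hu rfl).some d2⟩
  | ilet _ _ _ _ _ d1 d2 ih1 ih2 =>
    subst hD
    rw [Tm.ssubst, (d2.stoupFree rfl).ssubst]
    exact ⟨.ilet _ _ _ _ _ (ih1 hu rfl).some d2⟩
  | banglet _ _ _ _ _ _ d1 d2 ih1 ih2 =>
    subst hD
    rw [Tm.ssubst, (d2.stoupFree rfl).ssubst]
    exact ⟨.banglet _ _ _ _ _ _ (ih1 hu rfl).some d2⟩
  | copow _ _ _ _ _ _ d1 d2 ih1 ih2 =>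
    subst hD
    rw [Tm.ssubst, (d1.stoupFree rfl).ssubst]
    exact ⟨.copow _ _ _ _ _ _ d1 (ih2 hu rfl).some⟩
  | copowlet _ _ _ _ _ _ _ d1 d2 ih1 ih2 =>
    subst hD
    exact ⟨.copowlet _ _ _ _ _ _ _ (ih1 hu rfl).some d2⟩
  | cimage _ _ _ _ d1 ih1 =>
    subst hD
    exact ⟨.cimage _ _ _ _ (ih1 hu rfl).some⟩
  | cinl _ _ _ _ _ d1 ih1 =>
    subst hD
    exact ⟨.cinl _ _ _ _ _ (ih1 hu rfl).some⟩
  | cinr _ _ _ _ _ d1 ih1 =>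
    subst hD
    exact ⟨.cinr _ _ _ _ _ (ih1 hu rfl).some⟩
  | ccase _ _ _ _ _ _ _ _ d1 d2 d3 ih1 ih2 ih3 =>
    subst hD
    exact ⟨.ccase _ _ _ _ _ _ _ _ (ih1 hu rfl).some d2 d3⟩
  | lapp _ _ _ _ _ _ d1 d2 ih1 ih2 =>
    subst hD
    rw [Tm.ssubst, (d1.stoupFree rfl).ssubst]
    exact ⟨.lapp _ _ _ _ _ _ d1 (ih2 hu rfl).some⟩
  | cunit _ _ => exact ⟨.cunit _ _⟩
  | _ => cases hD

/-! ### Equal terms are well-typed, and substitution respects equality -/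

theorem EEq.typed {Γ : List VType} {Δ : Option CType} {t u : Tm} {A : VType}
    (h : EEq Γ Δ t u A) : Ty Γ Δ t A ∧ Ty Γ Δ u A := by
  induction h with
  | refl d => exact ⟨⟨d⟩, ⟨d⟩⟩
  | symm _ ih => exact ih.symm
  | trans _ _ ih1 ih2 => exact ⟨ih1.1, ih2.2⟩
  | vpair_cong _ _ ih1 ih2 =>
    exact ⟨⟨.vpair _ _ _ _ _ ih1.1.some ih2.1.some⟩, ⟨.vpair _ _ _ _ _ ih1.2.some ih2.2.some⟩⟩
  | vfst_cong _ ih => exact ⟨⟨.vfst _ _ _ _ ih.1.some⟩, ⟨.vfst _ _ _ _ ih.2.some⟩⟩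
  | vsnd_cong _ ih => exact ⟨⟨.vsnd _ _ _ _ ih.1.some⟩, ⟨.vsnd _ _ _ _ ih.2.some⟩⟩
  | vlam_cong _ ih => exact ⟨⟨.vlam _ _ _ _ ih.1.some⟩, ⟨.vlam _ _ _ _ ih.2.some⟩⟩
  | vapp_cong _ _ ih1 ih2 =>
    exact ⟨⟨.vapp _ _ _ _ _ ih1.1.some ih2.1.some⟩, ⟨.vapp _ _ _ _ _ ih1.2.some ih2.2.some⟩⟩
  | cpair_cong _ _ ih1 ih2 =>
    exact ⟨⟨.cpair _ _ _ _ _ _ ih1.1.some ih2.1.some⟩,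
      ⟨.cpair _ _ _ _ _ _ ih1.2.some ih2.2.some⟩⟩
  | cfst_cong _ ih => exact ⟨⟨.cfst _ _ _ _ _ ih.1.some⟩, ⟨.cfst _ _ _ _ _ ih.2.some⟩⟩
  | csnd_cong _ ih => exact ⟨⟨.csnd _ _ _ _ _ ih.1.some⟩, ⟨.csnd _ _ _ _ _ ih.2.some⟩⟩
  | clam_cong _ ih => exact ⟨⟨.clam _ _ _ _ _ ih.1.some⟩, ⟨.clam _ _ _ _ _ ih.2.some⟩⟩
  | capp_cong _ _ ih1 ih2 =>
    exact ⟨⟨.capp _ _ _ _ _ _ ih1.1.some ih2.1.some⟩, ⟨.capp _ _ _ _ _ _ ih1.2.some ih2.2.some⟩⟩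
  | ilet_cong _ _ ih1 ih2 =>
    exact ⟨⟨.ilet _ _ _ _ _ ih1.1.some ih2.1.some⟩, ⟨.ilet _ _ _ _ _ ih1.2.some ih2.2.some⟩⟩
  | bang_cong _ ih => exact ⟨⟨.bang _ _ _ ih.1.some⟩, ⟨.bang _ _ _ ih.2.some⟩⟩
  | banglet_cong _ _ ih1 ih2 =>
    exact ⟨⟨.banglet _ _ _ _ _ _ ih1.1.some ih2.1.some⟩,
      ⟨.banglet _ _ _ _ _ _ ih1.2.some ih2.2.some⟩⟩
  | copow_cong _ _ ih1 ih2 =>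
    exact ⟨⟨.copow _ _ _ _ _ _ ih1.1.some ih2.1.some⟩,
      ⟨.copow _ _ _ _ _ _ ih1.2.some ih2.2.some⟩⟩
  | copowlet_cong _ _ ih1 ih2 =>
    exact ⟨⟨.copowlet _ _ _ _ _ _ _ ih1.1.some ih2.1.some⟩,
      ⟨.copowlet _ _ _ _ _ _ _ ih1.2.some ih2.2.some⟩⟩
  | cimage_cong _ ih => exact ⟨⟨.cimage _ _ _ _ ih.1.some⟩, ⟨.cimage _ _ _ _ ih.2.some⟩⟩
  | cinl_cong _ ih => exact ⟨⟨.cinl _ _ _ _ _ ih.1.some⟩, ⟨.cinl _ _ _ _ _ ih.2.some⟩⟩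
  | cinr_cong _ ih => exact ⟨⟨.cinr _ _ _ _ _ ih.1.some⟩, ⟨.cinr _ _ _ _ _ ih.2.some⟩⟩
  | ccase_cong _ _ _ ih1 ih2 ih3 =>
    exact ⟨⟨.ccase _ _ _ _ _ _ _ _ ih1.1.some ih2.1.some ih3.1.some⟩,
      ⟨.ccase _ _ _ _ _ _ _ _ ih1.2.some ih2.2.some ih3.2.some⟩⟩
  | llam_cong _ ih => exact ⟨⟨.llam _ _ _ _ ih.1.some⟩, ⟨.llam _ _ _ _ ih.2.some⟩⟩
  | lapp_cong _ _ ih1 ih2 =>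
    exact ⟨⟨.lapp _ _ _ _ _ _ ih1.1.some ih2.1.some⟩, ⟨.lapp _ _ _ _ _ _ ih1.2.some ih2.2.some⟩⟩
  | unit_eta d => exact ⟨⟨d⟩, ⟨.unit _⟩⟩
  | vfst_beta d e => exact ⟨⟨.vfst _ _ _ _ (.vpair _ _ _ _ _ d e)⟩, ⟨d⟩⟩
  | vsnd_beta d e => exact ⟨⟨.vsnd _ _ _ _ (.vpair _ _ _ _ _ d e)⟩, ⟨e⟩⟩
  | vpair_eta d => exact ⟨⟨.vpair _ _ _ _ _ (.vfst _ _ _ _ d) (.vsnd _ _ _ _ d)⟩, ⟨d⟩⟩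
  | vlam_beta d e =>
    exact ⟨⟨.vapp _ _ _ _ _ (.vlam _ _ _ _ d) e⟩, Ty.subst0 ⟨d⟩ ⟨e⟩⟩
  | @vlam_eta _ _ A _ d =>
    exact ⟨⟨.vlam _ _ _ _ (.vapp _ _ _ _ _ (Ty.shift ⟨d⟩ A).some (.var _ 0 _ rfl))⟩, ⟨d⟩⟩
  | cunit_eta d => exact ⟨⟨d⟩, ⟨.cunit _ _⟩⟩
  | cfst_beta d e => exact ⟨⟨.cfst _ _ _ _ _ (.cpair _ _ _ _ _ _ d e)⟩, ⟨d⟩⟩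
  | csnd_beta d e => exact ⟨⟨.csnd _ _ _ _ _ (.cpair _ _ _ _ _ _ d e)⟩, ⟨e⟩⟩
  | cpair_eta d => exact ⟨⟨.cpair _ _ _ _ _ _ (.cfst _ _ _ _ _ d) (.csnd _ _ _ _ _ d)⟩, ⟨d⟩⟩
  | clam_beta d e =>
    exact ⟨⟨.capp _ _ _ _ _ _ (.clam _ _ _ _ _ d) e⟩, Ty.subst0 ⟨d⟩ ⟨e⟩⟩
  | @clam_eta _ _ _ A _ d =>
    exact ⟨⟨.clam _ _ _ _ _ (.capp _ _ _ _ _ _ (Ty.shift ⟨d⟩ A).some (.var _ 0 _ rfl))⟩, ⟨d⟩⟩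
  | ilet_beta d => exact ⟨⟨.ilet _ _ _ _ _ (.top _) d⟩, ⟨d⟩⟩
  | ilet_eta d e =>
    exact ⟨⟨.ilet _ _ _ _ _ d (Ty.ssubst ⟨e⟩ ⟨.top _⟩).some⟩, Ty.ssubst ⟨e⟩ ⟨d⟩⟩
  | bang_beta d e =>
    exact ⟨⟨.banglet _ _ _ _ _ _ (.bang _ _ _ d) e⟩, Ty.subst0 ⟨e⟩ ⟨d⟩⟩
  | @bang_eta _ _ _ _ A _ d e =>
    exact ⟨⟨.banglet _ _ _ _ _ _ d
      (Ty.ssubst (Ty.shift ⟨e⟩ A) ⟨.bang _ _ _ (.var _ 0 _ rfl)⟩).some⟩, Ty.ssubst ⟨e⟩ ⟨d⟩⟩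
  | copow_beta d e f =>
    exact ⟨⟨.copowlet _ _ _ _ _ _ _ (.copow _ _ _ _ _ _ d e) f⟩,
      Ty.ssubst (Ty.subst0 ⟨f⟩ ⟨d⟩) ⟨e⟩⟩
  | @copow_eta _ _ _ _ A _ _ d e =>
    exact ⟨⟨.copowlet _ _ _ _ _ _ _ d
      (Ty.ssubst (Ty.shift ⟨e⟩ A) ⟨.copow _ _ _ _ _ _ (.var _ 0 _ rfl) (.svar _ _)⟩).some⟩,
      Ty.ssubst ⟨e⟩ ⟨d⟩⟩
  | czero_eta d e => exact ⟨⟨.cimage _ _ _ _ d⟩, Ty.ssubst ⟨e⟩ ⟨d⟩⟩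
  | csum_beta_inl d e f =>
    exact ⟨⟨.ccase _ _ _ _ _ _ _ _ (.cinl _ _ _ _ _ f) d e⟩, Ty.ssubst ⟨d⟩ ⟨f⟩⟩
  | csum_beta_inr d e f =>
    exact ⟨⟨.ccase _ _ _ _ _ _ _ _ (.cinr _ _ _ _ _ f) d e⟩, Ty.ssubst ⟨e⟩ ⟨f⟩⟩
  | csum_eta d e =>
    exact ⟨⟨.ccase _ _ _ _ _ _ _ _ d (Ty.ssubst ⟨e⟩ ⟨.cinl _ _ _ _ _ (.svar _ _)⟩).some
      (Ty.ssubst ⟨e⟩ ⟨.cinr _ _ _ _ _ (.svar _ _)⟩).some⟩, Ty.ssubst ⟨e⟩ ⟨d⟩⟩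
  | llam_beta d e =>
    exact ⟨⟨.lapp _ _ _ _ _ _ (.llam _ _ _ _ d) e⟩, Ty.ssubst ⟨d⟩ ⟨e⟩⟩
  | llam_eta d => exact ⟨⟨.llam _ _ _ _ (.lapp _ _ _ _ _ _ d (.svar _ _))⟩, ⟨d⟩⟩

theorem Ty.refl {Γ : List VType} {Δ : Option CType} {t : Tm} {A : VType} (h : Ty Γ Δ t A) :
    EEq Γ Δ t t A :=
  .refl h.some

theorem EEq.ssubst {Γ : List VType} {Δ : Option CType} {t t' u u' : Tm} {A B : CType}
    (h : EEq Γ (some A) t t' (.comp B)) (hu : EEq Γ Δ u u' (.comp A)) :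
    EEq Γ Δ (Tm.ssubst u t) (Tm.ssubst u' t') (.comp B) :=
  ((EEq.llam_beta h.typed.1.some hu.typed.1.some).symm.trans
    (.lapp_cong (.llam_cong h) hu)).trans (.llam_beta h.typed.2.some hu.typed.2.some)

/-- Extensionality for morphisms out of a sum. -/
theorem EEq.case_ext {Γ : List VType} {t a b : Tm} {A B C : CType}
    (h : Ty Γ (some (.csum A B)) t (.comp C))
    (ha : EEq Γ (some A) (Tm.ssubst (.cinl .svar) t) a (.comp C))
    (hb : EEq Γ (some B) (Tm.ssubst (.cinr .svar) t) b (.comp C)) :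
    EEq Γ (some (.csum A B)) t (.ccase .svar a b) (.comp C) := by
  have := EEq.csum_eta (.svar Γ (.csum A B)) h.some
  rw [ssubst_svar] at this
  exact this.symm.trans (.ccase_cong (.refl (.svar _ _)) ha hb)

/-- Extensionality for morphisms out of a copower. -/
theorem EEq.copow_ext {Γ : List VType} {t a : Tm} {A : VType} {B C : CType}
    (h : Ty Γ (some (.copow A B)) t (.comp C))
    (ha : EEq (A :: Γ) (some B) (Tm.ssubst (.copow (.var 0) .svar) (Tm.shift t)) a (.comp C)) :
    EEq Γ (some (.copow A B)) t (.copowlet .svar a) (.comp C) := by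
  have := EEq.copow_eta (.svar Γ (.copow A B)) h.some
  rw [ssubst_svar] at this
  exact this.symm.trans (.copowlet_cong (.refl (.svar _ _)) ha)

/-! ### Typing of the translation -/

/-- The result type of the translation of a judgement with stoup `Δ`. -/
def tgt (R : CType) : Option CType → CType
  | none => R
  | some D => cpsC R D

/-- The translation of a computation judgement as a map out of the continuation type. -/
def kont : Option CType → Tm → Tm
  | none, t => .lapp t .svar
  | some _, t => t

/-- Abstraction over the continuation, when the stoup is empty. -/
def unkont : Option CType → CType → Tm → Tm
  | none, X, b => .llam X b
  | some _, _, b => b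

/-- Well-typedness of the translation of a judgement. -/
def CpsTy (R : CType) (Γ : List VType) : Option CType → Tm → VType → Prop
  | none, t, A => Ty Γ none t (cpsV R A)
  | some D, t, A => Ty Γ (some (cpsC R A.cod)) t (.comp (cpsC R D))

theorem psubst_kont (σ : ℕ → Tm) (Δ : Option CType) (t : Tm) :
    psubst σ (kont Δ t) = kont Δ (psubst σ t) := by
  cases Δ <;> rfl

theorem psubst_unkont (σ : ℕ → Tm) (Δ : Option CType) (X : CType) (b : Tm) :
    psubst σ (unkont Δ X b) = unkont Δ X (psubst σ b) := by
  cases Δ <;> rfl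

theorem CpsTy.kont {R : CType} {Γ : List VType} {Δ : Option CType} {t : Tm} {B : CType}
    (h : CpsTy R Γ Δ t (.comp B)) :
    Ty Γ (some (cpsC R B)) (kont Δ t) (.comp (tgt R Δ)) := by
  cases Δ with
  | none =>
    have h : Ty Γ none t (.lin (cpsC R B) R) := by simpa [CpsTy, cpsV] using h
    exact ⟨.lapp _ _ _ _ _ _ h.some (.svar _ _)⟩
  | some D => exact h

theorem kont_unkont {Γ : List VType} {Δ : Option CType} {X T : CType} {b : Tm}
    (h : Ty Γ (some X) b (.comp T)) :
    EEq Γ (some X) (kont Δ (unkont Δ X b)) b (.comp T) := by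
  cases Δ with
  | none =>
    have := EEq.llam_beta h.some (.svar Γ X)
    rwa [ssubst_svar] at this
  | some D => exact h.refl

theorem cps_typed (R : CType) {Γ : List VType} {Δ : Option CType} {t : Tm} {A : VType}
    (d : Deriv Γ Δ t A) : CpsTy R (cpsCtx R Γ) Δ (cps R d) A := by
  induction d with
  | var _ n A h => exact ⟨.var _ _ _ (by simp [cpsCtx, h])⟩
  | svar _ A => exact ⟨.svar _ _⟩
  | unit _ =>
    simp only [CpsTy, cpsV, cps] at *
    exact ⟨.unit _⟩
  | vpair _ _ _ _ _ _ _ ih1 ih2 =>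
    simp only [CpsTy, cpsV, cps] at *
    exact ⟨.vpair _ _ _ _ _ ih1.some ih2.some⟩
  | vfst _ _ _ _ _ ih1 =>
    simp only [CpsTy, cpsV, cps] at *
    exact ⟨.vfst _ _ _ _ ih1.some⟩
  | vsnd _ _ _ _ _ ih1 =>
    simp only [CpsTy, cpsV, cps] at *
    exact ⟨.vsnd _ _ _ _ ih1.some⟩
  | vlam _ _ _ _ _ ih1 =>
    simp only [CpsTy, cpsV, cps] at *
    exact ⟨.vlam _ _ _ _ ih1.some⟩
  | vapp _ _ _ _ _ _ _ ih1 ih2 =>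
    simp only [CpsTy, cpsV, cps] at *
    exact ⟨.vapp _ _ _ _ _ ih1.some ih2.some⟩
  | cunit _ Δ =>
    cases Δ <;> simp only [CpsTy, cpsV, cpsC, cps, VType.cod] at *
    · exact ⟨.llam _ _ _ _ (.cimage _ _ _ _ (.svar _ _))⟩
    · exact ⟨.cimage _ _ _ _ (.svar _ _)⟩
  | cpair _ Δ _ _ _ _ _ _ ih1 ih2 =>
    cases Δ <;> simp only [CpsTy, cpsV, cpsC, cps, VType.cod] at *
    · exact ⟨.llam _ _ _ _ (.ccase _ _ _ _ _ _ _ _ (.svar _ _)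
        (.lapp _ _ _ _ _ _ ih1.some (.svar _ _)) (.lapp _ _ _ _ _ _ ih2.some (.svar _ _)))⟩
    · exact ⟨.ccase _ _ _ _ _ _ _ _ (.svar _ _) ih1.some ih2.some⟩
  | cfst _ Δ _ _ _ _ ih1 =>
    cases Δ <;> simp only [CpsTy, cpsV, cpsC, cps, VType.cod] at *
    · exact ⟨.llam _ _ _ _ (.lapp _ _ _ _ _ _ ih1.some (.cinl _ _ _ _ _ (.svar _ _)))⟩
    · exact ih1.ssubst ⟨.cinl _ _ _ _ _ (.svar _ _)⟩
  | csnd _ Δ _ _ _ _ ih1 =>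
    cases Δ <;> simp only [CpsTy, cpsV, cpsC, cps, VType.cod] at *
    · exact ⟨.llam _ _ _ _ (.lapp _ _ _ _ _ _ ih1.some (.cinr _ _ _ _ _ (.svar _ _)))⟩
    · exact ih1.ssubst ⟨.cinr _ _ _ _ _ (.svar _ _)⟩
  | clam _ Δ _ _ _ _ ih1 =>
    cases Δ <;> simp only [CpsTy, cpsV, cpsC, cps, VType.cod] at *
    · exact ⟨.llam _ _ _ _ (.copowlet _ _ _ _ _ _ _ (.svar _ _)
        (.lapp _ _ _ _ _ _ ih1.some (.svar _ _)))⟩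
    · exact ⟨.copowlet _ _ _ _ _ _ _ (.svar _ _) ih1.some⟩
  | capp _ Δ _ _ _ _ _ _ ih1 ih2 =>
    cases Δ <;> simp only [CpsTy, cpsV, cpsC, cps, VType.cod] at *
    · exact ⟨.llam _ _ _ _ (.lapp _ _ _ _ _ _ ih1.some (.copow _ _ _ _ _ _ ih2.some (.svar _ _)))⟩
    · exact ih1.ssubst ⟨.copow _ _ _ _ _ _ ih2.some (.svar _ _)⟩
  | top _ =>
    simp only [CpsTy, cpsV, cpsC, cps] at *
    exact ⟨.llam _ _ _ _ (.svar _ _)⟩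
  | ilet _ Δ _ _ _ _ _ ih1 ih2 =>
    cases Δ <;> simp only [CpsTy, cpsV, cpsC, cps, VType.cod] at *
    · exact ⟨.llam _ _ _ _ (.lapp _ _ _ _ _ _ ih1.some (.lapp _ _ _ _ _ _ ih2.some (.svar _ _)))⟩
    · exact ih1.ssubst ⟨.lapp _ _ _ _ _ _ ih2.some (.svar _ _)⟩
  | bang _ _ _ _ ih1 =>
    simp only [CpsTy, cpsV, cpsC, cps] at *
    exact ⟨.llam _ _ _ _ (.capp _ _ _ _ _ _ (.svar _ _) ih1.some)⟩
  | banglet _ Δ _ _ _ _ _ _ ih1 ih2 =>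
    cases Δ <;> simp only [CpsTy, cpsV, cpsC, cps, VType.cod] at *
    · exact ⟨.llam _ _ _ _ (.lapp _ _ _ _ _ _ ih1.some
        (.clam _ _ _ _ _ (.lapp _ _ _ _ _ _ ih2.some (.svar _ _))))⟩
    · exact ih1.ssubst ⟨.clam _ _ _ _ _ (.lapp _ _ _ _ _ _ ih2.some (.svar _ _))⟩
  | copow _ Δ _ _ _ _ _ _ ih1 ih2 =>
    cases Δ <;> simp only [CpsTy, cpsV, cpsC, cps, VType.cod] at *
    · exact ⟨.llam _ _ _ _ (.lapp _ _ _ _ _ _ ih2.some (.capp _ _ _ _ _ _ (.svar _ _) ih1.some))⟩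
    · exact ih2.ssubst ⟨.capp _ _ _ _ _ _ (.svar _ _) ih1.some⟩
  | copowlet _ Δ _ _ _ _ _ _ _ ih1 ih2 =>
    cases Δ <;> simp only [CpsTy, cpsV, cpsC, cps, VType.cod] at *
    · exact ⟨.llam _ _ _ _ (.lapp _ _ _ _ _ _ ih1.some (.clam _ _ _ _ _ ih2.some))⟩
    · exact ih1.ssubst ⟨.clam _ _ _ _ _ ih2.some⟩
  | cimage _ Δ _ _ _ ih1 =>
    cases Δ <;> simp only [CpsTy, cpsV, cpsC, cps, VType.cod] at *
    · exact ⟨.llam _ _ _ _ (.lapp _ _ _ _ _ _ ih1.some (.cunit _ _))⟩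
    · exact ih1.ssubst ⟨.cunit _ _⟩
  | cinl _ Δ _ _ _ _ ih1 =>
    cases Δ <;> simp only [CpsTy, cpsV, cpsC, cps, VType.cod] at *
    · exact ⟨.llam _ _ _ _ (.lapp _ _ _ _ _ _ ih1.some (.cfst _ _ _ _ _ (.svar _ _)))⟩
    · exact ih1.ssubst ⟨.cfst _ _ _ _ _ (.svar _ _)⟩
  | cinr _ Δ _ _ _ _ ih1 =>
    cases Δ <;> simp only [CpsTy, cpsV, cpsC, cps, VType.cod] at *
    · exact ⟨.llam _ _ _ _ (.lapp _ _ _ _ _ _ ih1.some (.csnd _ _ _ _ _ (.svar _ _)))⟩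
    · exact ih1.ssubst ⟨.csnd _ _ _ _ _ (.svar _ _)⟩
  | ccase _ Δ _ _ _ _ _ _ _ _ _ ih1 ih2 ih3 =>
    cases Δ <;> simp only [CpsTy, cpsV, cpsC, cps, VType.cod] at *
    · exact ⟨.llam _ _ _ _ (.lapp _ _ _ _ _ _ ih1.some (.cpair _ _ _ _ _ _ ih2.some ih3.some))⟩
    · exact ih1.ssubst ⟨.cpair _ _ _ _ _ _ ih2.some ih3.some⟩
  | llam _ _ _ _ _ ih1 =>
    simp only [CpsTy, cpsV, cps, VType.cod] at *
    exact ⟨.llam _ _ _ _ ih1.some⟩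
  | lapp _ Δ _ _ _ _ _ _ ih1 ih2 =>
    cases Δ <;> simp only [CpsTy, cpsV, cps, VType.cod] at *
    · exact ⟨.llam _ _ _ _ (.lapp _ _ _ _ _ _ ih2.some (.lapp _ _ _ _ _ _ ih1.some (.svar _ _)))⟩
    · exact ih2.ssubst ⟨.lapp _ _ _ _ _ _ ih1.some (.svar _ _)⟩

/-! ### Mediating types

A raw term may have derivations with different types, because `cinl` and `cinr` carry no type
annotation.  The translations of two types of a common term are compared through a mediating
type, together with coercions. -/

open Classical in
mutual
  /-- Mediating type of the translations of two value types, if there is one. -/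
  noncomputable def meetV (R : CType) : VType → VType → Option VType
    | .base a, .base b => if a = b then some (.base a) else none
    | .unit, .unit => some .unit
    | .prod A B, .prod A' B' =>
        match meetV R A A', meetV R B B' with
        | some M, some N => some (.prod M N)
        | _, _ => none
    | .arr A B, .arr A' B' =>
        if A = A' then (meetV R B B').map (.arr (cpsV R A)) else none
    | .comp A, .comp A' => some (.lin (meetC R A A') R)
    | .lin A B, .lin A' B' =>
        if A = A' then some (.lin (meetC R B B') (cpsC R A)) else none
    | _, _ => none
  /-- Mediating type of the translations of two computation types. -/
  noncomputable def meetC (R : CType) : CType → CType → CType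
    | .base a, .base b => if a = b then cpsC R (.base a) else .cunit
    | .cunit, .cunit => .czero
    | .cand A B, .cand A' B' => .csum (meetC R A A') (meetC R B B')
    | .carr A B, .carr A' B' => if A = A' then .copow (cpsV R A) (meetC R B B') else .cunit
    | .iunit, .iunit => R
    | .bang A, .bang A' =>
        match meetV R A A' with
        | some M => .carr M R
        | none => .cunit
    | .copow A B, .copow A' B' =>
        match meetV R A A' with
        | some M => .carr M (meetC R B B')
        | none => .cunit
    | .csum A B, .csum A' B' => .cand (meetC R A A') (meetC R B B')
    | _, _ => .cunit
end

open Classical in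
mutual
  /-- Coercion from the mediating type of two value types to the translation of the first. -/
  noncomputable def coeV (R : CType) : VType → VType → Tm → Tm
    | .prod A B, .prod A' B', v => .vpair (coeV R A A' (.vfst v)) (coeV R B B' (.vsnd v))
    | .arr A B, .arr _ B', v => .vlam (cpsV R A) (coeV R B B' (.vapp (shift v) (.var 0)))
    | .comp A, .comp A', v => .llam (cpsC R A) (.lapp v (coeC R A A' .svar))
    | .lin _ B, .lin _ B', v => .llam (cpsC R B) (.lapp v (coeC R B B' .svar))
    | _, _, v => v
  /-- Coercion from the translation of a computation type to a mediating type. -/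
  noncomputable def coeC (R : CType) : CType → CType → Tm → Tm
    | .base a, .base b, k => if a = b then k else .cunit
    | .cunit, .cunit, k => k
    | .cand A B, .cand A' B', k =>
        .ccase k (.cinl (coeC R A A' .svar)) (.cinr (coeC R B B' .svar))
    | .carr A B, .carr A' B', k =>
        if A = A' then .copowlet k (.copow (.var 0) (coeC R B B' .svar)) else .cunit
    | .iunit, .iunit, k => k
    | .bang A, .bang A', k =>
        match meetV R A A' with
        | some M => .clam M (.capp (shift k) (coeV R A A' (.var 0)))
        | none => .cunit
    | .copow A B, .copow A' B', k =>
        match meetV R A A' with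
        | some M => .clam M (coeC R B B' (.capp (shift k) (coeV R A A' (.var 0))))
        | none => .cunit
    | .csum A B, .csum A' B', k => .cpair (coeC R A A' (.cfst k)) (coeC R B B' (.csnd k))
    | _, _, _ => .cunit
end

mutual
  theorem meetV_symm (R : CType) : ∀ A A' : VType, meetV R A A' = meetV R A' A
    | .base a, A' => by cases A' <;> simp [meetV, eq_comm]; split_ifs <;> simp_all
    | .unit, A' => by cases A' <;> simp [meetV]
    | .prod A B, A' => by
      cases A' <;> simp only [meetV]
      rw [meetV_symm R A, meetV_symm R B]
    | .arr A B, A' => by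
      cases A' <;> simp only [meetV]
      rw [meetV_symm R B]
      split_ifs <;> simp_all
    | .comp A, A' => by
      cases A' <;> simp only [meetV]
      rw [meetC_symm R A]
    | .lin A B, A' => by
      cases A' <;> simp only [meetV]
      rw [meetC_symm R B]
      split_ifs <;> simp_all
  theorem meetC_symm (R : CType) : ∀ A A' : CType, meetC R A A' = meetC R A' A
    | .base a, A' => by cases A' <;> simp [meetC, eq_comm]; split_ifs <;> simp_all
    | .cunit, A' => by cases A' <;> simp [meetC]
    | .cand A B, A' => by
      cases A' <;> simp only [meetC]
      rw [meetC_symm R A, meetC_symm R B]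
    | .carr A B, A' => by
      cases A' <;> simp only [meetC]
      rw [meetC_symm R B]
      split_ifs <;> simp_all
    | .iunit, A' => by cases A' <;> simp [meetC]
    | .bang A, A' => by
      cases A' <;> simp only [meetC]
      rw [meetV_symm R A]
    | .copow A B, A' => by
      cases A' <;> simp only [meetC]
      rw [meetV_symm R A, meetC_symm R B]
    | .czero, A' => by cases A' <;> simp [meetC]
    | .csum A B, A' => by
      cases A' <;> simp only [meetC]
      rw [meetC_symm R A, meetC_symm R B]
end

mutual
  theorem meetV_self (R : CType) : ∀ A : VType, meetV R A A = some (cpsV R A)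
    | .base a => by simp [meetV, cpsV]
    | .unit => by simp [meetV, cpsV]
    | .prod A B => by simp [meetV, cpsV, meetV_self R A, meetV_self R B]
    | .arr A B => by simp [meetV, cpsV, meetV_self R B]
    | .comp A => by simp [meetV, cpsV, meetC_self R A]
    | .lin A B => by simp [meetV, cpsV, meetC_self R B]
  theorem meetC_self (R : CType) : ∀ A : CType, meetC R A A = cpsC R A
    | .base a => by simp [meetC]
    | .cunit => by simp [meetC, cpsC]
    | .cand A B => by simp [meetC, cpsC, meetC_self R A, meetC_self R B]
    | .carr A B => by simp [meetC, cpsC, meetC_self R B]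
    | .iunit => by simp [meetC, cpsC]
    | .bang A => by simp [meetC, cpsC, meetV_self R A]
    | .copow A B => by simp [meetC, cpsC, meetV_self R A, meetC_self R B]
    | .czero => by simp [meetC, cpsC]
    | .csum A B => by simp [meetC, cpsC, meetC_self R A, meetC_self R B]
end

mutual
  theorem psubst_coeV (R : CType) : ∀ (A A' : VType) (σ : ℕ → Tm) (v : Tm),
      psubst σ (coeV R A A' v) = coeV R A A' (psubst σ v)
    | .base a, A', σ, v => by cases A' <;> simp [coeV]
    | .unit, A', σ, v => by cases A' <;> simp [coeV]
    | .prod A B, A', σ, v => by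
      cases A' <;> simp [coeV, psubst, psubst_coeV R A, psubst_coeV R B]
    | .arr A B, A', σ, v => by
      cases A' <;> simp [coeV, psubst, psubst_coeV R B, psubst_shift, liftS]
    | .comp A, A', σ, v => by cases A' <;> simp [coeV, psubst, psubst_coeC R A]
    | .lin A B, A', σ, v => by cases A' <;> simp [coeV, psubst, psubst_coeC R B]
  theorem psubst_coeC (R : CType) : ∀ (A A' : CType) (σ : ℕ → Tm) (k : Tm),
      psubst σ (coeC R A A' k) = coeC R A A' (psubst σ k)
    | .base a, A', σ, k => by
      cases A' <;> simp only [coeC, psubst]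
      split_ifs <;> simp [psubst]
    | .cunit, A', σ, k => by cases A' <;> simp [coeC, psubst]
    | .cand A B, A', σ, k => by
      cases A' <;> simp [coeC, psubst, psubst_coeC R A, psubst_coeC R B]
    | .carr A B, A', σ, k => by
      cases A' <;> simp only [coeC, psubst]
      split_ifs <;> simp [psubst, psubst_coeC R B, liftS]
    | .iunit, A', σ, k => by cases A' <;> simp [coeC, psubst]
    | .bang A, A', σ, k => by
      cases A' <;> simp only [coeC, psubst]
      split <;> simp [psubst, psubst_coeV R A, psubst_shift, liftS]
    | .copow A B, A', σ, k => by
      cases A' <;> simp only [coeC, psubst]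
      split <;> simp [psubst, psubst_coeV R A, psubst_coeC R B, psubst_shift, liftS]
    | .czero, A', σ, k => by cases A' <;> simp [coeC, psubst]
    | .csum A B, A', σ, k => by
      cases A' <;> simp [coeC, psubst, psubst_coeC R A, psubst_coeC R B]
end

theorem rename_eq_psubst (f : ℕ → ℕ) (t : Tm) : rename f t = psubst (Tm.var ∘ f) t := by
  rw [← psubst_rename, psubst_var]

theorem shift_coeV (R : CType) (A A' : VType) (v : Tm) :
    shift (coeV R A A' v) = coeV R A A' (shift v) := by
  simp only [shift, rename_eq_psubst, psubst_coeV]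

theorem shift_coeC (R : CType) (A A' : CType) (k : Tm) :
    shift (coeC R A A' k) = coeC R A A' (shift k) := by
  simp only [shift, rename_eq_psubst, psubst_coeC]

mutual
  theorem ssubst_coeV (R : CType) : ∀ (A A' : VType) (u v : Tm), v.StoupFree →
      ssubst u (coeV R A A' v) = coeV R A A' v
    | .base a, A', u, v, h => by cases A' <;> simp [coeV, h.ssubst]
    | .unit, A', u, v, h => by cases A' <;> simp [coeV, h.ssubst]
    | .prod A B, A', u, v, h => by
      have h1 : (Tm.vfst v).StoupFree := by simp [StoupFree, ssubst, h.ssubst]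
      have h2 : (Tm.vsnd v).StoupFree := by simp [StoupFree, ssubst, h.ssubst]
      cases A' <;> simp [coeV, ssubst, h.ssubst, ssubst_coeV R A _ _ _ h1, ssubst_coeV R B _ _ _ h2]
    | .arr A B, A', u, v, h => by
      have h1 : (Tm.vapp (shift v) (.var 0)).StoupFree := by
        simp [StoupFree, ssubst, shift, (h.rename _).ssubst]
      cases A' <;> simp [coeV, ssubst, h.ssubst, ssubst_coeV R B _ _ _ h1]
    | .comp A, A', u, v, h => by cases A' <;> simp [coeV, ssubst, h.ssubst]
    | .lin A B, A', u, v, h => by cases A' <;> simp [coeV, ssubst, h.ssubst]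
  theorem ssubst_coeC (R : CType) : ∀ (A A' : CType) (u k : Tm),
      ssubst u (coeC R A A' k) = coeC R A A' (ssubst u k)
    | .base a, A', u, k => by
      cases A' <;> simp only [coeC, ssubst]
      split_ifs <;> simp [ssubst]
    | .cunit, A', u, k => by cases A' <;> simp [coeC, ssubst]
    | .cand A B, A', u, k => by cases A' <;> simp [coeC, ssubst]
    | .carr A B, A', u, k => by
      cases A' <;> simp only [coeC, ssubst]
      split_ifs <;> simp [ssubst]
    | .iunit, A', u, k => by cases A' <;> simp [coeC, ssubst]
    | .bang A, A', u, k => by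
      cases A' <;> simp only [coeC, ssubst]
      split <;> simp [ssubst, ssubst_coeV R A _ _ (.var 0) rfl, shift_ssubst]
    | .copow A B, A', u, k => by
      cases A' <;> simp only [coeC, ssubst]
      split <;> simp [ssubst, ssubst_coeV R A _ _ (.var 0) rfl, ssubst_coeC R B, shift_ssubst]
    | .czero, A', u, k => by cases A' <;> simp [coeC, ssubst]
    | .csum A B, A', u, k => by
      cases A' <;> simp [coeC, ssubst, ssubst_coeC R A, ssubst_coeC R B]
end

mutual
  theorem coeV_typed (R : CType) : ∀ (A A' : VType) {Γ : List VType} {N : VType} {v : Tm},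
      meetV R A A' = some N → Ty Γ none v N → Ty Γ none (coeV R A A' v) (cpsV R A)
    | .base a, A', Γ, N, v, hN, h => by
      cases A' <;> simp [meetV, coeV, cpsV] at *
      obtain ⟨rfl, rfl⟩ := hN
      exact h
    | .unit, A', Γ, N, v, hN, h => by
      cases A' <;> simp [meetV, coeV, cpsV] at *
      subst hN
      exact h
    | .prod A B, A', Γ, N, v, hN, h => by
      cases A' <;> simp only [meetV, coeV, cpsV, reduceCtorEq] at *
      split at hN <;> simp at hN
      subst hN
      exact ⟨.vpair _ _ _ _ _ (coeV_typed R A _ ‹_› ⟨.vfst _ _ _ _ h.some⟩).some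
        (coeV_typed R B _ ‹_› ⟨.vsnd _ _ _ _ h.some⟩).some⟩
    | .arr A B, A', Γ, N, v, hN, h => by
      cases A' <;> simp only [meetV, coeV, cpsV, reduceCtorEq] at *
      split_ifs at hN
      simp only [Option.map_eq_some_iff] at hN
      obtain ⟨M, hM, rfl⟩ := hN
      exact ⟨.vlam _ _ _ _ (coeV_typed R B _ hM
        ⟨.vapp _ _ _ _ _ (h.shift _).some (.var _ 0 _ rfl)⟩).some⟩
    | .comp A, A', Γ, N, v, hN, h => by
      cases A' <;> simp only [meetV, coeV, cpsV, reduceCtorEq, Option.some.injEq] at *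
      subst hN
      exact ⟨.llam _ _ _ _ (.lapp _ _ _ _ _ _ h.some (coeC_typed R A _ ⟨.svar _ _⟩).some)⟩
    | .lin A B, A', Γ, N, v, hN, h => by
      cases A' <;> simp only [meetV, coeV, cpsV, reduceCtorEq] at *
      split_ifs at hN
      simp only [Option.some.injEq] at hN
      subst hN
      exact ⟨.llam _ _ _ _ (.lapp _ _ _ _ _ _ h.some (coeC_typed R B _ ⟨.svar _ _⟩).some)⟩
  theorem coeC_typed (R : CType) : ∀ (A A' : CType) {Γ : List VType} {Δ : Option CType} {k : Tm},
      Ty Γ Δ k (.comp (cpsC R A)) → Ty Γ Δ (coeC R A A' k) (.comp (meetC R A A'))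
    | .base a, A', Γ, Δ, k, h => by
      cases A' <;> simp only [meetC, coeC] <;> try exact ⟨.cunit _ _⟩
      split_ifs <;> first | exact ⟨.cunit _ _⟩ | exact h
    | .cunit, A', Γ, Δ, k, h => by
      cases A' <;> simp only [meetC, coeC] <;> first | exact ⟨.cunit _ _⟩ | skip
      simpa only [cpsC] using h
    | .cand A B, A', Γ, Δ, k, h => by
      cases A' <;> simp only [meetC, coeC, cpsC] at * <;> try exact ⟨.cunit _ _⟩
      exact ⟨.ccase _ _ _ _ _ _ _ _ h.some
        (.cinl _ _ _ _ _ (coeC_typed R A _ ⟨.svar _ _⟩).some)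
        (.cinr _ _ _ _ _ (coeC_typed R B _ ⟨.svar _ _⟩).some)⟩
    | .carr A B, A', Γ, Δ, k, h => by
      cases A' <;> simp only [meetC, coeC, cpsC] at * <;> try exact ⟨.cunit _ _⟩
      split_ifs <;> try exact ⟨.cunit _ _⟩
      exact ⟨.copowlet _ _ _ _ _ _ _ h.some (.copow _ _ _ _ _ _ (.var _ 0 _ rfl)
        (coeC_typed R B _ ⟨.svar _ _⟩).some)⟩
    | .iunit, A', Γ, Δ, k, h => by
      cases A' <;> simp only [meetC, coeC] <;> first | exact ⟨.cunit _ _⟩ | skip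
      simpa only [cpsC] using h
    | .bang A, A', Γ, Δ, k, h => by
      cases A' <;> simp only [meetC, coeC, cpsC] at * <;> try exact ⟨.cunit _ _⟩
      split <;> try exact ⟨.cunit _ _⟩
      exact ⟨.clam _ _ _ _ _ (.capp _ _ _ _ _ _ (h.shift _).some
        (coeV_typed R A _ ‹_› ⟨.var _ 0 _ rfl⟩).some)⟩
    | .copow A B, A', Γ, Δ, k, h => by
      cases A' <;> simp only [meetC, coeC, cpsC] at * <;> try exact ⟨.cunit _ _⟩
      split <;> try exact ⟨.cunit _ _⟩
      exact ⟨.clam _ _ _ _ _ (coeC_typed R B _ ⟨.capp _ _ _ _ _ _ (h.shift _).some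
        (coeV_typed R A _ ‹_› ⟨.var _ 0 _ rfl⟩).some⟩).some⟩
    | .czero, A', Γ, Δ, k, h => by
      cases A' <;> simp only [meetC, coeC] <;> exact ⟨.cunit _ _⟩
    | .csum A B, A', Γ, Δ, k, h => by
      cases A' <;> simp only [meetC, coeC, cpsC] at * <;> try exact ⟨.cunit _ _⟩
      exact ⟨.cpair _ _ _ _ _ _ (coeC_typed R A _ ⟨.cfst _ _ _ _ _ h.some⟩).some
        (coeC_typed R B _ ⟨.csnd _ _ _ _ _ h.some⟩).some⟩
end

/-! ### Equational properties of the coercions -/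

theorem ssubst_coeC_svar (R : CType) (A A' : CType) (k : Tm) :
    ssubst k (coeC R A A' .svar) = coeC R A A' k := by
  rw [ssubst_coeC, ssubst]

theorem coeC_svar_typed (R : CType) (A A' : CType) (Γ : List VType) :
    Ty Γ (some (cpsC R A)) (coeC R A A' .svar) (.comp (meetC R A A')) :=
  coeC_typed R A A' ⟨.svar _ _⟩

theorem coeC_cong {R : CType} {A A' : CType} {Γ : List VType} {Δ : Option CType} {k k' : Tm}
    (h : EEq Γ Δ k k' (.comp (cpsC R A))) :
    EEq Γ Δ (coeC R A A' k) (coeC R A A' k') (.comp (meetC R A A')) := by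
  have := (coeC_svar_typed R A A' Γ).refl.ssubst h
  simpa only [ssubst_coeC_svar] using this

theorem coeV_cong {R : CType} {A A' N : VType} {Γ : List VType} {v v' : Tm}
    (hN : meetV R A A' = some N) (h : EEq Γ none v v' N) :
    EEq Γ none (coeV R A A' v) (coeV R A A' v') (cpsV R A) := by
  have hb : Ty (N :: Γ) none (coeV R A A' (.var 0)) (cpsV R A) :=
    coeV_typed R A A' hN ⟨.var _ 0 _ rfl⟩
  have key : ∀ w, Ty Γ none w N →
      EEq Γ none (.vapp (.vlam N (coeV R A A' (.var 0))) w) (coeV R A A' w) (cpsV R A) := by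
    intro w hw
    have := EEq.vlam_beta hb.some hw.some
    rwa [subst0_eq, psubst_coeV] at this
  exact ((key v h.typed.1).symm.trans (.vapp_cong (.vlam_cong hb.refl) h)).trans
    (key v' h.typed.2)

mutual
  theorem coeV_self (R : CType) : ∀ (A : VType) {Γ : List VType} {v : Tm},
      Ty Γ none v (cpsV R A) → EEq Γ none (coeV R A A v) v (cpsV R A)
    | .base a, Γ, v, h => by simpa only [coeV] using h.refl
    | .unit, Γ, v, h => by simpa only [coeV] using h.refl
    | .prod A B, Γ, v, h => by
      simp only [coeV, cpsV] at *
      exact (EEq.vpair_cong (coeV_self R A ⟨.vfst _ _ _ _ h.some⟩)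
        (coeV_self R B ⟨.vsnd _ _ _ _ h.some⟩)).trans (.vpair_eta h.some)
    | .arr A B, Γ, v, h => by
      simp only [coeV, cpsV] at *
      exact (EEq.vlam_cong (coeV_self R B ⟨.vapp _ _ _ _ _ (h.shift _).some
        (.var _ 0 _ rfl)⟩)).trans (.vlam_eta h.some)
    | .comp A, Γ, v, h => by
      simp only [coeV, cpsV] at *
      exact (EEq.llam_cong (.lapp_cong h.refl (coeC_self R A ⟨.svar _ _⟩))).trans
        (.llam_eta h.some)
    | .lin A B, Γ, v, h => by
      simp only [coeV, cpsV] at *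
      exact (EEq.llam_cong (.lapp_cong h.refl (coeC_self R B ⟨.svar _ _⟩))).trans
        (.llam_eta h.some)
  theorem coeC_self (R : CType) : ∀ (A : CType) {Γ : List VType} {Δ : Option CType} {k : Tm},
      Ty Γ Δ k (.comp (cpsC R A)) → EEq Γ Δ (coeC R A A k) k (.comp (cpsC R A))
    | .base a, Γ, Δ, k, h => by simpa only [coeC, if_true] using h.refl
    | .cunit, Γ, Δ, k, h => by simpa only [coeC] using h.refl
    | .cand A B, Γ, Δ, k, h => by
      simp only [coeC, cpsC] at *
      exact (EEq.ccase_cong h.refl (.cinl_cong (coeC_self R A ⟨.svar _ _⟩))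
        (.cinr_cong (coeC_self R B ⟨.svar _ _⟩))).trans (.csum_eta h.some (.svar _ _))
    | .carr A B, Γ, Δ, k, h => by
      simp only [coeC, cpsC, if_true] at *
      exact (EEq.copowlet_cong h.refl (.copow_cong (.refl (.var _ 0 _ rfl))
        (coeC_self R B ⟨.svar _ _⟩))).trans (.copow_eta h.some (.svar _ _))
    | .iunit, Γ, Δ, k, h => by simpa only [coeC] using h.refl
    | .bang A, Γ, Δ, k, h => by
      simp only [coeC, cpsC, meetV_self] at *
      exact (EEq.clam_cong (.capp_cong (h.shift _).refl
        (coeV_self R A ⟨.var _ 0 _ rfl⟩))).trans (.clam_eta h.some)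
    | .copow A B, Γ, Δ, k, h => by
      simp only [coeC, cpsC, meetV_self] at *
      have hv : Ty (cpsV R A :: Γ) none (coeV R A A (.var 0)) (cpsV R A) :=
        coeV_typed R A A (meetV_self R A) ⟨.var _ 0 _ rfl⟩
      exact (EEq.clam_cong ((coeC_self R B ⟨.capp _ _ _ _ _ _ (h.shift _).some hv.some⟩).trans
        (.capp_cong (h.shift _).refl (coeV_self R A ⟨.var _ 0 _ rfl⟩)))).trans (.clam_eta h.some)
    | .czero, Γ, Δ, k, h => by
      simp only [coeC, cpsC] at *
      exact (EEq.cunit_eta h.some).symm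
    | .csum A B, Γ, Δ, k, h => by
      simp only [coeC, cpsC] at *
      exact (EEq.cpair_cong (coeC_self R A ⟨.cfst _ _ _ _ _ h.some⟩)
        (coeC_self R B ⟨.csnd _ _ _ _ _ h.some⟩)).trans (.cpair_eta h.some)
end

/-- Any two maps into `1̲` are equal. -/
theorem EEq.of_cunit {Γ : List VType} {Δ : Option CType} {t u : Tm} (ht : Ty Γ Δ t (.comp .cunit))
    (hu : Ty Γ Δ u (.comp .cunit)) : EEq Γ Δ t u (.comp .cunit) :=
  (EEq.cunit_eta ht.some).trans (EEq.cunit_eta hu.some).symm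

theorem EEq.sinl_beta {Γ : List VType} {a b : Tm} {A B C : CType}
    (ha : Ty Γ (some A) a (.comp C)) (hb : Ty Γ (some B) b (.comp C)) :
    EEq Γ (some A) (.ccase (.cinl .svar) a b) a (.comp C) := by
  have := EEq.csum_beta_inl ha.some hb.some (.svar Γ A)
  rwa [ssubst_svar] at this

theorem EEq.sinr_beta {Γ : List VType} {a b : Tm} {A B C : CType}
    (ha : Ty Γ (some A) a (.comp C)) (hb : Ty Γ (some B) b (.comp C)) :
    EEq Γ (some B) (.ccase (.cinr .svar) a b) b (.comp C) := by
  have := EEq.csum_beta_inr ha.some hb.some (.svar Γ B)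
  rwa [ssubst_svar] at this

theorem subst0_var_rename (t : Tm) : subst0 (.var 0) (rename (liftN Nat.succ) t) = t := by
  rw [subst0_eq, psubst_rename]
  convert psubst_var t using 2
  funext n
  cases n <;> rfl

/-- β-reduction of a copower against the generic element. -/
theorem EEq.copow_gen_beta {Γ : List VType} {a : Tm} {A : VType} {B C : CType}
    (ha : Ty (A :: Γ) (some B) a (.comp C)) :
    EEq (A :: Γ) (some B) (.copowlet (.copow (.var 0) .svar) (rename (liftN Nat.succ) a)) a
      (.comp C) := by
  have h' : Ty (A :: A :: Γ) (some B) (rename (liftN Nat.succ) a) (.comp C) := by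
    rw [rename_eq_psubst]
    refine ha.psubst fun n D hn => ?_
    cases n with
    | zero => exact ⟨.var _ 0 _ (by simpa using hn)⟩
    | succ n => exact ⟨.var _ (n + 2) _ (by simpa using hn)⟩
  have := EEq.copow_beta (.var (A :: Γ) 0 A rfl) (.svar _ B) h'.some
  rwa [ssubst_svar, subst0_var_rename] at this

/-- Commuting conversion for the case construct. -/
theorem EEq.case_comm {Γ : List VType} {a b p : Tm} {A B C S : CType}
    (ha : Ty Γ (some A) a (.comp C)) (hb : Ty Γ (some B) b (.comp C))
    (hp : Ty Γ (some C) p (.comp S)) :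
    EEq Γ (some (.csum A B)) (Tm.ssubst (.ccase .svar a b) p)
      (.ccase .svar (Tm.ssubst a p) (Tm.ssubst b p)) (.comp S) := by
  refine .case_ext (hp.ssubst ⟨.ccase _ _ _ _ _ _ _ _ (.svar _ _) ha.some hb.some⟩) ?_ ?_ <;>
    rw [ssubst_ssubst]
  · exact hp.refl.ssubst (.sinl_beta ha hb)
  · exact hp.refl.ssubst (.sinr_beta ha hb)

/-- Commuting conversion for the elimination of copowers. -/
theorem EEq.copowlet_comm {Γ : List VType} {a p : Tm} {A : VType} {B C S : CType}
    (ha : Ty (A :: Γ) (some B) a (.comp C)) (hp : Ty Γ (some C) p (.comp S)) :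
    EEq Γ (some (.copow A B)) (Tm.ssubst (.copowlet .svar a) p)
      (.copowlet .svar (Tm.ssubst a (Tm.shift p))) (.comp S) := by
  refine .copow_ext (hp.ssubst ⟨.copowlet _ _ _ _ _ _ _ (.svar _ _) ha.some⟩) ?_
  rw [shift_ssubst, ssubst_ssubst]
  exact (hp.shift A).refl.ssubst (.copow_gen_beta ha)

/-! ### Comparing two typings of a context -/

/-- `Side R M Γ Γ' σ` says that `M` mediates between the translations of `Γ` and `Γ'`, with `σ`
the coercion to the translation of `Γ`. -/
structure Side (R : CType) (M Γ Γ' : List VType) (σ : ℕ → Tm) : Prop where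
  entry : ∀ n A A', Γ[n]? = some A → Γ'[n]? = some A' →
    ∃ N, meetV R A A' = some N ∧ M[n]? = some N ∧
      ((A = A' ∧ σ n = .var n) ∨ σ n = coeV R A A' (.var n))
  free : ∀ n, (σ n).StoupFree
  length_eq : Γ.length = Γ'.length

namespace Side

variable {R : CType} {M Γ Γ' : List VType} {σ : ℕ → Tm}

theorem typed (h : Side R M Γ Γ' σ) :
    ∀ n C, (cpsCtx R Γ)[n]? = some C → Ty M none (σ n) C := by
  intro n C hC
  simp only [cpsCtx, List.getElem?_map, Option.map_eq_some_iff] at hC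
  obtain ⟨A, hA, rfl⟩ := hC
  have hn : n < Γ'.length := h.length_eq ▸ (List.getElem?_eq_some_iff.1 hA).1
  obtain ⟨N, hN, hM, ⟨rfl, hs⟩ | hs⟩ := h.entry n A _ hA (List.getElem?_eq_getElem hn)
  · rw [meetV_self, Option.some.injEq] at hN
    subst hN
    exact hs ▸ ⟨.var _ _ _ hM⟩
  · exact hs ▸ coeV_typed R _ _ hN ⟨.var _ _ _ hM⟩

theorem psubst (h : Side R M Γ Γ' σ) {Δ : Option CType} {t : Tm} {A : VType}
    (ht : Ty (cpsCtx R Γ) Δ t A) : Ty M Δ (Tm.psubst σ t) A :=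
  ht.psubst h.typed

theorem refl (R : CType) (Γ : List VType) : Side R (cpsCtx R Γ) Γ Γ Tm.var where
  entry n A A' hA hA' := by
    obtain rfl : A = A' := by simpa [hA] using hA'
    exact ⟨_, meetV_self R A, by simp [cpsCtx, hA], .inl ⟨rfl, rfl⟩⟩
  free _ := rfl
  length_eq := rfl

theorem succ_entry (h : Side R M Γ Γ' σ) {n : ℕ} {A A' N : VType} (hA : Γ[n]? = some A)
    (hA' : Γ'[n]? = some A') : ∃ N', meetV R A A' = some N' ∧ (N :: M)[n + 1]? = some N' ∧
      ((A = A' ∧ Tm.shift (σ n) = .var (n + 1)) ∨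
        Tm.shift (σ n) = coeV R A A' (.var (n + 1))) := by
  obtain ⟨N', hN, hM, hs⟩ := h.entry n A A' hA hA'
  refine ⟨N', hN, by simpa using hM, hs.imp (fun hs => ⟨hs.1, by rw [hs.2]; rfl⟩) fun hs => ?_⟩
  rw [hs, shift_coeV]
  rfl

theorem lift (h : Side R M Γ Γ' σ) (A : VType) :
    Side R (cpsV R A :: M) (A :: Γ) (A :: Γ') (liftS σ) where
  entry n B B' hB hB' := by
    cases n with
    | zero =>
      obtain rfl : A = B := by simpa using hB
      obtain rfl : A = B' := by simpa using hB'
      exact ⟨_, meetV_self R A, rfl, .inl ⟨rfl, rfl⟩⟩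
    | succ n => exact h.succ_entry (by simpa using hB) (by simpa using hB')
  free := StoupFree.liftS h.free
  length_eq := by simp [h.length_eq]

theorem coe (h : Side R M Γ Γ' σ) {A A' N : VType} (hN : meetV R A A' = some N) :
    Side R (N :: M) (A :: Γ) (A' :: Γ') (scons (coeV R A A' (.var 0)) (Tm.shift ∘ σ)) where
  entry n B B' hB hB' := by
    cases n with
    | zero =>
      obtain rfl : A = B := by simpa using hB
      obtain rfl : A' = B' := by simpa using hB'
      exact ⟨_, hN, rfl, .inr rfl⟩
    | succ n => exact h.succ_entry (by simpa using hB) (by simpa using hB')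
  free n := by
    cases n with
    | zero => exact ssubst_coeV R _ _ _ (.var 0) rfl
    | succ n => exact (h.free n).rename _
  length_eq := by simp [h.length_eq]

end Side

theorem subst0_rename_psubst (v t : Tm) (σ : ℕ → Tm) :
    subst0 v (rename (liftN Nat.succ) (Tm.psubst (liftS σ) t)) =
      Tm.psubst (scons v (Tm.shift ∘ σ)) t := by
  rw [subst0_eq, psubst_rename, psubst_psubst]
  congr 1
  funext n
  cases n with
  | zero => rfl
  | succ n =>
    simp only [Function.comp, liftS, scons, Tm.shift, psubst_rename]
    rw [rename_eq_psubst]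
    rfl

/-! ### Comparing two translations -/

/-- Mediating type of the results of two translations. -/
noncomputable def meetS (R : CType) : Option CType → Option CType → CType
  | some D, some D' => meetC R D D'
  | _, _ => R

/-- Coercion from the result of a translation to the mediating type. -/
noncomputable def coeS (R : CType) : Option CType → Option CType → Tm
  | some D, some D' => coeC R D D' .svar
  | _, _ => .svar

theorem meetS_symm (R : CType) (Δ Δ' : Option CType) : meetS R Δ Δ' = meetS R Δ' Δ := by
  cases Δ <;> cases Δ' <;> simp [meetS, meetC_symm R]

theorem coeS_typed (R : CType) {Δ Δ' : Option CType} (h : Δ.isSome = Δ'.isSome)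
    (Γ : List VType) : Ty Γ (some (tgt R Δ)) (coeS R Δ Δ') (.comp (meetS R Δ Δ')) := by
  cases Δ <;> cases Δ' <;> simp at h
  · exact ⟨.svar _ _⟩
  · exact coeC_svar_typed R _ _ Γ

theorem shift_coeS (R : CType) (Δ Δ' : Option CType) : Tm.shift (coeS R Δ Δ') = coeS R Δ Δ' := by
  cases Δ <;> cases Δ' <;> simp [coeS, shift_coeC] <;> rfl

/-- The value `s` of mediating type represents `v`. -/
def HalfV (R : CType) (M : List VType) (A A' : VType) (σ : ℕ → Tm) (v s : Tm) : Prop :=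
  EEq M none (coeV R A A' s) (psubst σ v) (cpsV R A)

/-- The map `k` between mediating types represents the translation `t`. -/
def HalfC (R : CType) (M : List VType) (Δ Θ : Option CType) (B C : CType) (σ : ℕ → Tm)
    (t k : Tm) : Prop :=
  EEq M (some (cpsC R B)) (ssubst (coeC R B C .svar) k)
    (ssubst (kont Δ (psubst σ t)) (coeS R Δ Θ)) (.comp (meetS R Δ Θ))

/-- Two translated values have a common representative. -/
def RelV (R : CType) (M : List VType) (A B : VType) (σ τ : ℕ → Tm) (v w : Tm) : Prop :=
  ∃ N s, meetV R A B = some N ∧ Ty M none s N ∧ HalfV R M A B σ v s ∧ HalfV R M B A τ w s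

/-- Two translated computations have a common representative. -/
def RelC (R : CType) (M : List VType) (Δ Δ' : Option CType) (B B' : CType) (σ σ' : ℕ → Tm)
    (t t' : Tm) : Prop :=
  ∃ k, Ty M (some (meetC R B B')) k (.comp (meetS R Δ Δ')) ∧ HalfC R M Δ Δ' B B' σ t k ∧
    HalfC R M Δ' Δ B' B σ' t' k

section Half

variable {R : CType} {M : List VType} {Δ Δ' : Option CType} {σ σ' : ℕ → Tm}

theorem HalfV.toC {B B' : CType} {v s : Tm} (hs : Ty M none s (.lin (meetC R B B') R))
    (h : HalfV R M (.comp B) (.comp B') σ v s) : HalfC R M none none B B' σ v (.lapp s .svar) := by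
  simp only [HalfV, HalfC, coeV, cpsV, coeS, ssubst, kont, meetS, hs.stoupFree.ssubst] at *
  have hb : Ty M (some (cpsC R B)) (.lapp s (coeC R B B' .svar)) (.comp R) :=
    ⟨.lapp _ _ _ _ _ _ hs.some (coeC_svar_typed R B B' M).some⟩
  exact (kont_unkont (Δ := none) hb).symm.trans (.lapp_cong h (.refl (.svar _ _)))

theorem HalfC.toV {B B' : CType} {v k : Tm}
    (hk : Ty M (some (meetC R B B')) k (.comp R)) (hv : Ty M none (psubst σ v) (cpsV R (.comp B)))
    (h : HalfC R M none none B B' σ v k) :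
    HalfV R M (.comp B) (.comp B') σ v (.llam (meetC R B B') k) := by
  simp only [HalfV, HalfC, coeV, cpsV, coeS, ssubst, kont, meetS] at *
  exact (EEq.llam_cong ((EEq.llam_beta hk.some (coeC_svar_typed R B B' M).some).trans h)).trans
    (.llam_eta hv.some)

theorem RelV.toC {B B' : CType} {v v' : Tm} (h : RelV R M (.comp B) (.comp B') σ σ' v v') :
    RelC R M none none B B' σ σ' v v' := by
  obtain ⟨N, s, hN, hs, h1, h2⟩ := h
  obtain rfl : VType.lin (meetC R B B') R = N := by simpa [meetV] using hN
  exact ⟨_, ⟨.lapp _ _ _ _ _ _ hs.some (.svar _ _)⟩, h1.toC hs,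
    h2.toC (by rwa [meetC_symm])⟩

theorem RelC.toV {B B' : CType} {v v' : Tm}
    (hv : Ty M none (psubst σ v) (cpsV R (.comp B)))
    (hv' : Ty M none (psubst σ' v') (cpsV R (.comp B')))
    (h : RelC R M none none B B' σ σ' v v') : RelV R M (.comp B) (.comp B') σ σ' v v' := by
  obtain ⟨k, hk, h1, h2⟩ := h
  simp only [meetS] at hk
  refine ⟨_, .llam (meetC R B B') k, by simp only [meetV], ⟨.llam _ _ _ _ hk.some⟩,
    h1.toV hk hv, ?_⟩
  rw [meetC_symm] at hk ⊢
  exact h2.toV hk hv'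

theorem HalfC.of_body {X X' : CType} {b k : Tm} (hΔ : Δ.isSome = Δ'.isSome)
    (hb : Ty M (some (cpsC R X)) (psubst σ b) (.comp (tgt R Δ)))
    (h : EEq M (some (cpsC R X)) (ssubst (coeC R X X' .svar) k)
      (ssubst (psubst σ b) (coeS R Δ Δ')) (.comp (meetS R Δ Δ'))) :
    HalfC R M Δ Δ' X X' σ (unkont Δ (cpsC R X) b) k := by
  unfold HalfC
  rw [psubst_unkont]
  exact h.trans ((coeS_typed R hΔ M).refl.ssubst (kont_unkont hb)).symm

theorem HalfC.plug {X X' Y Y' : CType} {t u k w : Tm} (hΔ : Δ.isSome = Δ'.isSome)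
    (hσ : ∀ n, (σ n).StoupFree)
    (ht : Ty M (some (cpsC R Y)) (psubst σ (kont Δ t)) (.comp (tgt R Δ)))
    (hu : Ty M (some (cpsC R X)) (psubst σ u) (.comp (cpsC R Y)))
    (hk : Ty M (some (meetC R Y Y')) k (.comp (meetS R Δ Δ')))
    (h : HalfC R M Δ Δ' Y Y' σ t k)
    (sq : EEq M (some (cpsC R X)) (ssubst (coeC R X X' .svar) w) (coeC R Y Y' (psubst σ u))
      (.comp (meetC R Y Y'))) :
    HalfC R M Δ Δ' X X' σ (unkont Δ (cpsC R X) (ssubst u (kont Δ t))) (ssubst w k) := by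
  refine .of_body hΔ ?_ ?_ <;> rw [psubst_ssubst hσ]
  · exact ht.ssubst hu
  · rw [ssubst_ssubst (coeC R X X' .svar) w k, ← ssubst_ssubst (psubst σ u), psubst_kont]
    refine (hk.refl.ssubst sq).trans ?_
    rw [← ssubst_coeC_svar, ← ssubst_ssubst]
    exact EEq.ssubst h hu.refl

end Half

/-! ### Squares -/

/-- The map `w` between mediating types represents `u`. -/
def Sq (R : CType) (M : List VType) (X X' Y Y' : CType) (σ : ℕ → Tm) (u w : Tm) : Prop :=
  EEq M (some (cpsC R X)) (ssubst (coeC R X X' .svar) w) (coeC R Y Y' (psubst σ u))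
    (.comp (meetC R Y Y'))

section Sq

variable {R : CType} {M Γ Γ' : List VType} {Δ Δ' : Option CType} {σ σ' : ℕ → Tm}

theorem HalfC.of_none {B B' : CType} {t k : Tm} (h : HalfC R M none none B B' σ t k) :
    EEq M (some (cpsC R B)) (ssubst (coeC R B B' .svar) k) (.lapp (psubst σ t) .svar)
      (.comp R) := by
  simpa only [HalfC, kont, coeS, meetS, ssubst] using h

theorem HalfC.sq {B B' D D' : CType} {t k : Tm}
    (h : HalfC R M (some D) (some D') B B' σ t k) : Sq R M B B' D D' σ t k := by
  simpa only [HalfC, Sq, kont, coeS, meetS, ssubst_coeC_svar] using h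

theorem RelC.plug {X X' Y Y' : CType} {t t' u u' w : Tm} (hΔ : Δ.isSome = Δ'.isSome)
    (S : Side R M Γ Γ' σ) (S' : Side R M Γ' Γ σ')
    (ht : CpsTy R (cpsCtx R Γ) Δ t (.comp Y)) (ht' : CpsTy R (cpsCtx R Γ') Δ' t' (.comp Y'))
    (h : RelC R M Δ Δ' Y Y' σ σ' t t')
    (hu : Ty (cpsCtx R Γ) (some (cpsC R X)) u (.comp (cpsC R Y)))
    (hu' : Ty (cpsCtx R Γ') (some (cpsC R X')) u' (.comp (cpsC R Y')))
    (hw : Ty M (some (meetC R X X')) w (.comp (meetC R Y Y')))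
    (sq : Sq R M X X' Y Y' σ u w) (sq' : Sq R M X' X Y' Y σ' u' w) :
    RelC R M Δ Δ' X X' σ σ' (unkont Δ (cpsC R X) (ssubst u (kont Δ t)))
      (unkont Δ' (cpsC R X') (ssubst u' (kont Δ' t'))) := by
  obtain ⟨k, hk, h1, h2⟩ := h
  refine ⟨ssubst w k, hk.ssubst hw, h1.plug hΔ S.free (S.psubst ht.kont) (S.psubst hu) hk sq,
    h2.plug hΔ.symm S'.free (S'.psubst ht'.kont) (S'.psubst hu') ?_ sq'⟩
  rwa [meetC_symm, meetS_symm]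

theorem RelC.plug_of_cunit {X X' Y Y' : CType} {t t' u u' : Tm} (hΔ : Δ.isSome = Δ'.isSome)
    (S : Side R M Γ Γ' σ) (S' : Side R M Γ' Γ σ')
    (ht : CpsTy R (cpsCtx R Γ) Δ t (.comp Y)) (ht' : CpsTy R (cpsCtx R Γ') Δ' t' (.comp Y'))
    (h : RelC R M Δ Δ' Y Y' σ σ' t t')
    (hu : Ty (cpsCtx R Γ) (some (cpsC R X)) u (.comp (cpsC R Y)))
    (hu' : Ty (cpsCtx R Γ') (some (cpsC R X')) u' (.comp (cpsC R Y')))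
    (hY : meetC R Y Y' = .cunit) :
    RelC R M Δ Δ' X X' σ σ' (unkont Δ (cpsC R X) (ssubst u (kont Δ t)))
      (unkont Δ' (cpsC R X') (ssubst u' (kont Δ' t'))) := by
  have hY' : meetC R Y' Y = .cunit := by rw [meetC_symm, hY]
  have c1 := coeC_typed R Y Y' (S.psubst hu)
  have c2 := coeC_typed R Y' Y (S'.psubst hu')
  refine .plug (w := .cunit) hΔ S S' ht ht' h hu hu' (hY ▸ ⟨.cunit _ _⟩) ?_ ?_ <;> unfold Sq
  · rw [hY] at c1 ⊢
    exact .of_cunit ⟨.cunit _ _⟩ c1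
  · rw [hY'] at c2 ⊢
    exact .of_cunit ⟨.cunit _ _⟩ c2

theorem Sq.cfst (A A' B B' : CType) :
    Sq R M A A' (.cand A B) (.cand A' B') σ (.cinl .svar) (.cinl .svar) := by
  simp only [Sq, Tm.ssubst, coeC, meetC, Tm.psubst]
  exact (EEq.sinl_beta (B := cpsC R B) ⟨.cinl _ _ _ _ _ (coeC_svar_typed R A A' M).some⟩
    ⟨.cinr _ _ _ _ _ (coeC_svar_typed R B B' M).some⟩).symm

theorem Sq.csnd (A A' B B' : CType) :
    Sq R M B B' (.cand A B) (.cand A' B') σ (.cinr .svar) (.cinr .svar) := by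
  simp only [Sq, Tm.ssubst, coeC, meetC, Tm.psubst]
  exact (EEq.sinr_beta (A := cpsC R A) ⟨.cinl _ _ _ _ _ (coeC_svar_typed R A A' M).some⟩
    ⟨.cinr _ _ _ _ _ (coeC_svar_typed R B B' M).some⟩).symm

theorem Sq.capp {A : VType} {v s : Tm} (B B' : CType)
    (h : EEq M none s (psubst σ v) (cpsV R A)) :
    Sq R M B B' (.carr A B) (.carr A B') σ (.copow v .svar) (.copow s .svar) := by
  simp only [Sq, Tm.ssubst, coeC, meetC, Tm.psubst, if_true, h.typed.1.stoupFree.ssubst]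
  have hc := coeC_svar_typed R B B' (cpsV R A :: M)
  have := EEq.copow_beta h.typed.2.some (.svar M (cpsC R B))
    (.copow _ _ _ _ _ _ (.var (cpsV R A :: M) 0 _ rfl) hc.some)
  rw [ssubst_svar, subst0_eq, Tm.psubst, psubst_coeC] at this
  exact (EEq.copow_cong h (coeC_svar_typed R B B' M).refl).trans this.symm

theorem Sq.ilet {A A' : CType} {t k : Tm} (h : HalfC R M none none A A' σ t k) :
    Sq R M A A' .iunit .iunit σ (.lapp t .svar) k := by
  simpa only [Sq, coeC, meetC, Tm.psubst] using h.of_none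

/-- β-reduction of the translation of an abstraction applied to a coerced variable. -/
theorem clam_coe_beta (S : Side R M Γ Γ' σ) {V V' N : VType} {X T : CType} {b : Tm}
    (hN : meetV R V V' = some N)
    (hb : Ty (cpsCtx R (V :: Γ)) (some X) b (.comp T)) :
    EEq (N :: M) (some X) (.capp (Tm.shift (psubst σ (.clam (cpsV R V) b))) (coeV R V V' (.var 0)))
      (psubst (scons (coeV R V V' (.var 0)) (Tm.shift ∘ σ)) b) (.comp T) := by
  have hc : Ty M (some X) (psubst σ (.clam (cpsV R V) b)) (.comp (.carr (cpsV R V) T)) :=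
    S.psubst ⟨.clam _ _ _ _ _ hb.some⟩
  have hv : Ty (N :: M) none (coeV R V V' (.var 0)) (cpsV R V) :=
    coeV_typed R V V' hN ⟨.var _ 0 _ rfl⟩
  have hd := (hc.shift N).some
  simp only [Tm.psubst, Tm.shift, Tm.rename] at hd ⊢
  cases hd with
  | clam _ _ _ _ _ hd =>
    have := EEq.clam_beta hd hv.some
    rwa [subst0_rename_psubst] at this

theorem Sq.banglet (S : Side R M Γ Γ' σ) {V V' N : VType} {B B' : CType} {t k : Tm}
    (hN : meetV R V V' = some N) (ht : Ty (cpsCtx R (V :: Γ)) none t (cpsV R (.comp B)))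
    (h : HalfC R (N :: M) none none B B' (scons (coeV R V V' (.var 0)) (Tm.shift ∘ σ)) t k) :
    Sq R M B B' (.bang V) (.bang V') σ (.clam (cpsV R V) (.lapp t .svar)) (.clam N k) := by
  have hb : Ty (cpsCtx R (V :: Γ)) (some (cpsC R B)) (.lapp t .svar) (.comp R) :=
    ⟨.lapp _ _ _ _ _ _ (by simpa only [cpsV] using ht.some) (.svar _ _)⟩
  simp only [Sq, Tm.ssubst, coeC, meetC, hN, shift_coeC]
  exact .clam_cong (h.of_none.trans (clam_coe_beta S hN hb).symm)

theorem Sq.copowlet (S : Side R M Γ Γ' σ) {V V' N : VType} {B B' C C' : CType} {t k : Tm}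
    (hN : meetV R V V' = some N)
    (ht : Ty (cpsCtx R (V :: Γ)) (some (cpsC R C)) t (.comp (cpsC R B)))
    (h : Sq R (N :: M) C C' B B' (scons (coeV R V V' (.var 0)) (Tm.shift ∘ σ)) t k) :
    Sq R M C C' (.copow V B) (.copow V' B') σ (.clam (cpsV R V) t) (.clam N k) := by
  simp only [Sq, Tm.ssubst, coeC, meetC, hN, shift_coeC]
  exact .clam_cong (EEq.trans h (coeC_cong (clam_coe_beta S hN ht).symm))

theorem Sq.copow {V V' N : VType} {v s : Tm} (B B' : CType) (hN : meetV R V V' = some N)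
    (hs : Ty M none s N) (h : HalfV R M V V' σ v s) :
    Sq R M (.copow V B) (.copow V' B') B B' σ (.capp .svar v) (.capp .svar s) := by
  simp only [Sq, Tm.ssubst, coeC, hN, Tm.psubst, hs.stoupFree.ssubst, cpsC]
  have hv : Ty (N :: M) none (coeV R V V' (.var 0)) (cpsV R V) :=
    coeV_typed R V V' hN ⟨.var _ 0 _ rfl⟩
  have hc : Ty (N :: M) (some (.carr (cpsV R V) (cpsC R B)))
      (coeC R B B' (.capp (Tm.shift .svar) (coeV R V V' (.var 0)))) (.comp (meetC R B B')) :=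
    coeC_typed R B B' ⟨.capp _ _ _ _ _ _ (.svar _ _) hv.some⟩
  have := EEq.clam_beta hc.some hs.some
  rw [subst0_eq, psubst_coeC] at this
  simp only [Tm.shift, Tm.rename, Tm.psubst, psubst_coeV, scons] at this
  exact this.trans (coeC_cong (.capp_cong (.refl (.svar _ _)) h))

theorem Sq.cinl (A A' B B' : CType) :
    Sq R M (.csum A B) (.csum A' B') A A' σ (.cfst .svar) (.cfst .svar) := by
  simp only [Sq, Tm.ssubst, coeC, Tm.psubst, cpsC]
  have h1 := coeC_typed R A A' (Γ := M) ⟨.cfst _ _ _ _ _ (.svar _ (.cand (cpsC R A) (cpsC R B)))⟩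
  have h2 := coeC_typed R B B' (Γ := M) ⟨.csnd _ _ _ _ _ (.svar _ (.cand (cpsC R A) (cpsC R B)))⟩
  exact .cfst_beta h1.some h2.some

theorem Sq.cinr (A A' B B' : CType) :
    Sq R M (.csum A B) (.csum A' B') B B' σ (.csnd .svar) (.csnd .svar) := by
  simp only [Sq, Tm.ssubst, coeC, Tm.psubst, cpsC]
  have h1 := coeC_typed R A A' (Γ := M) ⟨.cfst _ _ _ _ _ (.svar _ (.cand (cpsC R A) (cpsC R B)))⟩
  have h2 := coeC_typed R B B' (Γ := M) ⟨.csnd _ _ _ _ _ (.svar _ (.cand (cpsC R A) (cpsC R B)))⟩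
  exact .csnd_beta h1.some h2.some

theorem Sq.ccase {A A' B B' C C' : CType} {t u k l : Tm}
    (ht : Ty M (some (cpsC R C)) (psubst σ t) (.comp (cpsC R A)))
    (hu : Ty M (some (cpsC R C)) (psubst σ u) (.comp (cpsC R B)))
    (h1 : Sq R M C C' A A' σ t k) (h2 : Sq R M C C' B B' σ u l) :
    Sq R M C C' (.csum A B) (.csum A' B') σ (.cpair t u) (.cpair k l) := by
  simp only [Sq, Tm.ssubst, coeC, meetC, Tm.psubst] at *
  exact .cpair_cong (h1.trans (coeC_cong (.cfst_beta ht.some hu.some)).symm)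
    (h2.trans (coeC_cong (.csnd_beta ht.some hu.some)).symm)

theorem Sq.lapp {A B B' : CType} {v s : Tm} (hs : Ty M none s (.lin (meetC R B B') (cpsC R A)))
    (h : HalfV R M (.lin A B) (.lin A B') σ v s) :
    Sq R M B B' A A σ (.lapp v .svar) (.lapp s .svar) := by
  simp only [Sq, HalfV, Tm.ssubst, coeV, meetC_self, Tm.psubst, hs.stoupFree.ssubst, cpsV] at *
  have hb : Ty M (some (cpsC R B)) (.lapp s (coeC R B B' .svar)) (.comp (cpsC R A)) :=
    ⟨.lapp _ _ _ _ _ _ hs.some (coeC_svar_typed R B B' M).some⟩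
  have h1 := EEq.llam_beta hb.some (.svar M (cpsC R B))
  rw [ssubst_svar] at h1
  have h2 : EEq M (some (cpsC R B)) (.lapp (psubst σ v) .svar) _ _ :=
    EEq.lapp_cong h.symm (.refl (.svar M (cpsC R B)))
  exact (h2.trans h1).symm.trans (coeC_self R A h2.typed.1).symm

theorem RelV.self {A : VType} {v v' : Tm} (h : RelV R M A A σ σ' v v') :
    ∃ s, EEq M none s (psubst σ v) (cpsV R A) ∧ EEq M none s (psubst σ' v') (cpsV R A) := by
  obtain ⟨N, s, hN, hs, h1, h2⟩ := h
  obtain rfl : cpsV R A = N := by simpa [meetV_self] using hN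
  have hc := (coeV_self R A hs).symm
  exact ⟨s, hc.trans h1, hc.trans h2⟩

end Sq

/-! ### The translation as plugging -/

section Equations

variable {R : CType} {Γ : List VType}

theorem unkont_plug {Δ : Option CType} {t : Tm} {A : VType} (d : Deriv Γ Δ t A) (X : CType)
    (u : Tm) : unkont Δ X (ssubst u (kont Δ (cps R d))) =
      match Δ with
      | none => .llam X (.lapp (cps R d) u)
      | some _ => ssubst u (cps R d) := by
  cases Δ with
  | none =>
    have h : Ty (cpsCtx R Γ) none (cps R d) (cpsV R A) := cps_typed R d
    simp only [unkont, kont, ssubst, h.stoupFree.ssubst]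
  | some D => rfl

variable (Δ : Option CType) {s t u : Tm} {A B C : CType} {V : VType}

theorem cps_cfst (d : Deriv Γ Δ t (.comp (.cand A B))) : cps R (.cfst Γ Δ t A B d) =
    unkont Δ (cpsC R A) (ssubst (.cinl .svar) (kont Δ (cps R d))) := by
  rw [unkont_plug]
  cases Δ <;> rfl

theorem cps_csnd (d : Deriv Γ Δ t (.comp (.cand A B))) : cps R (.csnd Γ Δ t A B d) =
    unkont Δ (cpsC R B) (ssubst (.cinr .svar) (kont Δ (cps R d))) := by
  rw [unkont_plug]
  cases Δ <;> rfl

theorem cps_capp (d : Deriv Γ Δ s (.comp (.carr V B))) (e : Deriv Γ none t V) :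
    cps R (.capp Γ Δ s t V B d e) =
      unkont Δ (cpsC R B) (ssubst (.copow (cps R e) .svar) (kont Δ (cps R d))) := by
  rw [unkont_plug]
  cases Δ <;> rfl

theorem cps_ilet (d : Deriv Γ Δ t (.comp .iunit)) (e : Deriv Γ none u (.comp A)) :
    cps R (.ilet Γ Δ t u A d e) =
      unkont Δ (cpsC R A) (ssubst (.lapp (cps R e) .svar) (kont Δ (cps R d))) := by
  rw [unkont_plug]
  cases Δ <;> rfl

theorem cps_banglet (d : Deriv Γ Δ t (.comp (.bang V))) (e : Deriv (V :: Γ) none u (.comp B)) :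
    cps R (.banglet Γ Δ t u V B d e) = unkont Δ (cpsC R B)
      (ssubst (.clam (cpsV R V) (.lapp (cps R e) .svar)) (kont Δ (cps R d))) := by
  rw [unkont_plug]
  cases Δ <;> rfl

theorem cps_copow (d : Deriv Γ none t V) (e : Deriv Γ Δ u (.comp B)) :
    cps R (.copow Γ Δ t u V B d e) = unkont Δ (cpsC R (.copow V B))
      (ssubst (.capp .svar (cps R d)) (kont Δ (cps R e))) := by
  rw [unkont_plug]
  cases Δ <;> rfl

theorem cps_copowlet (d : Deriv Γ Δ s (.comp (.copow V B)))
    (e : Deriv (V :: Γ) (some B) t (.comp C)) :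
    cps R (.copowlet Γ Δ s t V B C d e) = unkont Δ (cpsC R C)
      (ssubst (.clam (cpsV R V) (cps R e)) (kont Δ (cps R d))) := by
  rw [unkont_plug]
  cases Δ <;> rfl

theorem cps_cimage (d : Deriv Γ Δ t (.comp .czero)) :
    cps R (.cimage Γ Δ t A d) = unkont Δ (cpsC R A) (ssubst .cunit (kont Δ (cps R d))) := by
  rw [unkont_plug]
  cases Δ <;> rfl

theorem cps_cinl (d : Deriv Γ Δ t (.comp A)) : cps R (.cinl Γ Δ t A B d) =
    unkont Δ (cpsC R (.csum A B)) (ssubst (.cfst .svar) (kont Δ (cps R d))) := by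
  rw [unkont_plug]
  cases Δ <;> rfl

theorem cps_cinr (d : Deriv Γ Δ t (.comp B)) : cps R (.cinr Γ Δ t A B d) =
    unkont Δ (cpsC R (.csum A B)) (ssubst (.csnd .svar) (kont Δ (cps R d))) := by
  rw [unkont_plug]
  cases Δ <;> rfl

theorem cps_ccase (d : Deriv Γ Δ s (.comp (.csum A B))) (e : Deriv Γ (some A) t (.comp C))
    (f : Deriv Γ (some B) u (.comp C)) : cps R (.ccase Γ Δ s t u A B C d e f) =
      unkont Δ (cpsC R C) (ssubst (.cpair (cps R e) (cps R f)) (kont Δ (cps R d))) := by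
  rw [unkont_plug]
  cases Δ <;> rfl

theorem cps_lapp (d : Deriv Γ none s (.lin A B)) (e : Deriv Γ Δ t (.comp A)) :
    cps R (.lapp Γ Δ s t A B d e) =
      unkont Δ (cpsC R B) (ssubst (.lapp (cps R d) .svar) (kont Δ (cps R e))) := by
  rw [unkont_plug]
  cases Δ <;> rfl

theorem cps_cunit : cps R (.cunit Γ Δ) =
    unkont Δ (cpsC R .cunit) (.cimage (tgt R Δ) .svar) := by
  cases Δ <;> rfl

theorem cps_cpair (d : Deriv Γ Δ t (.comp A)) (e : Deriv Γ Δ u (.comp B)) :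
    cps R (.cpair Γ Δ t u A B d e) = unkont Δ (cpsC R (.cand A B))
      (.ccase .svar (kont Δ (cps R d)) (kont Δ (cps R e))) := by
  cases Δ <;> rfl

theorem cps_clam (d : Deriv (V :: Γ) Δ t (.comp B)) : cps R (.clam Γ Δ t V B d) =
    unkont Δ (cpsC R (.carr V B)) (.copowlet .svar (kont Δ (cps R d))) := by
  cases Δ <;> rfl

end Equations

/-! ### Introduction rules -/

section Intro

variable {R : CType} {M Γ Γ' : List VType} {Δ Δ' : Option CType} {σ σ' : ℕ → Tm}

theorem HalfC.svar (D D' : CType) : HalfC R M (some D) (some D') D D' σ .svar .svar := by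
  simpa only [HalfC, kont, coeS, meetS, Tm.psubst, ssubst, ssubst_svar] using
    (coeC_svar_typed R D D' M).refl

theorem HalfC.cunit (hΔ : Δ.isSome = Δ'.isSome) :
    HalfC R M Δ Δ' .cunit .cunit σ (unkont Δ (cpsC R .cunit) (.cimage (tgt R Δ) .svar))
      (.cimage (meetS R Δ Δ') .svar) := by
  have hb : Ty M (some .czero) (.cimage (tgt R Δ) .svar) (.comp (tgt R Δ)) :=
    ⟨.cimage _ _ _ _ (.svar _ _)⟩
  refine .of_body hΔ (by simpa only [cpsC, Tm.psubst] using hb) ?_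
  simp only [coeC, cpsC, Tm.psubst, ssubst_svar]
  have := EEq.czero_eta (.svar M _) ((coeS_typed R hΔ M).ssubst hb).some
  rwa [ssubst_svar] at this

theorem HalfC.cpair {A A' B B' : CType} {t u k l : Tm} (hΔ : Δ.isSome = Δ'.isSome)
    (ht : Ty M (some (cpsC R A)) (psubst σ (kont Δ t)) (.comp (tgt R Δ)))
    (hu : Ty M (some (cpsC R B)) (psubst σ (kont Δ u)) (.comp (tgt R Δ)))
    (hk : Ty M (some (meetC R A A')) k (.comp (meetS R Δ Δ')))
    (hl : Ty M (some (meetC R B B')) l (.comp (meetS R Δ Δ')))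
    (h1 : HalfC R M Δ Δ' A A' σ t k) (h2 : HalfC R M Δ Δ' B B' σ u l) :
    HalfC R M Δ Δ' (.cand A B) (.cand A' B') σ
      (unkont Δ (cpsC R (.cand A B)) (.ccase .svar (kont Δ t) (kont Δ u))) (.ccase .svar k l) := by
  have hA := coeC_svar_typed R A A' M
  have hB := coeC_svar_typed R B B' M
  have hkl : Ty M (some (.csum (meetC R A A') (meetC R B B'))) (.ccase .svar k l)
      (.comp (meetS R Δ Δ')) := ⟨.ccase _ _ _ _ _ _ _ _ (.svar _ _) hk.some hl.some⟩
  refine .of_body hΔ ?_ ?_ <;> simp only [cpsC, Tm.psubst, coeC]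
  · exact ⟨.ccase _ _ _ _ _ _ _ _ (.svar _ _) ht.some hu.some⟩
  · refine (EEq.case_comm ⟨.cinl _ _ _ _ _ hA.some⟩ ⟨.cinr _ _ _ _ _ hB.some⟩ hkl).trans
      (.trans ?_ (EEq.case_comm ht hu (coeS_typed R hΔ M)).symm)
    rw [psubst_kont, psubst_kont]
    exact .ccase_cong (.refl (.svar _ _))
      ((EEq.csum_beta_inl hk.some hl.some hA.some).trans h1)
      ((EEq.csum_beta_inr hk.some hl.some hB.some).trans h2)

theorem HalfC.clam {V : VType} {B B' : CType} {t k : Tm} (hΔ : Δ.isSome = Δ'.isSome)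
    (ht : Ty (cpsV R V :: M) (some (cpsC R B)) (psubst (liftS σ) (kont Δ t)) (.comp (tgt R Δ)))
    (hk : Ty (cpsV R V :: M) (some (meetC R B B')) k (.comp (meetS R Δ Δ')))
    (h : HalfC R (cpsV R V :: M) Δ Δ' B B' (liftS σ) t k) :
    HalfC R M Δ Δ' (.carr V B) (.carr V B') σ
      (unkont Δ (cpsC R (.carr V B)) (.copowlet .svar (kont Δ t))) (.copowlet .svar k) := by
  have hB := coeC_svar_typed R B B' (cpsV R V :: M)
  have hc : Ty M (some (.copow (cpsV R V) (meetC R B B'))) (.copowlet .svar k)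
      (.comp (meetS R Δ Δ')) := ⟨.copowlet _ _ _ _ _ _ _ (.svar _ _) hk.some⟩
  refine .of_body hΔ ?_ ?_ <;> simp only [cpsC, Tm.psubst, coeC, if_true]
  · exact ⟨.copowlet _ _ _ _ _ _ _ (.svar _ _) ht.some⟩
  · refine (EEq.copowlet_comm ⟨.copow _ _ _ _ _ _ (.var _ 0 _ rfl) hB.some⟩ hc).trans
      (.trans ?_ (EEq.copowlet_comm ht (coeS_typed R hΔ M)).symm)
    rw [psubst_kont, shift_coeS]
    refine .copowlet_cong (.refl (.svar _ _)) (EEq.trans ?_ h)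
    have hd := (hc.shift (cpsV R V)).some
    simp only [Tm.shift, Tm.rename, ssubst] at hd ⊢
    cases hd with
    | copowlet _ _ _ _ _ _ _ hs hd =>
      cases hs
      have := EEq.copow_beta (.var (cpsV R V :: M) 0 _ rfl) hB.some hd
      rwa [subst0_var_rename] at this

theorem HalfC.top : HalfC R M none none .iunit .iunit σ (.llam R .svar) .svar := by
  have := HalfC.of_body (R := R) (M := M) (Δ := none) (Δ' := none) (X := .iunit) (X' := .iunit)
    (σ := σ) (b := .svar) (k := .svar) rfl (by simpa only [cpsC] using ⟨.svar _ _⟩)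
    (by simpa only [coeC, cpsC, coeS, Tm.psubst, ssubst] using .refl (.svar _ _))
  simpa only [unkont, cpsC] using this

theorem HalfC.bang {V V' N : VType} {v s : Tm} (hN : meetV R V V' = some N)
    (hs : Ty M none s N) (h : HalfV R M V V' σ v s) :
    HalfC R M none none (.bang V) (.bang V') σ (.llam (.carr (cpsV R V) R) (.capp .svar v))
      (.capp .svar s) := by
  have hv : Ty (N :: M) none (coeV R V V' (.var 0)) (cpsV R V) :=
    coeV_typed R V V' hN ⟨.var _ 0 _ rfl⟩
  have hc : Ty (N :: M) (some (.carr (cpsV R V) R))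
      (.capp (Tm.shift .svar) (coeV R V V' (.var 0))) (.comp R) :=
    ⟨.capp _ _ _ _ _ _ (.svar _ _) hv.some⟩
  have hb : Ty M (some (.carr (cpsV R V) R)) (.capp .svar (psubst σ v)) (.comp R) :=
    ⟨.capp _ _ _ _ _ _ (.svar _ _) h.typed.2.some⟩
  have key := EEq.clam_beta hc.some hs.some
  rw [subst0_eq] at key
  simp only [Tm.shift, Tm.rename, Tm.psubst, psubst_coeV, scons] at key
  have := HalfC.of_body (R := R) (M := M) (Δ := none) (Δ' := none) (X := .bang V) (X' := .bang V')
    (σ := σ) (b := .capp .svar v) (k := .capp .svar s) rfl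
    (by simpa only [cpsC, Tm.psubst, tgt] using hb) (by
      simp only [coeC, cpsC, coeS, Tm.psubst, ssubst, hN, hs.stoupFree.ssubst]
      exact key.trans (.capp_cong (.refl (.svar _ _)) h))
  simpa only [unkont, cpsC] using this

theorem HalfV.llam {A B B' : CType} {t k : Tm}
    (ht : Ty M (some (cpsC R B)) (psubst σ t) (.comp (cpsC R A)))
    (hk : Ty M (some (meetC R B B')) k (.comp (cpsC R A)))
    (h : HalfC R M (some A) (some A) B B' σ t k) :
    HalfV R M (.lin A B) (.lin A B') σ (.llam (cpsC R B) t) (.llam (meetC R B B') k) := by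
  have h := h.sq
  simp only [Sq, HalfV, coeV, cpsV, Tm.psubst, meetC_self] at *
  exact .llam_cong ((EEq.llam_beta hk.some (coeC_svar_typed R B B' M).some).trans
    (h.trans (coeC_self R A ht)))

theorem HalfV.vlam {A B B' N : VType} {t s : Tm} (hN : meetV R B B' = some N)
    (hs : Ty (cpsV R A :: M) none s N)
    (h : HalfV R (cpsV R A :: M) B B' (liftS σ) t s) :
    HalfV R M (.arr A B) (.arr A B') σ (.vlam (cpsV R A) t) (.vlam (cpsV R A) s) := by
  simp only [HalfV, coeV, cpsV, Tm.psubst] at *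
  refine .vlam_cong (EEq.trans (coeV_cong hN ?_) h)
  have hl : Ty M none (.vlam (cpsV R A) s) (.arr (cpsV R A) N) := ⟨.vlam _ _ _ _ hs.some⟩
  have hd := (hl.shift (cpsV R A)).some
  simp only [Tm.shift, Tm.rename] at hd ⊢
  cases hd with
  | vlam _ _ _ _ hd =>
    have := EEq.vlam_beta hd (.var (cpsV R A :: M) 0 _ rfl)
    rwa [subst0_var_rename] at this

theorem HalfV.vapp {A B B' N : VType} {v s u r : Tm} (hN : meetV R B B' = some N)
    (hs : Ty M none s (.arr (cpsV R A) N)) (hr : EEq M none r (psubst σ u) (cpsV R A))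
    (h : HalfV R M (.arr A B) (.arr A B') σ v s) :
    HalfV R M B B' σ (.vapp v u) (.vapp s r) := by
  simp only [HalfV, coeV, cpsV, Tm.psubst] at *
  have hb : Ty (cpsV R A :: M) none (coeV R B B' (.vapp (Tm.shift s) (.var 0))) (cpsV R B) :=
    coeV_typed R B B' hN ⟨.vapp _ _ _ _ _ (hs.shift _).some (.var _ 0 _ rfl)⟩
  have := EEq.vlam_beta hb.some hr.typed.1.some
  rw [subst0_eq, psubst_coeV] at this
  simp only [Tm.psubst, scons] at this
  rw [← subst0_eq, subst0_shift] at this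
  exact this.symm.trans (.vapp_cong h hr)

theorem HalfV.vpair {A A' B B' N P : VType} {v w s r : Tm} (hN : meetV R A A' = some N)
    (hP : meetV R B B' = some P) (hs : Ty M none s N) (hr : Ty M none r P)
    (h1 : HalfV R M A A' σ v s) (h2 : HalfV R M B B' σ w r) :
    HalfV R M (.prod A B) (.prod A' B') σ (.vpair v w) (.vpair s r) := by
  simp only [HalfV, coeV, cpsV, Tm.psubst] at *
  exact .vpair_cong ((coeV_cong hN (.vfst_beta hs.some hr.some)).trans h1)
    ((coeV_cong hP (.vsnd_beta hs.some hr.some)).trans h2)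

theorem HalfV.vfst {A A' B B' N P : VType} {v s : Tm} (hN : meetV R A A' = some N)
    (hP : meetV R B B' = some P) (hs : Ty M none s (.prod N P))
    (h : HalfV R M (.prod A B) (.prod A' B') σ v s) :
    HalfV R M A A' σ (.vfst v) (.vfst s) := by
  simp only [HalfV, coeV, cpsV, Tm.psubst] at *
  have h1 := coeV_typed R A A' hN ⟨.vfst _ _ _ _ hs.some⟩
  have h2 := coeV_typed R B B' hP ⟨.vsnd _ _ _ _ hs.some⟩
  exact (EEq.vfst_beta h1.some h2.some).symm.trans (.vfst_cong h)

theorem HalfV.vsnd {A A' B B' N P : VType} {v s : Tm} (hN : meetV R A A' = some N)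
    (hP : meetV R B B' = some P) (hs : Ty M none s (.prod N P))
    (h : HalfV R M (.prod A B) (.prod A' B') σ v s) :
    HalfV R M B B' σ (.vsnd v) (.vsnd s) := by
  simp only [HalfV, coeV, cpsV, Tm.psubst] at *
  have h1 := coeV_typed R A A' hN ⟨.vfst _ _ _ _ hs.some⟩
  have h2 := coeV_typed R B B' hP ⟨.vsnd _ _ _ _ hs.some⟩
  exact (EEq.vsnd_beta h1.some h2.some).symm.trans (.vsnd_cong h)

end Intro

/-! ### Coherence -/

/-- Two translations of a common term have a common representative. -/
def Rel (R : CType) (M : List VType) (Δ Δ' : Option CType) (A A' : VType) (σ σ' : ℕ → Tm)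
    (v v' : Tm) : Prop :=
  (Δ = none → Δ' = none → RelV R M A A' σ σ' v v') ∧
    ∀ B B', A = .comp B → A' = .comp B' → RelC R M Δ Δ' B B' σ σ' v v'

section Rel

variable {R : CType} {M Γ Γ' : List VType} {Δ Δ' : Option CType} {σ σ' : ℕ → Tm}

theorem RelV.rel {A A' : VType} {v v' : Tm} (h : RelV R M A A' σ σ' v v') :
    Rel R M none none A A' σ σ' v v' :=
  ⟨fun _ _ => h, fun _ _ hA hA' => by subst hA hA'; exact h.toC⟩

theorem Rel.value {A A' : VType} {v v' : Tm} (h : Rel R M none none A A' σ σ' v v') :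
    RelV R M A A' σ σ' v v' :=
  h.1 rfl rfl

theorem Rel.comp {B B' : CType} {v v' : Tm} (h : Rel R M Δ Δ' (.comp B) (.comp B') σ σ' v v') :
    RelC R M Δ Δ' B B' σ σ' v v' :=
  h.2 _ _ rfl rfl

theorem RelC.rel {t : Tm} {B B' : CType} (S : Side R M Γ Γ' σ) (S' : Side R M Γ' Γ σ')
    (d : Deriv Γ Δ t (.comp B)) (d' : Deriv Γ' Δ' t (.comp B'))
    (h : RelC R M Δ Δ' B B' σ σ' (cps R d) (cps R d')) :
    Rel R M Δ Δ' (.comp B) (.comp B') σ σ' (cps R d) (cps R d') := by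
  refine ⟨?_, fun _ _ hB hB' => ?_⟩
  · rintro rfl rfl
    exact h.toV (S.psubst (cps_typed R d)) (S'.psubst (cps_typed R d'))
  · cases hB
    cases hB'
    exact h

theorem HalfV.var (S : Side R M Γ Γ' σ) {n : ℕ} {A A' : VType} (hA : Γ[n]? = some A)
    (hA' : Γ'[n]? = some A') : ∃ N, meetV R A A' = some N ∧ M[n]? = some N ∧
      HalfV R M A A' σ (.var n) (.var n) := by
  obtain ⟨N, hN, hM, hs⟩ := S.entry n A A' hA hA'
  refine ⟨N, hN, hM, ?_⟩
  simp only [HalfV, Tm.psubst]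
  obtain ⟨rfl, hs⟩ | hs := hs
  · rw [hs]
    obtain rfl : cpsV R A = N := by simpa [meetV_self] using hN
    exact coeV_self R A ⟨.var _ _ _ hM⟩
  · rw [hs]
    exact (coeV_typed R A A' hN ⟨.var _ _ _ hM⟩).refl

end Rel

/-- Translations of two derivations of the same term have a common representative. -/
theorem cps_rel (R : CType) {Γ Γ' : List VType} {Δ Δ' : Option CType} {t : Tm} {A A' : VType}
    (d : Deriv Γ Δ t A) (d' : Deriv Γ' Δ' t A') (hΔ : Δ.isSome = Δ'.isSome) {M : List VType}
    {σ σ' : ℕ → Tm} (S : Side R M Γ Γ' σ) (S' : Side R M Γ' Γ σ') :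
    Rel R M Δ Δ' A A' σ σ' (cps R d) (cps R d') := by
  induction d generalizing Γ' Δ' A' M σ σ' with
  | var _ n A h =>
    cases d' with
    | var _ _ A' h' =>
      obtain ⟨N, hN, hM, h1⟩ := HalfV.var S h h'
      obtain ⟨_, _, _, h2⟩ := HalfV.var S' h' h
      exact RelV.rel ⟨N, .var n, hN, ⟨.var _ _ _ hM⟩, h1, h2⟩
  | svar _ D =>
    cases d' with
    | svar _ D' => exact RelC.rel S S' _ _ ⟨.svar, ⟨.svar _ _⟩, .svar D D', .svar D' D⟩
  | unit _ =>
    cases d' with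
    | unit _ =>
      exact RelV.rel ⟨.unit, .unit, by simp only [meetV], ⟨.unit _⟩,
        .refl (.unit _), .refl (.unit _)⟩
  | vpair _ _ _ A B d e ihd ihe =>
    cases d' with
    | vpair _ _ _ A' B' d' e' =>
      obtain ⟨N, s, hN, hs, h1, h1'⟩ := (ihd d' rfl S S').value
      obtain ⟨P, r, hP, hr, h2, h2'⟩ := (ihe e' rfl S S').value
      exact RelV.rel ⟨.prod N P, .vpair s r, by simp only [meetV, hN, hP],
        ⟨.vpair _ _ _ _ _ hs.some hr.some⟩, .vpair hN hP hs hr h1 h2,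
        .vpair (meetV_symm R A A' ▸ hN) (meetV_symm R B B' ▸ hP) hs hr h1' h2'⟩
  | vfst _ _ A B d ih =>
    cases d' with
    | vfst _ _ A' B' d' =>
      obtain ⟨Q, s, hQ, hs, h, h'⟩ := (ih d' rfl S S').value
      simp only [meetV] at hQ
      split at hQ
      · next N P hN hP =>
        cases hQ
        exact RelV.rel ⟨N, .vfst s, hN, ⟨.vfst _ _ _ _ hs.some⟩, h.vfst hN hP hs,
          h'.vfst (meetV_symm R A A' ▸ hN) (meetV_symm R B B' ▸ hP) hs⟩
      · cases hQ
  | vsnd _ _ A B d ih =>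
    cases d' with
    | vsnd _ _ A' B' d' =>
      obtain ⟨Q, s, hQ, hs, h, h'⟩ := (ih d' rfl S S').value
      simp only [meetV] at hQ
      split at hQ
      · next N P hN hP =>
        cases hQ
        exact RelV.rel ⟨P, .vsnd s, hP, ⟨.vsnd _ _ _ _ hs.some⟩, h.vsnd hN hP hs,
          h'.vsnd ((meetV_symm R _ _).trans hN) ((meetV_symm R _ _).trans hP) hs⟩
      · cases hQ
  | vlam _ _ A B d ih =>
    cases d' with
    | vlam _ _ _ B' d' =>
      obtain ⟨N, s, hN, hs, h, h'⟩ := (ih d' rfl (S.lift A) (S'.lift A)).value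
      exact RelV.rel ⟨.arr (cpsV R A) N, .vlam (cpsV R A) s,
        by simp only [meetV, hN, if_true, Option.map], ⟨.vlam _ _ _ _ hs.some⟩,
        h.vlam hN hs, h'.vlam ((meetV_symm R _ _).trans hN) hs⟩
  | vapp _ _ _ A B d e ihd ihe =>
    cases d' with
    | vapp _ _ _ A' B' d' e' =>
      obtain ⟨Q, s, hQ, hs, h, h'⟩ := (ihd d' rfl S S').value
      simp only [meetV] at hQ
      split_ifs at hQ with hA
      subst hA
      simp only [Option.map_eq_some_iff] at hQ
      obtain ⟨N, hN, rfl⟩ := hQ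
      obtain ⟨r, hr, hr'⟩ := (ihe e' rfl S S').value.self
      exact RelV.rel ⟨N, .vapp s r, hN, ⟨.vapp _ _ _ _ _ hs.some hr.typed.1.some⟩,
        h.vapp hN hs hr, h'.vapp ((meetV_symm R _ _).trans hN) hs hr'⟩
  | cunit _ Δ =>
    cases d' with
    | cunit _ Δ' =>
      refine RelC.rel S S' _ _ ?_
      rw [cps_cunit, cps_cunit]
      refine ⟨_, by simpa only [meetC] using ⟨.cimage _ _ _ _ (.svar _ _)⟩, .cunit hΔ, ?_⟩
      rw [meetS_symm]
      exact .cunit hΔ.symm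
  | cpair _ Δ _ _ A B d e ihd ihe =>
    cases d' with
    | cpair _ Δ' _ _ A' B' d' e' =>
      refine RelC.rel S S' _ _ ?_
      rw [cps_cpair, cps_cpair]
      obtain ⟨k, hk, h1, h1'⟩ := (ihd d' hΔ S S').comp
      obtain ⟨l, hl, h2, h2'⟩ := (ihe e' hΔ S S').comp
      refine ⟨.ccase .svar k l, by
        simpa only [meetC] using ⟨.ccase _ _ _ _ _ _ _ _ (.svar _ _) hk.some hl.some⟩,
        .cpair hΔ (S.psubst (cps_typed R d).kont) (S.psubst (cps_typed R e).kont) hk hl h1 h2, ?_⟩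
      rw [meetC_symm, meetS_symm] at hk hl
      exact .cpair hΔ.symm (S'.psubst (cps_typed R d').kont) (S'.psubst (cps_typed R e').kont)
        hk hl h1' h2'
  | cfst _ Δ _ A B d ih =>
    cases d' with
    | cfst _ Δ' _ A' B' d' =>
      refine RelC.rel S S' _ _ ?_
      rw [cps_cfst, cps_cfst]
      exact .plug hΔ S S' (cps_typed R d) (cps_typed R d') (ih d' hΔ S S').comp
        (by simpa only [cpsC] using ⟨.cinl _ _ _ _ _ (.svar _ _)⟩)
        (by simpa only [cpsC] using ⟨.cinl _ _ _ _ _ (.svar _ _)⟩)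
        (by simpa only [meetC] using ⟨.cinl _ _ _ _ _ (.svar _ _)⟩)
        (.cfst A A' B B') (.cfst A' A B' B)
  | csnd _ Δ _ A B d ih =>
    cases d' with
    | csnd _ Δ' _ A' B' d' =>
      refine RelC.rel S S' _ _ ?_
      rw [cps_csnd, cps_csnd]
      exact .plug hΔ S S' (cps_typed R d) (cps_typed R d') (ih d' hΔ S S').comp
        (by simpa only [cpsC] using ⟨.cinr _ _ _ _ _ (.svar _ _)⟩)
        (by simpa only [cpsC] using ⟨.cinr _ _ _ _ _ (.svar _ _)⟩)
        (by simpa only [meetC] using ⟨.cinr _ _ _ _ _ (.svar _ _)⟩)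
        (.csnd A A' B B') (.csnd A' A B' B)
  | clam _ Δ _ V B d ih =>
    cases d' with
    | clam _ Δ' _ _ B' d' =>
      refine RelC.rel S S' _ _ ?_
      rw [cps_clam, cps_clam]
      obtain ⟨k, hk, h, h'⟩ := (ih d' hΔ (S.lift V) (S'.lift V)).comp
      refine ⟨.copowlet .svar k, by
        simpa only [meetC, if_true] using ⟨.copowlet _ _ _ _ _ _ _ (.svar _ _) hk.some⟩,
        .clam hΔ ((S.lift V).psubst (cps_typed R d).kont) hk h, ?_⟩
      rw [meetC_symm, meetS_symm] at hk
      exact .clam hΔ.symm ((S'.lift V).psubst (cps_typed R d').kont) hk h'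
  | capp Γ Δ _ _ A B d e ihd ihe =>
    cases d' with
    | capp _ Δ' _ _ A' B' d' e' =>
      refine RelC.rel S S' _ _ ?_
      rw [cps_capp, cps_capp]
      have hu : Ty (cpsCtx R Γ) (some (cpsC R B)) (.copow (cps R e) .svar)
          (.comp (cpsC R (.carr A B))) := by
        simpa only [cpsC] using ⟨.copow _ _ _ _ _ _ (cps_typed R e).some (.svar _ _)⟩
      have hu' : Ty (cpsCtx R Γ') (some (cpsC R B')) (.copow (cps R e') .svar)
          (.comp (cpsC R (.carr A' B'))) := by
        simpa only [cpsC] using ⟨.copow _ _ _ _ _ _ (cps_typed R e').some (.svar _ _)⟩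
      by_cases hA : A = A'
      · subst hA
        obtain ⟨s, hs, hs'⟩ := (ihe e' rfl S S').value.self
        exact .plug hΔ S S' (cps_typed R d) (cps_typed R d') (ihd d' hΔ S S').comp hu hu'
          (by simpa only [meetC, if_true] using
            ⟨.copow _ _ _ _ _ _ hs.typed.1.some (.svar _ _)⟩)
          (.capp B B' hs) (.capp B' B hs')
      · exact .plug_of_cunit hΔ S S' (cps_typed R d) (cps_typed R d') (ihd d' hΔ S S').comp hu hu'
          (by simp only [meetC, if_neg hA])
  | top _ =>
    cases d' with
    | top _ =>
      exact RelC.rel S S' _ _ ⟨.svar, by simpa only [meetC, meetS] using ⟨.svar _ _⟩, .top, .top⟩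
  | ilet _ Δ _ _ A d e ihd ihe =>
    cases d' with
    | ilet _ Δ' _ _ A' d' e' =>
      refine RelC.rel S S' _ _ ?_
      rw [cps_ilet, cps_ilet]
      obtain ⟨k, hk, h, h'⟩ := (ihe e' rfl S S').comp
      exact .plug hΔ S S' (cps_typed R d) (cps_typed R d') (ihd d' hΔ S S').comp
        (by simpa only [cpsC, kont, tgt] using (cps_typed R e).kont)
        (by simpa only [cpsC, kont, tgt] using (cps_typed R e').kont)
        (by simpa only [meetC, meetS] using hk) (.ilet h) (.ilet h')
  | bang _ _ V d ih =>
    cases d' with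
    | bang _ _ V' d' =>
      obtain ⟨N, s, hN, hs, h, h'⟩ := (ih d' rfl S S').value
      exact RelC.rel S S' _ _ ⟨.capp .svar s, by
        simpa only [meetC, meetS, hN] using ⟨.capp _ _ _ _ _ _ (.svar _ _) hs.some⟩,
        .bang hN hs h, .bang (meetV_symm R V V' ▸ hN) hs h'⟩
  | banglet Γ Δ _ _ V B d e ihd ihe =>
    cases d' with
    | banglet _ Δ' _ _ V' B' d' e' =>
      refine RelC.rel S S' _ _ ?_
      rw [cps_banglet, cps_banglet]
      have hu : Ty (cpsCtx R Γ) (some (cpsC R B)) (.clam (cpsV R V) (.lapp (cps R e) .svar))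
          (.comp (cpsC R (.bang V))) := by
        simpa only [cpsC] using ⟨.clam _ _ _ _ _ (cps_typed R e).kont.some⟩
      have hu' : Ty (cpsCtx R Γ') (some (cpsC R B')) (.clam (cpsV R V') (.lapp (cps R e') .svar))
          (.comp (cpsC R (.bang V'))) := by
        simpa only [cpsC] using ⟨.clam _ _ _ _ _ (cps_typed R e').kont.some⟩
      cases hN : meetV R V V' with
      | some N =>
        have hN' : meetV R V' V = some N := by rw [meetV_symm, hN]
        obtain ⟨k, hk, h, h'⟩ := (ihe e' rfl (S.coe hN) (S'.coe hN')).comp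
        exact .plug hΔ S S' (cps_typed R d) (cps_typed R d') (ihd d' hΔ S S').comp hu hu'
          (by simpa only [meetC, meetS, hN] using ⟨.clam _ _ _ _ _ hk.some⟩)
          (.banglet S hN (cps_typed R e) h) (.banglet S' hN' (cps_typed R e') h')
      | none =>
        exact .plug_of_cunit hΔ S S' (cps_typed R d) (cps_typed R d') (ihd d' hΔ S S').comp hu hu'
          (by simp only [meetC, hN])
  | copow _ Δ _ _ V B d e ihd ihe =>
    cases d' with
    | copow _ Δ' _ _ V' B' d' e' =>
      refine RelC.rel S S' _ _ ?_
      rw [cps_copow, cps_copow]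
      obtain ⟨N, s, hN, hs, h, h'⟩ := (ihd d' rfl S S').value
      exact .plug hΔ S S' (cps_typed R e) (cps_typed R e') (ihe e' hΔ S S').comp
        (by simpa only [cpsC] using ⟨.capp _ _ _ _ _ _ (.svar _ _) (cps_typed R d).some⟩)
        (by simpa only [cpsC] using ⟨.capp _ _ _ _ _ _ (.svar _ _) (cps_typed R d').some⟩)
        (by simpa only [meetC, hN] using ⟨.capp _ _ _ _ _ _ (.svar _ _) hs.some⟩)
        (.copow B B' hN hs h) (.copow B' B (meetV_symm R V V' ▸ hN) hs h')
  | copowlet Γ Δ _ _ V B C d e ihd ihe =>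
    cases d' with
    | copowlet _ Δ' _ _ V' B' C' d' e' =>
      refine RelC.rel S S' _ _ ?_
      rw [cps_copowlet, cps_copowlet]
      have hu : Ty (cpsCtx R Γ) (some (cpsC R C)) (.clam (cpsV R V) (cps R e))
          (.comp (cpsC R (.copow V B))) := by
        simpa only [cpsC] using ⟨.clam _ _ _ _ _ (cps_typed R e).some⟩
      have hu' : Ty (cpsCtx R Γ') (some (cpsC R C')) (.clam (cpsV R V') (cps R e'))
          (.comp (cpsC R (.copow V' B'))) := by
        simpa only [cpsC] using ⟨.clam _ _ _ _ _ (cps_typed R e').some⟩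
      cases hN : meetV R V V' with
      | some N =>
        have hN' : meetV R V' V = some N := by rw [meetV_symm, hN]
        obtain ⟨k, hk, h, h'⟩ := (ihe e' rfl (S.coe hN) (S'.coe hN')).comp
        exact .plug hΔ S S' (cps_typed R d) (cps_typed R d') (ihd d' hΔ S S').comp hu hu'
          (by simpa only [meetC, meetS, hN] using ⟨.clam _ _ _ _ _ hk.some⟩)
          (.copowlet S hN (cps_typed R e) h.sq) (.copowlet S' hN' (cps_typed R e') h'.sq)
      | none =>
        exact .plug_of_cunit hΔ S S' (cps_typed R d) (cps_typed R d') (ihd d' hΔ S S').comp hu hu'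
          (by simp only [meetC, hN])
  | cimage _ Δ _ A d ih =>
    cases d' with
    | cimage _ Δ' _ _ d' =>
      refine RelC.rel S S' _ _ ?_
      rw [cps_cimage, cps_cimage]
      exact .plug_of_cunit hΔ S S' (cps_typed R d) (cps_typed R d') (ih d' hΔ S S').comp
        (by simpa only [cpsC] using ⟨.cunit _ _⟩) (by simpa only [cpsC] using ⟨.cunit _ _⟩)
        (by simp only [meetC])
  | cinl _ Δ _ A B d ih =>
    cases d' with
    | cinl _ Δ' _ A' B' d' =>
      refine RelC.rel S S' _ _ ?_
      rw [cps_cinl, cps_cinl]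
      exact .plug hΔ S S' (cps_typed R d) (cps_typed R d') (ih d' hΔ S S').comp
        (by simpa only [cpsC] using ⟨.cfst _ _ _ _ _ (.svar _ _)⟩)
        (by simpa only [cpsC] using ⟨.cfst _ _ _ _ _ (.svar _ _)⟩)
        (by simpa only [meetC] using ⟨.cfst _ _ _ _ _ (.svar _ _)⟩)
        (.cinl A A' B B') (.cinl A' A B' B)
  | cinr _ Δ _ A B d ih =>
    cases d' with
    | cinr _ Δ' _ A' B' d' =>
      refine RelC.rel S S' _ _ ?_
      rw [cps_cinr, cps_cinr]
      exact .plug hΔ S S' (cps_typed R d) (cps_typed R d') (ih d' hΔ S S').comp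
        (by simpa only [cpsC] using ⟨.csnd _ _ _ _ _ (.svar _ _)⟩)
        (by simpa only [cpsC] using ⟨.csnd _ _ _ _ _ (.svar _ _)⟩)
        (by simpa only [meetC] using ⟨.csnd _ _ _ _ _ (.svar _ _)⟩)
        (.cinr A A' B B') (.cinr A' A B' B)
  | ccase _ Δ _ _ _ A B C d e f ihd ihe ihf =>
    cases d' with
    | ccase _ Δ' _ _ _ A' B' C' d' e' f' =>
      refine RelC.rel S S' _ _ ?_
      rw [cps_ccase, cps_ccase]
      obtain ⟨k, hk, h1, h1'⟩ := (ihe e' rfl S S').comp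
      obtain ⟨l, hl, h2, h2'⟩ := (ihf f' rfl S S').comp
      exact .plug hΔ S S' (cps_typed R d) (cps_typed R d') (ihd d' hΔ S S').comp
        (by simpa only [cpsC] using
          ⟨.cpair _ _ _ _ _ _ (cps_typed R e).some (cps_typed R f).some⟩)
        (by simpa only [cpsC] using
          ⟨.cpair _ _ _ _ _ _ (cps_typed R e').some (cps_typed R f').some⟩)
        (by simpa only [meetC] using ⟨.cpair _ _ _ _ _ _ hk.some hl.some⟩)
        (.ccase (S.psubst (cps_typed R e)) (S.psubst (cps_typed R f)) h1.sq h2.sq)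
        (.ccase (S'.psubst (cps_typed R e')) (S'.psubst (cps_typed R f')) h1'.sq h2'.sq)
  | llam _ _ A B d ih =>
    cases d' with
    | llam _ _ _ B' d' =>
      obtain ⟨k, hk, h, h'⟩ := (ih d' rfl S S').comp
      simp only [meetS, meetC_self] at hk
      have h2 := HalfV.llam (S'.psubst (cps_typed R d')) (meetC_symm R B B' ▸ hk) h'
      rw [meetC_symm] at h2
      exact RelV.rel ⟨_, .llam (meetC R B B') k, by simp only [meetV, if_true],
        ⟨.llam _ _ _ _ hk.some⟩, .llam (S.psubst (cps_typed R d)) hk h, h2⟩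
  | lapp _ Δ _ _ A B d e ihd ihe =>
    cases d' with
    | lapp _ Δ' _ _ A' B' d' e' =>
      refine RelC.rel S S' _ _ ?_
      rw [cps_lapp, cps_lapp]
      obtain ⟨N, s, hN, hs, h, h'⟩ := (ihd d' rfl S S').value
      simp only [meetV] at hN
      split_ifs at hN with hA
      subst hA
      cases hN
      have hd : Ty _ none (cps R d) (cpsV R (.lin A B)) := cps_typed R d
      have hd' : Ty _ none (cps R d') (cpsV R (.lin A B')) := cps_typed R d'
      simp only [cpsV] at hd hd'
      exact .plug hΔ S S' (cps_typed R e) (cps_typed R e') (ihe e' hΔ S S').comp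
        ⟨.lapp _ _ _ _ _ _ hd.some (.svar _ _)⟩ ⟨.lapp _ _ _ _ _ _ hd'.some (.svar _ _)⟩
        (by simpa only [meetC_self] using ⟨.lapp _ _ _ _ _ _ hs.some (.svar _ _)⟩)
        (.lapp hs h) (.lapp (meetC_symm R B B' ▸ hs) h')

theorem cps_coherent (R : CType) {Γ : List VType} {D B : CType} {t : Tm}
    (d d' : Deriv Γ (some D) t (.comp B)) :
    EEq (cpsCtx R Γ) (some (cpsC R B)) (cps R d) (cps R d') (.comp (cpsC R D)) := by
  obtain ⟨k, hk, h, h'⟩ := (cps_rel R d d' rfl (.refl R Γ) (.refl R Γ)).comp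
  have key : ∀ {u : Tm}, Ty (cpsCtx R Γ) (some (cpsC R B)) u (.comp (cpsC R D)) →
      HalfC R (cpsCtx R Γ) (some D) (some D) B B .var u k →
      EEq (cpsCtx R Γ) (some (cpsC R B)) (ssubst (coeC R B B .svar) k) u (.comp (cpsC R D)) := by
    intro u hu h
    have h := h.sq
    rw [Sq, psubst_var, meetC_self] at h
    exact h.trans (coeC_self R D hu)
  exact (key (cps_typed R d) h).symm.trans (key (cps_typed R d') h')

end EEC

namespace EEC

/-- **Substitution property of the self-translation, value into stoup-typed
term** (Proposition 5.1(2)): if `Γ, x:A | z:D̲ ⊢ t : B̲` and `Γ ⊢ u : A`,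
then `Γᶜ | k_z:B̲ᶜ ⊢ (t[u/x])ᶜ = tᶜ[uᶜ/x] : D̲ᶜ` in the equational theory
of EEC. -/
theorem cps_subst_value_stoup (R : CType) (Γ : List VType) (t u : Tm)
    (A : VType) (D B : CType)
    (dt : Deriv (A :: Γ) (some D) t (.comp B)) (du : Deriv Γ none u A)
    (dtu : Deriv Γ (some D) (Tm.subst0 u t) (.comp B)) :
    EEq (cpsCtx R Γ) (some (cpsC R B)) (cps R dtu)
      (Tm.subst0 (cps R du) (cps R dt)) (.comp (cpsC R D)) := by
  have hu : Ty (cpsCtx R Γ) none (cps R du) (cpsV R A) := cps_typed R du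
  obtain ⟨d, hd⟩ : ∃ d : Deriv Γ (some D) (Tm.psubst (Tm.scons u .var) t) (.comp B),
      cps R d = Tm.psubst (Tm.scons (cps R du) .var) (cps R dt) := by
    refine dt.exists_psubst R (fun n C hn => ?_) fun n => ?_
    · cases n with
      | zero =>
        obtain rfl : A = C := by simpa using hn
        exact ⟨du, rfl⟩
      | succ n => exact ⟨.var _ n C (by simpa using hn), rfl⟩
    · cases n with
      | zero => exact hu.stoupFree
      | succ n => rfl
  rw [Tm.subst0_eq (cps R du), ← hd]
  revert dtu
  rw [Tm.subst0_eq]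
  exact fun dtu => cps_coherent R dtu d

end EEC
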